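/- arXiv:1805.02521 — 3 statements merged into one kernel-verified Lean document; each statement's English description precedes it below -/
import Mathlib

section
/- Dichotomy for minimizing sequences: let μ > 0 and p ∈ (2,6), and let u_n ∈ H¹_μ(𝒢) be a sequence with E_p(u_n) → ℰ_p(μ) such that u_n converges to some u ∈ H¹(𝒢) weakly in H¹(𝒢) and pointwise almost everywhere on 𝒢. Then the lost mass m = μ − ‖u‖_{L²(𝒢)}² satisfies either m = 0 or m = μ. -/
/- Formalization of NLS ground states on the two-dimensional grid 𝒢
   (the planar metric graph with vertex set ℤ×ℤ and unit edges).

   A function `u` on 𝒢 is encoded by the family `h j` of its restrictions to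
   the horizontal lines `H j` and the family `w k` of its restrictions to the
   vertical lines `V k`, subject to the vertex-compatibility conditions
   `h j k = w k j`.  The (weak) derivative of `u` along each line is carried
   as additional data `hd`, `wd`, tied to `h`, `w` by the fundamental theorem
   of calculus in the membership predicates below. -/

open MeasureTheory Filter Topology
open scoped ENNReal NNReal

noncomputable section

/-- A function on the grid 𝒢, together with candidate derivatives along
horizontal and vertical lines. -/
structure GridFunc where
  /-- restriction to the horizontal line `H j` -/
  h : ℤ → ℝ → ℝ
  /-- restriction to the vertical line `V k` -/
  w : ℤ → ℝ → ℝ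
  /-- derivative along the horizontal line `H j` -/
  hd : ℤ → ℝ → ℝ
  /-- derivative along the vertical line `V k` -/
  wd : ℤ → ℝ → ℝ
  /-- vertex compatibility: the values at the vertex `(k, j)` agree -/
  compat : ∀ j k : ℤ, h j (k : ℝ) = w k (j : ℝ)

/-- `∑_j ∫_ℝ |f j|^p + ∑_k ∫_ℝ |g k|^p`, as an extended nonnegative real:
the `p`-th power of the `L^p(𝒢)` norm of the function encoded by `(f, g)`. -/
def gridLpPow (p : ℝ) (f g : ℤ → ℝ → ℝ) : ℝ≥0∞ :=
  (∑' j : ℤ, ∫⁻ x : ℝ, (‖f j x‖₊ : ℝ≥0∞) ^ p) +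
  (∑' k : ℤ, ∫⁻ y : ℝ, (‖g k y‖₊ : ℝ≥0∞) ^ p)

/-- The `L^p(𝒢)` norm of `u`. -/
def GridFunc.lpNorm (u : GridFunc) (p : ℝ) : ℝ≥0∞ :=
  gridLpPow p u.h u.w ^ (1 / p)

/-- The `L^p(𝒢)` norm of the derivative `u'`. -/
def GridFunc.derivLpNorm (u : GridFunc) (p : ℝ) : ℝ≥0∞ :=
  gridLpPow p u.hd u.wd ^ (1 / p)

/-- The `L^∞(𝒢)` norm of `u`: the sup over all lines of the sup norms. -/
def GridFunc.linfNorm (u : GridFunc) : ℝ≥0∞ :=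
  (⨆ j : ℤ, ⨆ x : ℝ, (‖u.h j x‖₊ : ℝ≥0∞)) ⊔
  (⨆ k : ℤ, ⨆ y : ℝ, (‖u.w k y‖₊ : ℝ≥0∞))

/-- `u ∈ H¹(𝒢)`: every line restriction is continuous and is recovered from
its (locally integrable) derivative by integration, and both `‖u‖₂²` and
`‖u'‖₂²` are finite. -/
def GridFunc.MemH1 (u : GridFunc) : Prop :=
  (∀ j, Continuous (u.h j)) ∧ (∀ k, Continuous (u.w k)) ∧
  (∀ j, LocallyIntegrable (u.hd j)) ∧ (∀ k, LocallyIntegrable (u.wd k)) ∧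
  (∀ j x, (∫ t in (0:ℝ)..x, u.hd j t) = u.h j x - u.h j 0) ∧
  (∀ k y, (∫ t in (0:ℝ)..y, u.wd k t) = u.w k y - u.w k 0) ∧
  gridLpPow 2 u.h u.w < ⊤ ∧ gridLpPow 2 u.hd u.wd < ⊤

/-- `u ∈ W^{1,1}(𝒢)`: every line restriction is continuous and is recovered
from its (integrable) derivative by integration, and both `‖u‖₁` and `‖u'‖₁`
are finite. -/
def GridFunc.MemW11 (u : GridFunc) : Prop :=
  (∀ j, Continuous (u.h j)) ∧ (∀ k, Continuous (u.w k)) ∧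
  (∀ j, Integrable (u.hd j)) ∧ (∀ k, Integrable (u.wd k)) ∧
  (∀ j x, (∫ t in (0:ℝ)..x, u.hd j t) = u.h j x - u.h j 0) ∧
  (∀ k y, (∫ t in (0:ℝ)..y, u.wd k t) = u.w k y - u.w k 0) ∧
  gridLpPow 1 u.h u.w < ⊤ ∧ gridLpPow 1 u.hd u.wd < ⊤

/-- The mass `‖u‖_{L²(𝒢)}²` of `u`, as a real number. -/
def GridFunc.mass (u : GridFunc) : ℝ :=
  (gridLpPow 2 u.h u.w).toReal

/-- The NLS energy `E_p(u) = ½‖u'‖₂² − (1/p)‖u‖_p^p`. -/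
def GridFunc.energy (u : GridFunc) (p : ℝ) : ℝ :=
  (1 / 2) * (gridLpPow 2 u.hd u.wd).toReal
    - (1 / p) * (gridLpPow p u.h u.w).toReal

/-- `u` is not identically zero on 𝒢. -/
def GridFunc.Nonzero (u : GridFunc) : Prop :=
  (∃ j x, u.h j x ≠ 0) ∨ (∃ k y, u.w k y ≠ 0)

/-- The Gagliardo–Nirenberg quotient
`Q_p(u) = ‖u‖_p^p / (‖u‖₂^{p−2} ‖u'‖₂²)`. -/
def GridFunc.gnQuot (u : GridFunc) (p : ℝ) : ℝ :=
  (gridLpPow p u.h u.w).toReal /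
    ((gridLpPow 2 u.h u.w).toReal ^ ((p - 2) / 2) *
      (gridLpPow 2 u.hd u.wd).toReal)

/-- The set of Gagliardo–Nirenberg quotients `Q_p(u)` over nontrivial
`u ∈ H¹(𝒢)`; its supremum is the optimal constant `K_p`. -/
def gnSet (p : ℝ) : Set ℝ :=
  {q | ∃ u : GridFunc, u.MemH1 ∧ u.Nonzero ∧ q = u.gnQuot p}

/-- The critical mass `μ_p = (p/(2K))^{2/(p−2)}` associated with the optimal
Gagliardo–Nirenberg constant `K`. -/
def critMass (p K : ℝ) : ℝ :=
  (p / (2 * K)) ^ (2 / (p - 2))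

/-- The `H¹(𝒢)` inner product `⟨u,v⟩_{L²(𝒢)} + ⟨u',v'⟩_{L²(𝒢)}`. -/
def GridFunc.h1Inner (u v : GridFunc) : ℝ :=
  ((∑' j : ℤ, ∫ x : ℝ, u.h j x * v.h j x) +
    (∑' k : ℤ, ∫ y : ℝ, u.w k y * v.w k y)) +
  ((∑' j : ℤ, ∫ x : ℝ, u.hd j x * v.hd j x) +
    (∑' k : ℤ, ∫ y : ℝ, u.wd k y * v.wd k y))

/-- The set of energies `E_p(u)` of functions `u ∈ H¹_μ(𝒢)`; its infimum is
the ground-state energy level `ℰ_p(μ)`. -/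
def energySet (p μ : ℝ) : Set ℝ :=
  {e | ∃ u : GridFunc, u.MemH1 ∧ u.mass = μ ∧ u.energy p = e}

/-- `u` is a ground state of mass `μ`: it belongs to `H¹_μ(𝒢)` and minimizes
the energy `E_p` there. -/
def IsGroundState (p μ : ℝ) (u : GridFunc) : Prop :=
  u.MemH1 ∧ u.mass = μ ∧
    ∀ v : GridFunc, v.MemH1 → v.mass = μ → u.energy p ≤ v.energy p

end

open Filter Topology MeasureTheory

noncomputable section

/-- pointwise inequality for the Brezis-Lieb lemma -/
lemma bl_pt1 (p : ℝ) (hp : 1 < p) (ε : ℝ) (hε : 0 < ε) :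
    ∃ C : ℝ, 0 ≤ C ∧ ∀ x y : ℝ, |x| ^ p ≤ (1 + ε) * |y| ^ p + C * |x - y| ^ p := by
  have hcont : Tendsto (fun t : ℝ => t ^ (1 - p)) (𝓝[<] 1) (𝓝 1) := by
    have : ContinuousAt (fun t : ℝ => t ^ (1 - p)) 1 :=
      Real.continuousAt_rpow_const 1 (1 - p) (Or.inl one_ne_zero)
    have h2 := this.tendsto
    simp only [Real.one_rpow] at h2
    exact h2.mono_left nhdsWithin_le_nhds
  have h1 : ∀ᶠ t : ℝ in 𝓝[<] 1, t ^ (1 - p) < 1 + ε := hcont.eventually_lt_const (by linarith)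
  have h2 : ∀ᶠ t : ℝ in 𝓝[<] 1, t ∈ Set.Ioo (0:ℝ) 1 := Ioo_mem_nhdsLT one_pos
  obtain ⟨t, ht, ht0, ht1⟩ := (h1.and h2).exists
  have hs : 0 < 1 - t := by linarith
  refine ⟨(1 - t) ^ (1 - p), by positivity, fun x y => ?_⟩
  have hconv := (convexOn_rpow hp.le).2 (x := |y| / t) (y := |x - y| / (1 - t))
    (by simp only [Set.mem_Ici]; positivity) (by simp only [Set.mem_Ici]; positivity)
    ht0.le hs.le (by ring)
  simp only [smul_eq_mul] at hconv
  rw [mul_div_cancel₀ _ ht0.ne', mul_div_cancel₀ _ hs.ne'] at hconv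
  have e1 : t * (|y| / t) ^ p = t ^ (1 - p) * |y| ^ p := by
    rw [Real.div_rpow (abs_nonneg _) ht0.le, Real.rpow_sub ht0, Real.rpow_one]; ring
  have e2 : (1 - t) * (|x - y| / (1 - t)) ^ p = (1 - t) ^ (1 - p) * |x - y| ^ p := by
    rw [Real.div_rpow (abs_nonneg _) hs.le, Real.rpow_sub hs, Real.rpow_one]; ring
  rw [e1, e2] at hconv
  have h3 : |x| ≤ |y| + |x - y| := by
    have := abs_add_le y (x - y); simpa using this
  have h4 : |x| ^ p ≤ (|y| + |x - y|) ^ p := Real.rpow_le_rpow (abs_nonneg _) h3 (by linarith)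
  have h5 : t ^ (1 - p) * |y| ^ p ≤ (1 + ε) * |y| ^ p :=
    mul_le_mul_of_nonneg_right ht.le (by positivity)
  linarith

lemma bl_pt2 (p : ℝ) (hp : 1 < p) (ε : ℝ) (hε : 0 < ε) :
    ∃ C : ℝ, 0 ≤ C ∧ ∀ x y : ℝ,
      |(|x| ^ p - |y| ^ p)| ≤ ε * (|x| ^ p + |y| ^ p) + C * |x - y| ^ p := by
  obtain ⟨C, hC, h⟩ := bl_pt1 p hp ε hε
  refine ⟨C, hC, fun x y => ?_⟩
  have h1 := h x y
  have h2 := h y x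
  rw [abs_sub_comm y x] at h2
  have a1 : 0 ≤ |x| ^ p := by positivity
  have a2 : 0 ≤ |y| ^ p := by positivity
  rw [abs_le]
  constructor <;> nlinarith

section
variable {X : Type*} [MeasurableSpace X] {ν : Measure X}

lemma int_sub_rpow (p : ℝ) (hp : 1 < p) {f g : X → ℝ}
    (hfm : AEStronglyMeasurable f ν) (hgm : AEStronglyMeasurable g ν)
    (hf : Integrable (fun x => |f x| ^ p) ν) (hg : Integrable (fun x => |g x| ^ p) ν) :
    Integrable (fun x => |f x - g x| ^ p) ν := by
  obtain ⟨C, hC, h⟩ := bl_pt1 p hp 1 one_pos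
  refine Integrable.mono' ((hf.const_mul (1 + 1)).add (hg.const_mul C)) ?_ ?_
  · exact (((hfm.sub hgm).aemeasurable.norm).pow_const p).aestronglyMeasurable
  · refine Eventually.of_forall fun x => ?_
    have h1 := h (f x - g x) (f x)
    rw [Real.norm_of_nonneg (by positivity)]
    simpa using h1

lemma brezis_lieb (p : ℝ) (hp : 1 < p) {F : ℕ → X → ℝ} {f : X → ℝ} (B : ℝ)
    (hFm : ∀ n, AEStronglyMeasurable (F n) ν) (hfm : AEStronglyMeasurable f ν)
    (hF : ∀ n, Integrable (fun x => |F n x| ^ p) ν) (hf : Integrable (fun x => |f x| ^ p) ν)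
    (hB : ∀ n, ∫ x, |F n x| ^ p ∂ν ≤ B)
    (hlim : ∀ᵐ x ∂ν, Tendsto (fun n => F n x) atTop (𝓝 (f x))) :
    Tendsto (fun n => ∫ x, |F n x| ^ p ∂ν - ∫ x, |F n x - f x| ^ p ∂ν) atTop
      (𝓝 (∫ x, |f x| ^ p ∂ν)) := by
  have hp0 : 0 < p := by linarith
  have hG : ∀ n, Integrable (fun x => |F n x - f x| ^ p) ν := fun n =>
    int_sub_rpow p hp (hFm n) hfm (hF n) hf
  obtain ⟨C1, hC1, h1⟩ := bl_pt1 p hp 1 one_pos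
  set If := ∫ x, |f x| ^ p ∂ν with hIf
  have hIf0 : 0 ≤ If := integral_nonneg fun x => by positivity
  have hB0 : 0 ≤ B := le_trans (integral_nonneg fun x => by positivity) (hB 0)
  set Bq := 2 * B + C1 * If with hBq
  have hGB : ∀ n, ∫ x, |F n x - f x| ^ p ∂ν ≤ Bq := by
    intro n
    have : ∫ x, |F n x - f x| ^ p ∂ν ≤ ∫ x, (1 + 1) * |F n x| ^ p + C1 * |f x| ^ p ∂ν := by
      refine integral_mono (hG n) (((hF n).const_mul (1 + 1)).add (hf.const_mul C1)) fun x => ?_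
      simpa using h1 (F n x - f x) (F n x)
    rw [integral_add ((hF n).const_mul _) (hf.const_mul _), integral_const_mul,
      integral_const_mul] at this
    have := hB n
    linarith
  have hBq0 : 0 ≤ Bq := by positivity
  rw [Metric.tendsto_atTop]
  intro δ hδ
  set ε := δ / (2 * (B + Bq + 1)) with hε
  have hε0 : 0 < ε := by positivity
  obtain ⟨C, hC, h2⟩ := bl_pt2 p hp ε hε0
  let R : ℕ → X → ℝ := fun n x => |F n x| ^ p - |F n x - f x| ^ p - |f x| ^ p
  let S : ℕ → X → ℝ := fun n x => ε * (|F n x| ^ p + |F n x - f x| ^ p)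
  let W : ℕ → X → ℝ := fun n x => max (|R n x| - S n x) 0
  have hRi : ∀ n, Integrable (R n) ν := fun n => ((hF n).sub (hG n)).sub hf
  have hSi : ∀ n, Integrable (S n) ν := fun n => ((hF n).add (hG n)).const_mul ε
  have hWi : ∀ n, Integrable (W n) ν := fun n => ((hRi n).abs.sub (hSi n)).pos_part
  have hWlim : Tendsto (fun n => ∫ x, W n x ∂ν) atTop (𝓝 (∫ x, (0:ℝ) ∂ν)) := by
    refine tendsto_integral_of_dominated_convergence (fun x => (C + 1) * |f x| ^ p)
      (fun n => (hWi n).aestronglyMeasurable) (hf.const_mul _) ?_ ?_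
    · intro n
      refine Eventually.of_forall fun x => ?_
      have a := h2 (F n x) (F n x - f x)
      rw [sub_sub_cancel] at a
      have b : |R n x| ≤ |(|F n x| ^ p - |F n x - f x| ^ p)| + |f x| ^ p := by
        have := abs_sub (|F n x| ^ p - |F n x - f x| ^ p) (|f x| ^ p)
        rwa [abs_of_nonneg (a := |f x| ^ p) (by positivity)] at this
      have c : 0 ≤ |f x| ^ p := by positivity
      rw [Real.norm_of_nonneg (le_max_right _ _)]
      refine max_le ?_ (by positivity)
      simp only [S]
      linarith
    · filter_upwards [hlim] with x hx
      have e1 : Tendsto (fun n => |F n x| ^ p) atTop (𝓝 (|f x| ^ p)) :=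
        (hx.abs).rpow_const (Or.inr hp0.le)
      have e2 : Tendsto (fun n => |F n x - f x| ^ p) atTop (𝓝 0) := by
        have := ((hx.sub_const (f x)).abs).rpow_const (p := p) (Or.inr hp0.le)
        simpa [Real.zero_rpow hp0.ne'] using this
      have e3 : Tendsto (fun n => |R n x|) atTop (𝓝 0) := by
        have := ((e1.sub e2).sub_const (|f x| ^ p)).abs
        simpa using this
      refine squeeze_zero (fun n => le_max_right _ _) (fun n => ?_) e3
      refine max_le ?_ (abs_nonneg _)
      have : 0 ≤ S n x := by simp only [S]; positivity
      linarith
  rw [integral_zero] at hWlim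
  have hev := hWlim.eventually_lt_const (half_pos hδ)
  rw [eventually_atTop] at hev
  obtain ⟨N, hN⟩ := hev
  refine ⟨N, fun n hn => ?_⟩
  have k1 : ∫ x, R n x ∂ν = ∫ x, |F n x| ^ p ∂ν - ∫ x, |F n x - f x| ^ p ∂ν - If := by
    simp only [R]
    have q1 := integral_sub ((hF n).sub (hG n)) hf
    have q2 := integral_sub (hF n) (hG n)
    simp only [Pi.sub_apply] at q1
    rw [q1, q2]
  have k2 : ∫ x, S n x ∂ν ≤ ε * (B + Bq) := by
    simp only [S]
    rw [integral_const_mul, integral_add (hF n) (hG n)]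
    have := hB n
    have := hGB n
    gcongr
  have k3 : |∫ x, R n x ∂ν| ≤ ∫ x, W n x ∂ν + ∫ x, S n x ∂ν := by
    refine (abs_integral_le_integral_abs).trans ?_
    rw [← integral_add (hWi n) (hSi n)]
    refine integral_mono (hRi n).abs ((hWi n).add (hSi n)) fun x => ?_
    have : |R n x| - S n x ≤ W n x := le_max_left _ _
    linarith
  have k4 : ε * (B + Bq) < δ / 2 := by
    rw [hε, div_mul_eq_mul_div, div_lt_iff₀ (by positivity)]
    nlinarith
  rw [Real.dist_eq, ← k1]
  have := hN n hn
  linarith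

lemma int_expand {f g : X → ℝ} (hf : Integrable (fun x => f x ^ 2) ν)
    (hg : Integrable (fun x => g x ^ 2) ν) (hfg : Integrable (fun x => f x * g x) ν) :
    ∫ x, (f x - g x) ^ 2 ∂ν
      = ∫ x, f x ^ 2 ∂ν - 2 * (∫ x, f x * g x ∂ν) + ∫ x, g x ^ 2 ∂ν := by
  have q1 := integral_add (hf.sub (hfg.const_mul 2)) hg
  have q2 := integral_sub hf (hfg.const_mul 2)
  simp only [Pi.sub_apply] at q1
  rw [← integral_const_mul, ← q2, ← q1]
  congr 1; ext x; ring

end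

/-- sublinear growth -/
lemma sublin (C θ : ℝ) (hC : 0 ≤ C) (hθ0 : 0 ≤ θ) (hθ : θ < 1) :
    ∃ K : ℝ, ∀ t : ℝ, 0 ≤ t → C * t ^ θ ≤ t / 4 + K := by
  have h0 : Tendsto (fun t : ℝ => t ^ (-(1 - θ))) atTop (𝓝 0) :=
    tendsto_rpow_neg_atTop (by linarith)
  have h := h0.eventually_lt_const (show (0:ℝ) < 1 / (4 * (C + 1)) by positivity)
  rw [eventually_atTop] at h
  obtain ⟨T, hT⟩ := h
  refine ⟨C * (max T 1) ^ θ, fun t ht => ?_⟩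
  rcases le_total t (max T 1) with h1 | h1
  · have : t ^ θ ≤ (max T 1) ^ θ := Real.rpow_le_rpow ht h1 hθ0
    have := mul_le_mul_of_nonneg_left this hC
    linarith
  · have h2 := hT t ((le_max_left _ _).trans h1)
    have ht0 : 0 < t := lt_of_lt_of_le one_pos ((le_max_right _ _).trans h1)
    have e : t ^ θ = t ^ (-(1 - θ)) * t := by
      nth_rewrite 3 [← Real.rpow_one t]
      rw [← Real.rpow_add ht0]; congr 1; ring
    have h3 : C * t ^ θ ≤ C * (1 / (4 * (C + 1)) * t) := by
      rw [e]; gcongr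
    have h4 : C * (1 / (4 * (C + 1)) * t) ≤ t / 4 := by
      rw [one_div, ← mul_assoc, ← div_eq_mul_inv, div_mul_eq_mul_div,
        div_le_div_iff₀ (by positivity) (by positivity)]
      nlinarith
    have : 0 ≤ C * (max T 1) ^ θ := by positivity
    linarith

/-- one-dimensional sup bound -/
lemma sup_bound {f g : ℝ → ℝ} (hf : Continuous f) (hg : LocallyIntegrable g)
    (hfg : ∀ x, (∫ t in (0:ℝ)..x, g t) = f x - f 0)
    (hf2 : Integrable (fun x => f x ^ 2)) (hg2 : Integrable (fun x => g x ^ 2))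
    (L : ℝ) (hL : 0 < L) (x : ℝ) :
    f x ^ 2 ≤ 2 / L * (∫ x, f x ^ 2) + 2 * L * ∫ x, g x ^ 2 := by
  set D := ∫ x, g x ^ 2 with hD
  have hii : ∀ a b : ℝ, IntervalIntegrable g volume a b := fun a b => intervalIntegrable_iff.2
    ((hg.integrableOn_isCompact isCompact_uIcc).mono_set Set.uIoc_subset_uIcc)
  have key : ∀ y ∈ Set.Icc x (x + L), f x ^ 2 ≤ 2 * f y ^ 2 + 2 * L * D := by
    intro y hy
    have e : ∫ t in x..y, g t = f y - f x := by
      rw [← intervalIntegral.integral_interval_sub_left (hii 0 y) (hii 0 x), hfg, hfg]; ring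
    have cs : (∫ t in x..y, g t) ^ 2 ≤ L * D := by
      rw [intervalIntegral.integral_of_le hy.1]
      set s := Set.Ioc x y
      set I := ∫ t in s, g t with hI
      have hgs : Integrable g (volume.restrict s) := by
        have := (hii x y).1; exact this
      have hgs2 : Integrable (fun t => g t ^ 2) (volume.restrict s) := hg2.restrict
      have hvol : (volume.restrict s).real Set.univ = y - x := by
        simp [s, Measure.real, hy.1]
      have hD2 : ∫ t in s, g t ^ 2 ≤ D :=
        setIntegral_le_integral hg2 (Eventually.of_forall fun t => sq_nonneg _)
      have hDs0 : 0 ≤ ∫ t in s, g t ^ 2 := integral_nonneg fun t => sq_nonneg _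
      have : 0 ≤ ∫ t in s, (L * g t - I) ^ 2 := integral_nonneg fun t => sq_nonneg _
      have e2 : ∫ t in s, (L * g t - I) ^ 2
          = L ^ 2 * (∫ t in s, g t ^ 2) - 2 * L * I * I + (y - x) * I ^ 2 := by
        have : ∀ t, (L * g t - I) ^ 2 = L ^ 2 * g t ^ 2 - 2 * L * I * g t + I ^ 2 := fun t => by ring
        simp_rw [this]
        have q1 := integral_add ((hgs2.const_mul (L ^ 2)).sub (hgs.const_mul (2 * L * I)))
          (integrable_const (I ^ 2))
        have q2 := integral_sub (hgs2.const_mul (L ^ 2)) (hgs.const_mul (2 * L * I))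
        simp only [Pi.sub_apply] at q1
        rw [q1, q2, integral_const_mul,
          integral_const_mul, integral_const, hvol, smul_eq_mul]
      rw [e2] at this
      have hyx : y - x ≤ L := by linarith [hy.2]
      have h6 : (y - x) * I ^ 2 ≤ L * I ^ 2 := mul_le_mul_of_nonneg_right hyx (sq_nonneg _)
      have h7 : L * (I ^ 2) ≤ L * (L * ∫ t in s, g t ^ 2) := by nlinarith
      have h8 := le_of_mul_le_mul_left h7 hL
      nlinarith
    rw [e] at cs
    nlinarith [sq_nonneg (f x - 2 * f y), sq_nonneg (f x), sq_nonneg (2 * f y - f x)]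
  have i1 : ∫ y in x..(x + L), f x ^ 2 ≤ ∫ y in x..(x + L), (2 * f y ^ 2 + 2 * L * D) := by
    refine intervalIntegral.integral_mono_on (by linarith) (by simp) ?_ key
    exact Continuous.intervalIntegrable (by fun_prop) _ _
  rw [intervalIntegral.integral_add (Continuous.intervalIntegrable (by fun_prop) _ _) (by simp),
    intervalIntegral.integral_const_mul, intervalIntegral.integral_const,
    intervalIntegral.integral_const] at i1
  simp only [add_sub_cancel_left, smul_eq_mul] at i1
  have i2 : ∫ y in x..(x + L), f y ^ 2 ≤ ∫ y, f y ^ 2 := by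
    rw [intervalIntegral.integral_of_le (by linarith)]
    exact setIntegral_le_integral hf2 (Eventually.of_forall fun t => sq_nonneg _)
  have i3 : L * f x ^ 2 ≤ L * (2 / L * (∫ x, f x ^ 2) + 2 * L * D) := by
    have : L * (2 / L * (∫ x, f x ^ 2) + 2 * L * D) = 2 * (∫ x, f x ^ 2) + L * (2 * L * D) := by
      field_simp
    rw [this]; linarith
  exact le_of_mul_le_mul_left i3 hL

/-- index type of lines times the real line -/
abbrev GX := (ℤ ⊕ ℤ) × ℝ

lemma gx_emb (i : ℤ ⊕ ℤ) : MeasurableEmbedding (fun x : ℝ => ((i, x) : GX)) := by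
  have : MeasurableSingletonClass (ℤ ⊕ ℤ) := by
    refine ⟨fun a => ?_⟩
    rw [measurableSet_sum_iff]
    exact ⟨(Set.to_countable _).measurableSet, (Set.to_countable _).measurableSet⟩
  exact measurableEmbedding_prodMk_left i

/-- the measure of the grid -/
def gnu : Measure GX := Measure.sum fun i => (volume : Measure ℝ).map fun x => ((i, x) : GX)

/-- joint function -/
def gval (f g : ℤ → ℝ → ℝ) : GX → ℝ := fun x => Sum.elim f g x.1 x.2

lemma gnu_lintegral (F : GX → ℝ≥0∞) :
    ∫⁻ x, F x ∂gnu = ∑' i, ∫⁻ t : ℝ, F (i, t) := by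
  rw [gnu, lintegral_sum_measure]
  congr 1; ext i
  exact (gx_emb i).lintegral_map _

lemma gnu_ae {P : GX → Prop} : (∀ᵐ x ∂gnu, P x) ↔ ∀ i, ∀ᵐ t : ℝ, P (i, t) := by
  rw [gnu, Measure.ae_sum_iff]
  exact forall_congr' fun i => (gx_emb i).ae_map_iff

lemma gnu_aesm {F : GX → ℝ} (h : ∀ i, AEStronglyMeasurable (fun t : ℝ => F (i, t)) volume) :
    AEStronglyMeasurable F gnu := by
  rw [gnu, aestronglyMeasurable_sum_measure_iff]
  intro i
  exact ((gx_emb i).aestronglyMeasurable_map_iff).2 (h i)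

lemma gnu_hasSum {F : GX → ℝ} (h : Integrable F gnu) :
    HasSum (fun i => ∫ t : ℝ, F (i, t)) (∫ x, F x ∂gnu) := by
  have := hasSum_integral_measure h
  simp only [(gx_emb _).integral_map] at this
  exact this

lemma gnu_integral {F : GX → ℝ} (h : Integrable F gnu) :
    ∫ x, F x ∂gnu = (∑' j : ℤ, ∫ t : ℝ, F (.inl j, t)) + ∑' j : ℤ, ∫ t : ℝ, F (.inr j, t) := by
  have hs := gnu_hasSum h
  rw [← hs.tsum_eq]
  exact Summable.tsum_sum (hs.summable.comp_injective Sum.inl_injective)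
    (hs.summable.comp_injective Sum.inr_injective)

lemma gnu_integrable_line {F : GX → ℝ} (h : Integrable F gnu) (i : ℤ ⊕ ℤ) :
    Integrable (fun t : ℝ => F (i, t)) :=
  ((gx_emb i).integrable_map_iff).1 (h.mono_measure (Measure.le_sum _ i))

lemma gnu_integral_line {F : GX → ℝ} (h : Integrable F gnu) (h0 : ∀ x, 0 ≤ F x) (i : ℤ ⊕ ℤ) :
    ∫ t : ℝ, F (i, t) ≤ ∫ x, F x ∂gnu :=
  le_hasSum (gnu_hasSum h) i fun _ _ => integral_nonneg fun _ => h0 _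

lemma gridLpPow_eq (p : ℝ) (f g : ℤ → ℝ → ℝ) :
    gridLpPow p f g = ∫⁻ x, (‖gval f g x‖₊ : ℝ≥0∞) ^ p ∂gnu := by
  rw [gnu_lintegral, Summable.tsum_sum ENNReal.summable ENNReal.summable]
  rfl

lemma enn_rpow (p : ℝ) (hp : 0 ≤ p) (a : ℝ) :
    (‖a‖₊ : ℝ≥0∞) ^ p = ENNReal.ofReal (|a| ^ p) := by
  rw [← ENNReal.ofReal_rpow_of_nonneg (abs_nonneg _) hp, ← Real.norm_eq_abs, ofReal_norm]
  rfl

lemma gridLpPow_toReal (p : ℝ) (hp : 0 ≤ p) (f g : ℤ → ℝ → ℝ)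
    (hm : AEStronglyMeasurable (gval f g) gnu) :
    (gridLpPow p f g).toReal = ∫ x, |gval f g x| ^ p ∂gnu := by
  have hm' : AEStronglyMeasurable (fun x => |gval f g x| ^ p) gnu :=
    ((hm.aemeasurable.norm).pow_const p).aestronglyMeasurable
  rw [gridLpPow_eq, integral_eq_lintegral_of_nonneg_ae
    (Eventually.of_forall fun x => by positivity) hm']
  simp_rw [enn_rpow p hp]

lemma gridLpPow_lt_top (p : ℝ) (hp : 0 ≤ p) (f g : ℤ → ℝ → ℝ)
    (hm : AEStronglyMeasurable (gval f g) gnu) :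
    gridLpPow p f g < ⊤ ↔ Integrable (fun x => |gval f g x| ^ p) gnu := by
  rw [gridLpPow_eq]
  simp_rw [enn_rpow p hp]
  rw [← hasFiniteIntegral_iff_ofReal (Eventually.of_forall fun x => by positivity)]
  exact ⟨fun h => ⟨((hm.aemeasurable.norm).pow_const p).aestronglyMeasurable, h⟩, fun h => h.2⟩

namespace GridFunc

def vl (u : GridFunc) : GX → ℝ := gval u.h u.w
def dr (u : GridFunc) : GX → ℝ := gval u.hd u.wd

variable {u v : GridFunc}

lemma MemH1.cont (hu : u.MemH1) (i : ℤ ⊕ ℤ) : Continuous fun t : ℝ => u.vl (i, t) := by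
  cases i with
  | inl j => exact hu.1 j
  | inr j => exact hu.2.1 j

lemma MemH1.loc (hu : u.MemH1) (i : ℤ ⊕ ℤ) : LocallyIntegrable fun t : ℝ => u.dr (i, t) := by
  cases i with
  | inl j => exact hu.2.2.1 j
  | inr j => exact hu.2.2.2.1 j

lemma MemH1.ftc (hu : u.MemH1) (i : ℤ ⊕ ℤ) (x : ℝ) :
    (∫ t in (0:ℝ)..x, u.dr (i, t)) = u.vl (i, x) - u.vl (i, 0) := by
  cases i with
  | inl j => exact hu.2.2.2.2.1 j x
  | inr j => exact hu.2.2.2.2.2.1 j x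

lemma MemH1.vlm (hu : u.MemH1) : AEStronglyMeasurable u.vl gnu :=
  gnu_aesm fun i => (hu.cont i).aestronglyMeasurable

lemma MemH1.drm (hu : u.MemH1) : AEStronglyMeasurable u.dr gnu :=
  gnu_aesm fun i => (hu.loc i).aestronglyMeasurable

lemma MemH1.vl2 (hu : u.MemH1) : Integrable (fun x => u.vl x ^ 2) gnu := by
  have := (gridLpPow_lt_top 2 (by norm_num) _ _ hu.vlm).1 hu.2.2.2.2.2.2.1
  simp only [Real.rpow_two, sq_abs] at this
  exact this

lemma MemH1.dr2 (hu : u.MemH1) : Integrable (fun x => u.dr x ^ 2) gnu := by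
  have := (gridLpPow_lt_top 2 (by norm_num) _ _ hu.drm).1 hu.2.2.2.2.2.2.2
  simp only [Real.rpow_two, sq_abs] at this
  exact this

lemma MemH1.mass_eq (hu : u.MemH1) : u.mass = ∫ x, u.vl x ^ 2 ∂gnu := by
  have := gridLpPow_toReal 2 (by norm_num) _ _ hu.vlm
  simp only [Real.rpow_two, sq_abs] at this
  exact this

/-- kinetic part -/
def kin (u : GridFunc) : ℝ := ∫ x, u.dr x ^ 2 ∂gnu

/-- potential part -/
def pot (u : GridFunc) (p : ℝ) : ℝ := ∫ x, |u.vl x| ^ p ∂gnu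

lemma kin_nonneg : 0 ≤ u.kin := integral_nonneg fun _ => sq_nonneg _
lemma pot_nonneg (p : ℝ) : 0 ≤ u.pot p := integral_nonneg fun _ => by positivity
lemma mass_nonneg : 0 ≤ u.mass := ENNReal.toReal_nonneg

lemma MemH1.energy_eq (hu : u.MemH1) (p : ℝ) (hp : 0 ≤ p) :
    u.energy p = 1 / 2 * u.kin - 1 / p * u.pot p := by
  have h1 := gridLpPow_toReal 2 (by norm_num) _ _ hu.drm
  simp only [Real.rpow_two, sq_abs] at h1
  have h2 := gridLpPow_toReal p hp _ _ hu.vlm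
  rw [energy, h1, h2]; rfl

lemma MemH1.inner_eq (hu : u.MemH1) (hv : v.MemH1) :
    u.h1Inner v = ∫ x, u.vl x * v.vl x ∂gnu + ∫ x, u.dr x * v.dr x ∂gnu := by
  have i1 : Integrable (fun x => u.vl x * v.vl x) gnu :=
    ((memLp_two_iff_integrable_sq hu.vlm).2 hu.vl2).integrable_mul
      ((memLp_two_iff_integrable_sq hv.vlm).2 hv.vl2)
  have i2 : Integrable (fun x => u.dr x * v.dr x) gnu :=
    ((memLp_two_iff_integrable_sq hu.drm).2 hu.dr2).integrable_mul
      ((memLp_two_iff_integrable_sq hv.drm).2 hv.dr2)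
  rw [gnu_integral i1, gnu_integral i2]
  rfl

lemma MemH1.sup (hu : u.MemH1) (x : GX) :
    u.vl x ^ 2 ≤ 2 * (u.mass + 1) * (u.kin + 1) ^ (1 / 2 : ℝ) := by
  obtain ⟨i, t⟩ := x
  have hD := u.kin_nonneg
  set s := (u.kin + 1) ^ (1 / 2 : ℝ) with hs
  have hs0 : 0 < s := by positivity
  have hss : s * s = u.kin + 1 := by
    rw [hs, ← Real.sqrt_eq_rpow, Real.mul_self_sqrt (by positivity)]
  have h := sup_bound (hu.cont i) (hu.loc i) (hu.ftc i)
    (gnu_integrable_line hu.vl2 i) (gnu_integrable_line hu.dr2 i) (1 / s) (by positivity) t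
  have h1 := gnu_integral_line hu.vl2 (fun _ => sq_nonneg _) i
  have h2 := gnu_integral_line hu.dr2 (fun _ => sq_nonneg _) i
  rw [← hu.mass_eq] at h1
  change _ ≤ u.kin at h2
  have h3 : 2 / (1 / s) * (∫ t, u.vl (i, t) ^ 2) ≤ 2 / (1 / s) * u.mass := by gcongr
  have h4 : 2 * (1 / s) * (∫ t, u.dr (i, t) ^ 2) ≤ 2 * (1 / s) * (s * s) := by
    gcongr; linarith
  have h5 : 2 / (1 / s) * u.mass + 2 * (1 / s) * (s * s) = 2 * (u.mass + 1) * s := by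
    field_simp
  linarith

lemma MemH1.pt (hu : u.MemH1) (p : ℝ) (hp : 2 < p) (x : GX) :
    |u.vl x| ^ p ≤ (2 * (u.mass + 1) * (u.kin + 1) ^ (1 / 2 : ℝ)) ^ ((p - 2) / 2) * u.vl x ^ 2 := by
  have h1 := hu.sup x
  have e : |u.vl x| ^ p = (u.vl x ^ 2) ^ ((p - 2) / 2) * u.vl x ^ 2 := by
    rcases eq_or_ne (u.vl x) 0 with h | h
    · rw [h]; simp [Real.zero_rpow (by linarith : p ≠ 0)]
    · have : 0 < |u.vl x| := abs_pos.2 h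
      rw [← sq_abs, ← Real.rpow_two, ← Real.rpow_mul this.le, ← Real.rpow_add this]
      congr 1; ring
  rw [e]
  have := u.mass_nonneg
  gcongr

lemma MemH1.vlp (hu : u.MemH1) (p : ℝ) (hp : 2 < p) : Integrable (fun x => |u.vl x| ^ p) gnu := by
  refine Integrable.mono' (hu.vl2.const_mul
    ((2 * (u.mass + 1) * (u.kin + 1) ^ (1 / 2 : ℝ)) ^ ((p - 2) / 2)))
    ((hu.vlm.aemeasurable.norm).pow_const p).aestronglyMeasurable
    (Eventually.of_forall fun x => ?_)
  · rw [Real.norm_of_nonneg (by positivity)]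
    exact hu.pt p hp x

lemma MemH1.pot_le (hu : u.MemH1) (p : ℝ) (hp : 2 < p) :
    u.pot p ≤ (2 * (u.mass + 1)) ^ ((p - 2) / 2) * u.mass * (u.kin + 1) ^ ((p - 2) / 4) := by
  have h := integral_mono (hu.vlp p hp) (hu.vl2.const_mul _) (hu.pt p hp)
  rw [integral_const_mul, ← hu.mass_eq] at h
  refine h.trans_eq ?_
  have := u.mass_nonneg
  have := u.kin_nonneg
  rw [Real.mul_rpow (by positivity) (by positivity), ← Real.rpow_mul (by positivity)]
  rw [show (1 / 2 : ℝ) * ((p - 2) / 2) = (p - 2) / 4 by ring]; ring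

lemma coercive (p μ : ℝ) (hp : 2 < p) (hp6 : p < 6) (hμ : 0 < μ) :
    ∃ K : ℝ, ∀ u : GridFunc, u.MemH1 → u.mass = μ →
      u.kin / 4 - K ≤ u.energy p := by
  obtain ⟨K, hK⟩ := sublin (1 / p * ((2 * (μ + 1)) ^ ((p - 2) / 2) * μ)) ((p - 2) / 4)
    (by positivity) (by linarith) (by linarith)
  refine ⟨K + 1 / 4, fun u hu hm => ?_⟩
  have h0 := u.kin_nonneg
  have h1 := hu.pot_le p hp
  have h2 := hK (u.kin + 1) (by linarith)
  rw [hm] at h1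
  have h3 := mul_le_mul_of_nonneg_left h1 (show 0 ≤ 1 / p by positivity)
  rw [hu.energy_eq p (by linarith)]
  linarith

/-- difference of grid functions -/
def sub (u v : GridFunc) : GridFunc where
  h j x := u.h j x - v.h j x
  w j x := u.w j x - v.w j x
  hd j x := u.hd j x - v.hd j x
  wd j x := u.wd j x - v.wd j x
  compat j k := by rw [u.compat, v.compat]

/-- scalar multiple of a grid function -/
def smul (c : ℝ) (u : GridFunc) : GridFunc where
  h j x := c * u.h j x
  w j x := c * u.w j x
  hd j x := c * u.hd j x
  wd j x := c * u.wd j x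
  compat j k := by rw [u.compat]

lemma vl_sub (x : GX) : (u.sub v).vl x = u.vl x - v.vl x := by
  obtain ⟨i | i, t⟩ := x <;> rfl
lemma dr_sub (x : GX) : (u.sub v).dr x = u.dr x - v.dr x := by
  obtain ⟨i | i, t⟩ := x <;> rfl
lemma vl_smul (c : ℝ) (x : GX) : (u.smul c).vl x = c * u.vl x := by
  obtain ⟨i | i, t⟩ := x <;> rfl
lemma dr_smul (c : ℝ) (x : GX) : (u.smul c).dr x = c * u.dr x := by
  obtain ⟨i | i, t⟩ := x <;> rfl

lemma loc_ii {g : ℝ → ℝ} (hg : LocallyIntegrable g) (a b : ℝ) :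
    IntervalIntegrable g volume a b := intervalIntegrable_iff.2
    ((hg.integrableOn_isCompact isCompact_uIcc).mono_set Set.uIoc_subset_uIcc)

lemma MemH1.mk' (h1 : ∀ i, Continuous fun t : ℝ => u.vl (i, t))
    (h2 : ∀ i, LocallyIntegrable fun t : ℝ => u.dr (i, t))
    (h3 : ∀ i (x : ℝ), (∫ t in (0:ℝ)..x, u.dr (i, t)) = u.vl (i, x) - u.vl (i, 0))
    (h4 : Integrable (fun x => u.vl x ^ 2) gnu) (h5 : Integrable (fun x => u.dr x ^ 2) gnu) :
    u.MemH1 := by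
  refine ⟨fun j => h1 (.inl j), fun j => h1 (.inr j), fun j => h2 (.inl j), fun j => h2 (.inr j),
    fun j => h3 (.inl j), fun j => h3 (.inr j), ?_, ?_⟩
  · rw [gridLpPow_lt_top 2 (by norm_num) _ _ (gnu_aesm fun i => (h1 i).aestronglyMeasurable)]
    simp only [Real.rpow_two, sq_abs]
    exact h4
  · rw [gridLpPow_lt_top 2 (by norm_num) _ _ (gnu_aesm fun i => (h2 i).aestronglyMeasurable)]
    simp only [Real.rpow_two, sq_abs]
    exact h5

lemma MemH1.sub (hu : u.MemH1) (hv : v.MemH1) : (u.sub v).MemH1 := by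
  refine MemH1.mk' (fun i => ?_) (fun i => ?_) (fun i x => ?_) ?_ ?_
  · simp only [vl_sub]; exact (hu.cont i).sub (hv.cont i)
  · simp only [dr_sub]; exact (hu.loc i).sub (hv.loc i)
  · simp only [dr_sub, vl_sub]
    rw [intervalIntegral.integral_sub (loc_ii (hu.loc i) _ _) (loc_ii (hv.loc i) _ _),
      hu.ftc, hv.ftc]; ring
  · simp only [vl_sub]
    exact (((memLp_two_iff_integrable_sq hu.vlm).2 hu.vl2).sub
      ((memLp_two_iff_integrable_sq hv.vlm).2 hv.vl2)).integrable_sq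
  · simp only [dr_sub]
    exact (((memLp_two_iff_integrable_sq hu.drm).2 hu.dr2).sub
      ((memLp_two_iff_integrable_sq hv.drm).2 hv.dr2)).integrable_sq

lemma MemH1.smul (c : ℝ) (hu : u.MemH1) : (u.smul c).MemH1 := by
  refine MemH1.mk' (fun i => ?_) (fun i => ?_) (fun i x => ?_) ?_ ?_
  · simp only [vl_smul]; exact (hu.cont i).const_mul c
  · simp only [dr_smul]; exact (hu.loc i).smul c
  · simp only [dr_smul, vl_smul]
    rw [intervalIntegral.integral_const_mul, hu.ftc]; ring
  · simp only [vl_smul, mul_pow]; exact hu.vl2.const_mul _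
  · simp only [dr_smul, mul_pow]; exact hu.dr2.const_mul _

lemma MemH1.mass_smul (c : ℝ) (hu : u.MemH1) : (u.smul c).mass = c ^ 2 * u.mass := by
  rw [(hu.smul c).mass_eq, hu.mass_eq, ← integral_const_mul]
  simp only [vl_smul, mul_pow]

lemma kin_smul (c : ℝ) : (u.smul c).kin = c ^ 2 * u.kin := by
  rw [kin, kin, ← integral_const_mul]
  simp only [dr_smul, mul_pow]

lemma pot_smul (c p : ℝ) : (u.smul c).pot p = |c| ^ p * u.pot p := by
  rw [pot, pot, ← integral_const_mul]
  simp only [vl_smul, abs_mul, Real.mul_rpow (abs_nonneg _) (abs_nonneg _)]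

lemma scaling (p μ : ℝ) (hp : 2 < p) (hp6 : p < 6) (hμ : 0 < μ) (hu : u.MemH1)
    (hm : 0 < u.mass) :
    sInf (energySet p μ) ≤
      1 / 2 * (μ / u.mass * u.kin) - 1 / p * ((μ / u.mass) ^ (p / 2) * u.pot p) := by
  obtain ⟨K, hK⟩ := coercive p μ hp hp6 hμ
  have hbdd : BddBelow (energySet p μ) := by
    refine ⟨-K, ?_⟩
    rintro e ⟨w, hw, hwm, rfl⟩
    have := hK w hw hwm
    have := w.kin_nonneg
    linarith
  have hs : 0 < μ / u.mass := by positivity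
  have hsq : (Real.sqrt (μ / u.mass)) ^ 2 = μ / u.mass := Real.sq_sqrt hs.le
  have hw := hu.smul (Real.sqrt (μ / u.mass))
  have hmem : (u.smul (Real.sqrt (μ / u.mass))).energy p ∈ energySet p μ := by
    refine ⟨_, hw, ?_, rfl⟩
    rw [hu.mass_smul, hsq]; field_simp
  refine (csInf_le hbdd hmem).trans_eq ?_
  rw [hw.energy_eq p (by linarith), kin_smul, pot_smul, hsq, abs_of_nonneg (Real.sqrt_nonneg _),
    Real.sqrt_eq_rpow, ← Real.rpow_mul hs.le]
  rw [show (1 / 2 : ℝ) * p = p / 2 by ring]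

lemma MemH1.pot_pos (hu : u.MemH1) (p : ℝ) (hp : 2 < p) (hm : 0 < u.mass) : 0 < u.pot p := by
  refine lt_of_le_of_ne (u.pot_nonneg p) fun h => ?_
  have h1 := (integral_eq_zero_iff_of_nonneg (fun x => by positivity) (hu.vlp p hp)).1 h.symm
  have h2 : ∫ x, u.vl x ^ 2 ∂gnu = 0 := by
    refine integral_eq_zero_of_ae ?_
    filter_upwards [h1] with x hx
    have : |u.vl x| = 0 := by
      by_contra hne
      have : 0 < |u.vl x| := lt_of_le_of_ne (abs_nonneg _) (Ne.symm hne)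
      have : 0 < |u.vl x| ^ p := by positivity
      simp only [Pi.zero_apply] at hx
      linarith
    simp [abs_eq_zero.1 this]
  rw [hu.mass_eq] at hm
  linarith

end GridFunc

/-- **Dichotomy for minimizing sequences**: let `μ > 0`, `p ∈ (2,6)`, and let
`U n ∈ H¹_μ(𝒢)` be a minimizing sequence for `E_p` (its energies tend to the
ground-state level `ℰ_p(μ)`) converging to `u ∈ H¹(𝒢)` weakly in `H¹(𝒢)` and
pointwise a.e. on 𝒢.  Then the lost mass `m = μ − ‖u‖₂²` is `0` or `μ`. -/
theorem grid_dichotomy (p μ : ℝ) (hp₂ : 2 < p) (hp₆ : p < 6) (hμ : 0 < μ)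
    (U : ℕ → GridFunc) (hU : ∀ n, (U n).MemH1 ∧ (U n).mass = μ)
    (u : GridFunc) (hu : u.MemH1)
    (hmin : Tendsto (fun n => (U n).energy p) atTop (𝓝 (sInf (energySet p μ))))
    (hweak : ∀ v : GridFunc, v.MemH1 →
      Tendsto (fun n => (U n).h1Inner v) atTop (𝓝 (u.h1Inner v)))
    (hae_h : ∀ j : ℤ, ∀ᵐ x : ℝ,
      Tendsto (fun n => (U n).h j x) atTop (𝓝 (u.h j x)))
    (hae_w : ∀ k : ℤ, ∀ᵐ y : ℝ,
      Tendsto (fun n => (U n).w k y) atTop (𝓝 (u.w k y))) :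
    μ - u.mass = 0 ∨ μ - u.mass = μ := by
  set e := sInf (energySet p μ) with he
  have hlim : ∀ᵐ x ∂gnu, Tendsto (fun n => (U n).vl x) atTop (𝓝 (u.vl x)) := by
    rw [gnu_ae]
    rintro (j | j)
    · exact hae_h j
    · exact hae_w j
  have hV : ∀ n, ((U n).sub u).MemH1 := fun n => (hU n).1.sub hu
  -- mass splitting
  have hmass : Tendsto (fun n => ((U n).sub u).mass) atTop (𝓝 (μ - u.mass)) := by
    have h := brezis_lieb (ν := gnu) 2 (by norm_num) (F := fun n => (U n).vl) (f := u.vl) μ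
      (fun n => (hU n).1.vlm) hu.vlm
      (fun n => by simpa only [Real.rpow_two, sq_abs] using (hU n).1.vl2)
      (by simpa only [Real.rpow_two, sq_abs] using hu.vl2)
      (fun n => by
        simp only [Real.rpow_two, sq_abs]
        rw [← (hU n).1.mass_eq, (hU n).2]) hlim
    simp only [Real.rpow_two, sq_abs] at h
    rw [← hu.mass_eq] at h
    have h2 : ∀ n, ∫ x, (U n).vl x ^ 2 ∂gnu - ∫ x, ((U n).vl x - u.vl x) ^ 2 ∂gnu
        = μ - ((U n).sub u).mass := fun n => by
      rw [← (hU n).1.mass_eq, (hU n).2, (hV n).mass_eq]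
      simp only [GridFunc.vl_sub]
    simp only [h2] at h
    simpa using h.const_sub μ
  have hm0 : 0 ≤ μ - u.mass := ge_of_tendsto' hmass fun n => GridFunc.mass_nonneg
  by_contra hcon
  push Not at hcon
  obtain ⟨hc1, hc2⟩ := hcon
  have hum : 0 < u.mass := lt_of_le_of_ne GridFunc.mass_nonneg fun h => hc2 (by rw [← h]; ring)
  have hm : 0 < μ - u.mass := lt_of_le_of_ne hm0 (Ne.symm hc1)
  -- bounds
  obtain ⟨K, hK⟩ := GridFunc.coercive p μ hp₂ hp₆ hμ
  obtain ⟨B, hB⟩ := hmin.bddAbove_range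
  have hEB : ∀ n, (U n).energy p ≤ B := fun n => hB ⟨n, rfl⟩
  have hkinB : ∀ n, (U n).kin ≤ 4 * (B + K) := fun n => by
    have := hK (U n) (hU n).1 (hU n).2
    have := hEB n
    linarith
  have hpotB : ∀ n, (U n).pot p ≤ p * (2 * (B + K) - (-K)) := fun n => by
    have h1 := hK (U n) (hU n).1 (hU n).2
    rw [(hU n).1.energy_eq p (by linarith)] at h1
    have h2 := hkinB n
    have h3 := (U n).kin_nonneg
    have h4 : 1 / p * (U n).pot p ≤ 2 * (B + K) - (-K) := by linarith
    rw [one_div, inv_mul_le_iff₀ (by linarith)] at h4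
    exact h4
  have hpot : Tendsto (fun n => (U n).pot p - ((U n).sub u).pot p) atTop (𝓝 (u.pot p)) := by
    have h := brezis_lieb (ν := gnu) p (by linarith) (F := fun n => (U n).vl) (f := u.vl) _
      (fun n => (hU n).1.vlm) hu.vlm (fun n => (hU n).1.vlp p hp₂) (hu.vlp p hp₂) hpotB hlim
    simp only [← GridFunc.vl_sub] at h
    exact h
  -- kinetic splitting
  have hkin : Tendsto (fun n => (U n).kin - ((U n).sub u).kin) atTop (𝓝 u.kin) := by
    have hw := hweak u hu
    have q : ∀ n, (U n).mass + (U n).kin - ((U n).sub u).mass - ((U n).sub u).kin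
        = 2 * (U n).h1Inner u - u.mass - u.kin := by
      intro n
      have hn := (hU n).1
      have i1 : Integrable (fun x => (U n).vl x * u.vl x) gnu :=
        ((memLp_two_iff_integrable_sq hn.vlm).2 hn.vl2).integrable_mul
          ((memLp_two_iff_integrable_sq hu.vlm).2 hu.vl2)
      have i2 : Integrable (fun x => (U n).dr x * u.dr x) gnu :=
        ((memLp_two_iff_integrable_sq hn.drm).2 hn.dr2).integrable_mul
          ((memLp_two_iff_integrable_sq hu.drm).2 hu.dr2)
      have j1 : ((U n).sub u).mass
          = (U n).mass - 2 * (∫ x, (U n).vl x * u.vl x ∂gnu) + u.mass := by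
        rw [(hV n).mass_eq, hn.mass_eq, hu.mass_eq]
        simp only [GridFunc.vl_sub]
        exact int_expand hn.vl2 hu.vl2 i1
      have j2 : ((U n).sub u).kin
          = (U n).kin - 2 * (∫ x, (U n).dr x * u.dr x ∂gnu) + u.kin := by
        rw [GridFunc.kin, GridFunc.kin, GridFunc.kin]
        simp only [GridFunc.dr_sub]
        exact int_expand hn.dr2 hu.dr2 i2
      rw [hn.inner_eq hu, j1, j2]; ring
    have huu : u.h1Inner u = u.mass + u.kin := by
      rw [hu.inner_eq hu, hu.mass_eq, GridFunc.kin]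
      simp only [← sq]
    have h1 := (((hw.const_mul 2).sub_const u.mass).sub_const u.kin).add hmass
    simp only [← q, (hU _).2] at h1
    rw [huu] at h1
    have h2 := h1.sub_const μ
    convert h2 using 2 <;> ring
  -- energy splitting
  have hp0 : 0 < p := by linarith
  have hE : Tendsto (fun n => ((U n).sub u).energy p) atTop (𝓝 (e - u.energy p)) := by
    have h := hmin.sub ((hkin.const_mul (1 / 2)).sub (hpot.const_mul (1 / p)))
    rw [← hu.energy_eq p hp0.le] at h
    refine h.congr fun n => ?_
    rw [(hU n).1.energy_eq p hp0.le, (hV n).energy_eq p hp0.le]; ring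
  -- lower bound for remainder
  have hlow : e ≤ μ / (μ - u.mass) * (e - u.energy p) := by
    refine ge_of_tendsto ((tendsto_const_nhds.div hmass hm.ne').mul hE) ?_
    filter_upwards [hmass.eventually_const_lt hm,
      hmass.eventually_lt_const (show μ - u.mass < μ by linarith)] with n hn1 hn2
    have h1 := GridFunc.scaling p μ hp₂ hp₆ hμ (hV n) hn1
    have h2 := ((U n).sub u).pot_nonneg p
    have h3 : μ / ((U n).sub u).mass ≤ (μ / ((U n).sub u).mass) ^ (p / 2) := by
      refine Real.self_le_rpow_of_one_le ?_ (by linarith)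
      rw [one_le_div hn1]; linarith
    have h4 : 1 / p * (μ / ((U n).sub u).mass * ((U n).sub u).pot p)
        ≤ 1 / p * ((μ / ((U n).sub u).mass) ^ (p / 2) * ((U n).sub u).pot p) := by
      gcongr
    rw [(hV n).energy_eq p hp0.le]
    simp only [Pi.div_apply]
    linarith
  have hstrict : e < μ / u.mass * u.energy p := by
    have h1 := GridFunc.scaling p μ hp₂ hp₆ hμ hu hum
    have h2 := hu.pot_pos p hp₂ hum
    have h3 : μ / u.mass < (μ / u.mass) ^ (p / 2) := by
      refine Real.self_lt_rpow_of_one_lt ?_ (by linarith)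
      rw [one_lt_div hum]; linarith
    have h4 : 1 / p * (μ / u.mass * u.pot p) < 1 / p * ((μ / u.mass) ^ (p / 2) * u.pot p) := by
      gcongr
    rw [hu.energy_eq p hp0.le]
    linarith
  rw [div_mul_eq_mul_div, le_div_iff₀ hm] at hlow
  rw [div_mul_eq_mul_div, lt_div_iff₀ hum] at hstrict
  linarith

end
end

section
/- Attainment of negative ground-state energy levels: let 2 < p < 6 and μ > 0, and assume ℰ_p(μ) < 0. Then there exists u ∈ H¹_μ(𝒢) such that E_p(u) = ℰ_p(μ), i.e., a ground state of mass μ exists. -/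
/- Formalization of NLS ground states on the two-dimensional grid 𝒢
   (the planar metric graph with vertex set ℤ×ℤ and unit edges).

   A function `u` on 𝒢 is encoded by the family `h j` of its restrictions to
   the horizontal lines `H j` and the family `w k` of its restrictions to the
   vertical lines `V k`, subject to the vertex-compatibility conditions
   `h j k = w k j`.  The (weak) derivative of `u` along each line is carried
   as additional data `hd`, `wd`, tied to `h`, `w` by the fundamental theorem
   of calculus in the membership predicates below. -/

open MeasureTheory Filter Topology
open scoped ENNReal NNReal

noncomputable section

/-- index set of all the lines of the grid: `inl j` is `H j`, `inr k` is `V k` -/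
abbrev GIdx := ℤ ⊕ ℤ

instance : MeasurableSingletonClass GIdx where
  measurableSet_singleton a := by
    rw [measurableSet_sum_iff]
    exact ⟨(Set.to_countable _).measurableSet, (Set.to_countable _).measurableSet⟩

lemma locInt_interval {f : ℝ → ℝ} (hf : LocallyIntegrable f) (a b : ℝ) :
    IntervalIntegrable f volume a b :=
  ⟨(hf.integrableOn_isCompact isCompact_Icc).mono_set Set.Ioc_subset_Icc_self,
    (hf.integrableOn_isCompact isCompact_Icc).mono_set Set.Ioc_subset_Icc_self⟩

/-- the length measure on the disjoint union of all lines -/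
def gridMeas : Measure (GIdx × ℝ) := Measure.sum (fun i : GIdx => volume.map (Prod.mk i))

/-- the function as a function on the disjoint union of the lines -/
def GridFunc.F (u : GridFunc) : GIdx → ℝ → ℝ := Sum.elim u.h u.w
/-- the derivative as a function on the disjoint union of the lines -/
def GridFunc.D (u : GridFunc) : GIdx → ℝ → ℝ := Sum.elim u.hd u.wd

lemma gridEmb (i : GIdx) : MeasurableEmbedding (Prod.mk i : ℝ → GIdx × ℝ) :=
  measurableEmbedding_prodMk_left i

lemma gridMeas_eq : gridMeas = (Measure.count : Measure GIdx).prod volume := by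
  unfold gridMeas Measure.count
  rw [Measure.prod_sum_left]
  congr 1
  ext1 i
  rw [Measure.dirac_prod]

instance : SigmaFinite gridMeas := by
  rw [gridMeas_eq]; infer_instance

lemma lintegral_gridMeas (f : GIdx × ℝ → ℝ≥0∞) :
    ∫⁻ z, f z ∂gridMeas = ∑' i, ∫⁻ x, f (i, x) := by
  unfold gridMeas
  rw [lintegral_sum_measure]
  congr 1; ext1 i
  rw [(gridEmb i).lintegral_map]

lemma gridLpPow_eq_s9 (p : ℝ) (f g : ℤ → ℝ → ℝ) :
    gridLpPow p f g = ∫⁻ z, ‖(Sum.elim f g : GIdx → ℝ → ℝ) z.1 z.2‖ₑ ^ p ∂gridMeas := by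
  rw [lintegral_gridMeas, Summable.tsum_sum ENNReal.summable ENNReal.summable]
  rfl

lemma aesm_grid {f : GIdx → ℝ → ℝ} (hf : ∀ i, AEStronglyMeasurable (f i) volume) :
    AEStronglyMeasurable (fun z : GIdx × ℝ => f z.1 z.2) gridMeas := by
  rw [aestronglyMeasurable_iff_aemeasurable]
  unfold gridMeas
  rw [aemeasurable_sum_measure_iff]
  intro i
  rw [(gridEmb i).aemeasurable_map_iff]
  exact (hf i).aemeasurable

lemma ae_grid {P : GIdx × ℝ → Prop} (h : ∀ᵐ z ∂gridMeas, P z) (i : GIdx) :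
    ∀ᵐ x : ℝ, P (i, x) := by
  unfold gridMeas at h
  rw [Measure.ae_sum_iff] at h
  exact (gridEmb i).ae_map_iff.1 (h i)

/-- uniform version of `MemH1` -/
lemma memH1_iff (u : GridFunc) : u.MemH1 ↔
    (∀ i, Continuous (u.F i)) ∧ (∀ i, LocallyIntegrable (u.D i)) ∧
    (∀ i x, (∫ t in (0:ℝ)..x, u.D i t) = u.F i x - u.F i 0) ∧
    MemLp (fun z : GIdx × ℝ => u.F z.1 z.2) 2 gridMeas ∧
    MemLp (fun z : GIdx × ℝ => u.D z.1 z.2) 2 gridMeas := by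
  have key : ∀ f : GIdx → ℝ → ℝ, (∀ i, AEStronglyMeasurable (f i) volume) →
      ((∫⁻ z, ‖f z.1 z.2‖ₑ ^ (2:ℝ) ∂gridMeas) < ⊤ ↔
        MemLp (fun z : GIdx × ℝ => f z.1 z.2) 2 gridMeas) := by
    intro f hf
    constructor
    · intro h
      refine ⟨aesm_grid hf, ?_⟩
      rw [eLpNorm_lt_top_iff_lintegral_rpow_enorm_lt_top (by norm_num) (by norm_num)]
      simpa using h
    · intro h
      have := (eLpNorm_lt_top_iff_lintegral_rpow_enorm_lt_top (by norm_num) (by norm_num)).1 h.2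
      simpa using this
  unfold GridFunc.MemH1
  rw [gridLpPow_eq_s9, gridLpPow_eq_s9]
  constructor
  · rintro ⟨h1, h2, h3, h4, h5, h6, h7, h8⟩
    have c1 : ∀ i, Continuous (u.F i) := by rintro (j | k); exacts [h1 j, h2 k]
    have c2 : ∀ i, LocallyIntegrable (u.D i) := by rintro (j | k); exacts [h3 j, h4 k]
    refine ⟨c1, c2, ?_, ?_, ?_⟩
    · rintro (j | k); exacts [h5 j, h6 k]
    · exact (key u.F fun i => (c1 i).aestronglyMeasurable).1 h7
    · exact (key u.D fun i => (c2 i).aestronglyMeasurable).1 h8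
  · rintro ⟨c1, c2, h5, h7, h8⟩
    refine ⟨fun j => c1 (.inl j), fun j => c1 (.inr j), fun j => c2 (.inl j), fun j => c2 (.inr j),
      fun j => h5 (.inl j), fun j => h5 (.inr j), ?_, ?_⟩
    · exact (key u.F fun i => (c1 i).aestronglyMeasurable).2 h7
    · exact (key u.D fun i => (c2 i).aestronglyMeasurable).2 h8

lemma toReal_gridLpPow {p : ℝ} (hp : 0 < p) {f g : ℤ → ℝ → ℝ}
    (hm : AEStronglyMeasurable (fun z : GIdx × ℝ => (Sum.elim f g : GIdx → ℝ → ℝ) z.1 z.2)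
      gridMeas) :
    (gridLpPow p f g).toReal =
      ∫ z : GIdx × ℝ, |(Sum.elim f g : GIdx → ℝ → ℝ) z.1 z.2| ^ p ∂gridMeas := by
  rw [gridLpPow_eq_s9, integral_eq_lintegral_of_nonneg_ae]
  · congr 1
    apply lintegral_congr
    intro z
    rw [← Real.enorm_abs, Real.enorm_eq_ofReal (abs_nonneg _),
      ENNReal.ofReal_rpow_of_nonneg (abs_nonneg _) hp.le]
  · exact ae_of_all _ fun z => by positivity
  · have : AEMeasurable (fun z : GIdx × ℝ => (Sum.elim f g : GIdx → ℝ → ℝ) z.1 z.2)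
      gridMeas := hm.aemeasurable
    exact ((this.norm).pow_const p).aestronglyMeasurable

/-- kinetic part -/
def GridFunc.kin_s9 (u : GridFunc) : ℝ := ∫ z : GIdx × ℝ, (u.D z.1 z.2) ^ 2 ∂gridMeas
/-- potential part -/
def GridFunc.pot_s9 (u : GridFunc) (p : ℝ) : ℝ := ∫ z : GIdx × ℝ, |u.F z.1 z.2| ^ p ∂gridMeas

lemma mass_eq {u : GridFunc} (hu : u.MemH1) :
    u.mass = ∫ z : GIdx × ℝ, (u.F z.1 z.2) ^ 2 ∂gridMeas := by
  have := toReal_gridLpPow (p := 2) (by norm_num) ((memH1_iff u).1 hu).2.2.2.1.1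
  unfold GridFunc.mass
  rw [this]
  simp [GridFunc.F]

lemma energy_eq {u : GridFunc} (hu : u.MemH1) {p : ℝ} (hp : 0 < p) :
    u.energy p = 1 / 2 * u.kin_s9 - 1 / p * u.pot_s9 p := by
  have h1 := toReal_gridLpPow (p := 2) (by norm_num) ((memH1_iff u).1 hu).2.2.2.2.1
  have h2 := toReal_gridLpPow (p := p) hp ((memH1_iff u).1 hu).2.2.2.1.1
  unfold GridFunc.energy
  rw [h1, h2]
  simp [GridFunc.F, GridFunc.D, GridFunc.kin_s9, GridFunc.pot_s9]

/-- linear combination -/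
def GridFunc.comb (a : ℝ) (u : GridFunc) (b : ℝ) (v : GridFunc) : GridFunc where
  h j x := a * u.h j x + b * v.h j x
  w j x := a * u.w j x + b * v.w j x
  hd j x := a * u.hd j x + b * v.hd j x
  wd j x := a * u.wd j x + b * v.wd j x
  compat j k := by rw [u.compat, v.compat]

lemma comb_F (a : ℝ) (u : GridFunc) (b : ℝ) (v : GridFunc) (i : GIdx) :
    (u.comb a b v).F i = fun x => a * u.F i x + b * v.F i x := by
  rcases i with j | k <;> rfl

lemma comb_D (a : ℝ) (u : GridFunc) (b : ℝ) (v : GridFunc) (i : GIdx) :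
    (u.comb a b v).D i = fun x => a * u.D i x + b * v.D i x := by
  rcases i with j | k <;> rfl

lemma comb_memH1 (a : ℝ) {u : GridFunc} (b : ℝ) {v : GridFunc} (hu : u.MemH1) (hv : v.MemH1) :
    (u.comb a b v).MemH1 := by
  rw [memH1_iff] at *
  obtain ⟨u1, u2, u3, u4, u5⟩ := hu
  obtain ⟨v1, v2, v3, v4, v5⟩ := hv
  refine ⟨?_, ?_, ?_, ?_, ?_⟩
  · intro i; rw [comb_F]; have := u1 i; have := v1 i; fun_prop
  · intro i; rw [comb_D]; exact ((u2 i).smul a).add ((v2 i).smul b)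
  · intro i x
    rw [comb_D, comb_F, intervalIntegral.integral_add, intervalIntegral.integral_const_mul,
      intervalIntegral.integral_const_mul, u3, v3]
    · ring
    · exact (locInt_interval (u2 i) _ _).const_mul a
    · exact (locInt_interval (v2 i) _ _).const_mul b
  · simp only [comb_F]; exact (u4.const_mul a).add (v4.const_mul b)
  · simp only [comb_D]; exact (u5.const_mul a).add (v5.const_mul b)

end

noncomputable section

lemma section_int {f : GIdx × ℝ → ℝ} (hf : Integrable f gridMeas) (h0 : ∀ z, 0 ≤ f z) (i : GIdx) :
    Integrable (fun x => f (i, x)) ∧ ∫ x, f (i, x) ≤ ∫ z, f z ∂gridMeas := by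
  have hle : volume.map (Prod.mk i) ≤ gridMeas := Measure.le_sum _ i
  constructor
  · exact (gridEmb i).integrable_map_iff.1 (hf.mono_measure hle)
  · have := integral_mono_measure hle (ae_of_all _ h0) hf
    rwa [(gridEmb i).integral_map] at this

lemma cs_interval {f : ℝ → ℝ} {x y : ℝ} (hxy : y < x) (hf : IntervalIntegrable f volume y x)
    (hf2 : IntervalIntegrable (fun t => f t ^ 2) volume y x) :
    (∫ t in y..x, f t) ^ 2 ≤ (x - y) * ∫ t in y..x, f t ^ 2 := by
  set A := ∫ t in y..x, f t with hA
  set B := ∫ t in y..x, f t ^ 2 with hB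
  have hL : 0 < x - y := sub_pos.2 hxy
  set c := A / (x - y) with hc
  have h0 : 0 ≤ ∫ t in y..x, (f t - c) ^ 2 :=
    intervalIntegral.integral_nonneg hxy.le fun t _ => sq_nonneg _
  have h1 : ∫ t in y..x, (f t - c) ^ 2 = B - 2 * c * A + c ^ 2 * (x - y) := by
    have : ∀ t, (f t - c) ^ 2 = f t ^ 2 - 2 * c * f t + c ^ 2 := fun t => by ring
    simp_rw [this]
    rw [intervalIntegral.integral_add (hf2.sub (hf.const_mul _)) (by simp),
      intervalIntegral.integral_sub hf2 (hf.const_mul _), intervalIntegral.integral_const_mul,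
      intervalIntegral.integral_const]
    simp; ring
  rw [h1, hc] at h0
  have : (x - y) * (B - 2 * (A / (x - y)) * A + (A / (x - y)) ^ 2 * (x - y)) =
      (x - y) * B - A ^ 2 := by
    field_simp; ring
  nlinarith [mul_nonneg hL.le h0]

lemma mass_nonneg (u : GridFunc) : 0 ≤ u.mass := ENNReal.toReal_nonneg
lemma kin_nonneg (u : GridFunc) : 0 ≤ u.kin_s9 := integral_nonneg fun _ => sq_nonneg _
lemma pot_nonneg (u : GridFunc) (p : ℝ) : 0 ≤ u.pot_s9 p := integral_nonneg fun _ => by positivity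

lemma holder_lt {u : GridFunc} (hu : u.MemH1) (i : GIdx) {x y : ℝ} (hxy : y < x) :
    (u.F i x - u.F i y) ^ 2 ≤ (x - y) * u.kin_s9 := by
  obtain ⟨u1, u2, u3, u4, u5⟩ := (memH1_iff u).1 hu
  have hD := section_int u5.integrable_sq (fun z => sq_nonneg _) i
  have hI : ∀ a b, IntervalIntegrable (u.D i) volume a b := locInt_interval (u2 i)
  have e : ∫ t in y..x, u.D i t = u.F i x - u.F i y := by
    have := intervalIntegral.integral_interval_sub_left (hI 0 x) (hI 0 y)
    rw [← this, u3, u3]; ring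
  rw [← e]
  refine (cs_interval hxy (hI y x) hD.1.intervalIntegrable).trans ?_
  refine mul_le_mul_of_nonneg_left ?_ (sub_pos.2 hxy).le
  refine le_trans ?_ hD.2
  rw [intervalIntegral.integral_of_le hxy.le]
  exact setIntegral_le_integral hD.1 (ae_of_all _ fun z => sq_nonneg _)

lemma holder {u : GridFunc} (hu : u.MemH1) (i : GIdx) (x y : ℝ) :
    (u.F i x - u.F i y) ^ 2 ≤ |x - y| * u.kin_s9 := by
  rcases lt_trichotomy x y with h | h | h
  · rw [abs_sub_comm, abs_of_pos (sub_pos.2 h)]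
    have := holder_lt hu i h
    nlinarith
  · subst h; simp
  · rw [abs_of_pos (sub_pos.2 h)]
    exact holder_lt hu i h

lemma sup_bound_s9 {u : GridFunc} (hu : u.MemH1) (i : GIdx) (x : ℝ) {l : ℝ} (hl : 0 < l) :
    (u.F i x) ^ 2 ≤ 2 * u.mass / l + 2 * l * u.kin_s9 := by
  obtain ⟨u1, u2, u3, u4, u5⟩ := (memH1_iff u).1 hu
  have hF := section_int u4.integrable_sq (fun z => sq_nonneg _) i
  have hk := kin_nonneg u
  have h1 : ∫ y in x..(x+l), (u.F i x) ^ 2 ≤ ∫ y in x..(x+l), (2 * (u.F i y) ^ 2 + 2 * l * u.kin_s9) := by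
    have hc := u1 i
    apply intervalIntegral.integral_mono_on (by linarith)
    · simp
    · apply Continuous.intervalIntegrable; fun_prop
    · intro y hy
      have h2 := holder hu i x y
      have h3 : |x - y| ≤ l := by rw [abs_le]; constructor <;> linarith [hy.1, hy.2]
      have h4 := mul_le_mul_of_nonneg_right h3 hk
      nlinarith [sq_nonneg (u.F i x - 2 * u.F i y)]
  have h2 : ∫ y in x..(x+l), (u.F i y) ^ 2 ≤ u.mass := by
    rw [mass_eq hu]
    refine le_trans ?_ hF.2
    rw [intervalIntegral.integral_of_le (by linarith)]
    exact setIntegral_le_integral hF.1 (ae_of_all _ fun z => sq_nonneg _)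
  rw [intervalIntegral.integral_add (hF.1.intervalIntegrable.const_mul 2) (by simp),
    intervalIntegral.integral_const_mul] at h1
  simp at h1
  have : l * (2 * u.mass / l + 2 * l * u.kin_s9) = 2 * u.mass + l * (2 * l * u.kin_s9) := by
    field_simp
  have h5 : l * (u.F i x) ^ 2 ≤ l * (2 * u.mass / l + 2 * l * u.kin_s9) := by
    rw [this]; linarith
  exact le_of_mul_le_mul_left h5 hl

lemma sup_bound_one {u : GridFunc} (hu : u.MemH1) (i : GIdx) (x : ℝ) :
    |u.F i x| ≤ √(2 * u.mass + 2 * u.kin_s9) := by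
  apply Real.abs_le_sqrt
  have := sup_bound_s9 hu i x one_pos
  linarith

lemma rpow_le_of_bdd {p a S : ℝ} (hp : 2 ≤ p) (h : |a| ≤ S) :
    |a| ^ p ≤ S ^ (p - 2) * a ^ 2 := by
  rcases eq_or_ne a 0 with rfl | ha
  · simp; rw [Real.zero_rpow (by linarith)]
  have : |a| ^ p = |a| ^ (p - 2) * a ^ 2 := by
    rw [← sq_abs a, ← Real.rpow_natCast, ← Real.rpow_add (abs_pos.2 ha)]
    congr 1; push_cast; ring
  rw [this]
  gcongr

lemma pot_integrable {u : GridFunc} (hu : u.MemH1) {p : ℝ} (hp : 2 ≤ p) :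
    Integrable (fun z : GIdx × ℝ => |u.F z.1 z.2| ^ p) gridMeas := by
  obtain ⟨u1, u2, u3, u4, u5⟩ := (memH1_iff u).1 hu
  refine (u4.integrable_sq.const_mul (√(2 * u.mass + 2 * u.kin_s9) ^ (p - 2))).mono' ?_ ?_
  · exact (u4.1.aemeasurable.norm.pow_const p).aestronglyMeasurable
  · refine ae_of_all _ fun z => ?_
    rw [Real.norm_of_nonneg (by positivity)]
    exact rpow_le_of_bdd hp (sup_bound_one hu _ _)

lemma pot_le {u : GridFunc} (hu : u.MemH1) {p S : ℝ} (hp : 2 ≤ p) (hS : ∀ i x, |u.F i x| ≤ S) :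
    u.pot_s9 p ≤ S ^ (p - 2) * u.mass := by
  obtain ⟨u1, u2, u3, u4, u5⟩ := (memH1_iff u).1 hu
  rw [mass_eq hu, ← integral_const_mul]
  exact integral_mono (pot_integrable hu hp) (u4.integrable_sq.const_mul _)
    fun z => rpow_le_of_bdd hp (hS _ _)

lemma coercive {p μ : ℝ} (hp₂ : 2 < p) (hp₆ : p < 6) (hμ : 0 < μ) :
    ∃ C : ℝ, ∀ u : GridFunc, u.MemH1 → u.mass = μ → 1 / 4 * u.kin_s9 - C ≤ u.energy p := by
  set α := (p - 2) / 4 with hα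
  have hα0 : 0 < α := by rw [hα]; linarith
  have hα1 : α < 1 := by rw [hα]; linarith
  set K : ℝ := 1 / p * ((4 * √μ) ^ ((p - 2) / 2) * μ) with hK
  have hK0 : 0 < K := by have : 0 < p := by linarith
                         positivity
  set B : ℝ := (K * 4 ^ α) ^ (1 / (1 - α)) with hB
  have hB0 : 0 < B := by positivity
  refine ⟨1 / 4 + B, fun u hu hm => ?_⟩
  rw [energy_eq hu (by linarith)]
  set T := u.kin_s9 + 1 with hT
  have hT0 : 0 < T := by have := kin_nonneg u; linarith
  have hs : ∀ i x, |u.F i x| ≤ √(4 * √μ * √T) := by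
    intro i x
    apply Real.abs_le_sqrt
    have hl : 0 < √μ / √T := by positivity
    have := sup_bound_s9 hu i x hl
    rw [hm] at this
    refine this.trans ?_
    have e1 : 2 * μ / (√μ / √T) = 2 * √μ * √T := by
      have : √μ * √μ = μ := Real.mul_self_sqrt hμ.le
      have h0 : √μ ≠ 0 := by positivity
      field_simp
      rw [Real.sq_sqrt hμ.le]
    have e2 : 2 * (√μ / √T) * T = 2 * √μ * √T := by
      have h0 : √T ≠ 0 := by positivity
      field_simp
      rw [Real.sq_sqrt hT0.le]
    have : 2 * (√μ / √T) * u.kin_s9 ≤ 2 * (√μ / √T) * T := by gcongr; linarith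
    linarith
  have hP := pot_le hu hp₂.le hs
  have e : √(4 * √μ * √T) ^ (p - 2) = (4 * √μ) ^ ((p - 2) / 2) * T ^ α := by
    rw [Real.sqrt_eq_rpow, ← Real.rpow_mul (by positivity), Real.mul_rpow (by positivity) (by positivity),
      Real.sqrt_eq_rpow T, ← Real.rpow_mul hT0.le]
    congr 2 <;> (try rw [hα]) <;> ring
  rw [e, hm] at hP
  have h1 : 1 / p * u.pot_s9 p ≤ K * T ^ α := by
    have : 0 < 1 / p := by have : 0 < p := by linarith
                           positivity
    calc 1 / p * u.pot_s9 p ≤ 1 / p * ((4 * √μ) ^ ((p - 2) / 2) * T ^ α * μ) := by gcongr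
      _ = _ := by rw [hK]; ring
  have h2 := Real.geom_mean_le_arith_mean2_weighted hα0.le (sub_pos.2 hα1).le
    (by positivity : 0 ≤ T / 4) hB0.le (by ring)
  have h3 : B ^ (1 - α) = K * 4 ^ α := by
    rw [hB, ← Real.rpow_mul (by positivity), one_div_mul_cancel (by linarith), Real.rpow_one]
  rw [h3, Real.div_rpow hT0.le (by norm_num)] at h2
  have h4 : T ^ α / 4 ^ α * (K * 4 ^ α) = K * T ^ α := by
    have : (4:ℝ) ^ α ≠ 0 := by positivity
    field_simp
  rw [h4] at h2
  have h5 : α * (T / 4) ≤ T / 4 := by nlinarith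
  have h6 : (1 - α) * B ≤ B := by nlinarith
  linarith

/-- swap horizontal and vertical lines -/
def GridFunc.swap (u : GridFunc) : GridFunc where
  h := u.w
  w := u.h
  hd := u.wd
  wd := u.hd
  compat j k := (u.compat k j).symm

lemma gridLpPow_comm (p : ℝ) (f g : ℤ → ℝ → ℝ) : gridLpPow p f g = gridLpPow p g f := by
  unfold gridLpPow; rw [add_comm]

lemma swap_memH1 {u : GridFunc} (hu : u.MemH1) : u.swap.MemH1 := by
  obtain ⟨h1, h2, h3, h4, h5, h6, h7, h8⟩ := hu
  refine ⟨h2, h1, h4, h3, h6, h5, ?_, ?_⟩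
  · rw [gridLpPow_comm]; exact h7
  · rw [gridLpPow_comm]; exact h8

lemma swap_mass (u : GridFunc) : u.swap.mass = u.mass := by
  unfold GridFunc.mass; rw [gridLpPow_comm]; rfl

lemma swap_energy (u : GridFunc) (p : ℝ) : u.swap.energy p = u.energy p := by
  unfold GridFunc.energy
  rw [gridLpPow_comm p, gridLpPow_comm 2]; rfl

/-- translation by a lattice vector -/
def GridFunc.trans (u : GridFunc) (a b : ℤ) : GridFunc where
  h j x := u.h (j + b) (x + a)
  w k y := u.w (k + a) (y + b)
  hd j x := u.hd (j + b) (x + a)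
  wd k y := u.wd (k + a) (y + b)
  compat j k := by
    have := u.compat (j + b) (k + a)
    push_cast at this
    exact this

lemma gridLpPow_trans (p : ℝ) (f g : ℤ → ℝ → ℝ) (a b : ℤ) :
    gridLpPow p (fun j x => f (j + b) (x + a)) (fun k y => g (k + a) (y + b)) =
      gridLpPow p f g := by
  unfold gridLpPow
  congr 1
  · rw [← (Equiv.addRight b).tsum_eq (fun j : ℤ => ∫⁻ x : ℝ, (‖f j x‖₊ : ℝ≥0∞) ^ p)]
    congr 1; ext1 j
    exact lintegral_add_right_eq_self (μ := volume)
      (fun x : ℝ => (‖f (j + b) x‖₊ : ℝ≥0∞) ^ p) (a : ℝ)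
  · rw [← (Equiv.addRight a).tsum_eq (fun j : ℤ => ∫⁻ x : ℝ, (‖g j x‖₊ : ℝ≥0∞) ^ p)]
    congr 1; ext1 j
    exact lintegral_add_right_eq_self (μ := volume)
      (fun x : ℝ => (‖g (j + a) x‖₊ : ℝ≥0∞) ^ p) (b : ℝ)

lemma ftc_shift {f d : ℝ → ℝ} (hd : LocallyIntegrable d)
    (h : ∀ x, (∫ t in (0:ℝ)..x, d t) = f x - f 0) (a : ℝ) (x : ℝ) :
    (∫ t in (0:ℝ)..x, d (t + a)) = f (x + a) - f (0 + a) := by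
  rw [intervalIntegral.integral_comp_add_right]
  have := intervalIntegral.integral_interval_sub_left (locInt_interval hd 0 (x + a))
    (locInt_interval hd 0 (0 + a))
  rw [← this, h, h]; ring

lemma locInt_shift {d : ℝ → ℝ} (hd : LocallyIntegrable d) (a : ℝ) :
    LocallyIntegrable (fun x => d (x + a)) := by
  rw [locallyIntegrable_iff]
  intro k hk
  have h1 : IntegrableOn d ((fun x => x + a) '' k) :=
    hd.integrableOn_isCompact (hk.image (by fun_prop))
  have h2 := (measurePreserving_add_right (volume : Measure ℝ) a).integrableOn_image
    (measurableEmbedding_addRight a) (f := d) (s := k)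
  exact h2.1 h1

lemma trans_memH1 {u : GridFunc} (hu : u.MemH1) (a b : ℤ) : (u.trans a b).MemH1 := by
  obtain ⟨h1, h2, h3, h4, h5, h6, h7, h8⟩ := hu
  refine ⟨fun j => ?_, fun k => ?_, fun j => locInt_shift (h3 _) _, fun k => locInt_shift (h4 _) _,
    fun j x => ftc_shift (h3 _) (h5 _) _ _, fun j x => ftc_shift (h4 _) (h6 _) _ _, ?_, ?_⟩
  · exact (h1 (j + b)).comp (by fun_prop : Continuous fun x : ℝ => x + a)
  · exact (h2 (k + a)).comp (by fun_prop : Continuous fun x : ℝ => x + b)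
  · exact (gridLpPow_trans 2 u.h u.w a b).trans_lt h7
  · exact (gridLpPow_trans 2 u.hd u.wd a b).trans_lt h8

lemma trans_mass (u : GridFunc) (a b : ℤ) : (u.trans a b).mass = u.mass :=
  congrArg ENNReal.toReal (gridLpPow_trans 2 u.h u.w a b)

lemma trans_energy (u : GridFunc) (a b : ℤ) (p : ℝ) : (u.trans a b).energy p = u.energy p := by
  unfold GridFunc.energy
  have e1 := gridLpPow_trans 2 u.hd u.wd a b
  have e2 := gridLpPow_trans p u.h u.w a b
  simp only [GridFunc.trans]
  rw [e1, e2]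

lemma recenter_h {u : GridFunc} (hu : u.MemH1) (p : ℝ) (j : ℤ) (x : ℝ) :
    ∃ v : GridFunc, v.MemH1 ∧ v.mass = u.mass ∧ v.energy p = u.energy p ∧
      ∃ y ∈ Set.Icc (0:ℝ) 1, v.F (.inl 0) y = u.h j x := by
  refine ⟨u.trans ⌊x⌋ j, trans_memH1 hu _ _, trans_mass _ _ _, trans_energy _ _ _ _,
    x - ⌊x⌋, ⟨?_, ?_⟩, ?_⟩
  · exact sub_nonneg.2 (Int.floor_le x)
  · linarith [Int.lt_floor_add_one x]
  · simp [GridFunc.F, GridFunc.trans]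

lemma recenter {u : GridFunc} (hu : u.MemH1) (p : ℝ) (i : GIdx) (x : ℝ) :
    ∃ v : GridFunc, v.MemH1 ∧ v.mass = u.mass ∧ v.energy p = u.energy p ∧
      ∃ y ∈ Set.Icc (0:ℝ) 1, v.F (.inl 0) y = u.F i x := by
  rcases i with j | k
  · exact recenter_h hu p j x
  · have := recenter_h (swap_memH1 hu) p k x
    rwa [swap_mass, swap_energy] at this

/-- nonvanishing -/
lemma nonvanish {p μ c : ℝ} (hp₂ : 2 < p) (hμ : 0 < μ) (hc : 0 < c) :
    ∃ δ : ℝ, 0 < δ ∧ ∀ u : GridFunc, u.MemH1 → u.mass = μ → u.energy p ≤ -c →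
      ∃ i x, δ ≤ |u.F i x| := by
  set δ : ℝ := (p * c / μ) ^ (1 / (p - 2)) with hδ
  have hp : 0 < p := by linarith
  refine ⟨δ / 2, by positivity, fun u hu hm he => ?_⟩
  by_contra! hcon
  have h := pot_le hu hp₂.le fun i x => (hcon i x).le
  have h1 : (δ / 2) ^ (p - 2) < δ ^ (p - 2) := by
    apply Real.rpow_lt_rpow (by positivity) _ (by linarith)
    have : 0 < δ := by positivity
    linarith
  have h2 : δ ^ (p - 2) = p * c / μ := by
    rw [hδ, ← Real.rpow_mul (by positivity), one_div_mul_cancel (by linarith), Real.rpow_one]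
  rw [energy_eq hu hp] at he
  rw [hm] at h
  have h3 : (δ / 2) ^ (p - 2) * μ < p * c := by
    rw [h2, lt_div_iff₀ hμ] at h1; exact h1
  have h4 : c ≤ 1 / p * u.pot_s9 p := by have := kin_nonneg u; linarith
  rw [one_div_mul_eq_div, le_div_iff₀ hp] at h4
  linarith

end

noncomputable section

instance : Fact ((2 : ℝ≥0∞) ≠ ∞) := ⟨by norm_num⟩

lemma cross_tendsto {X : Type*} [MeasurableSpace X] {ν : Measure X} {a : ℕ → X → ℝ} {b : X → ℝ}
    {C : ℝ} (ha : ∀ n, MemLp (a n) 2 ν) (hb : MemLp b 2 ν) (hC : ∀ n, ∫ z, a n z ^ 2 ∂ν ≤ C)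
    (hlim : ∀ z, Tendsto (fun n => a n z) atTop (𝓝 0)) :
    Tendsto (fun n => ∫ z, |a n z| * |b z| ∂ν) atTop (𝓝 0) := by
  have hC0 : 0 ≤ C := (integral_nonneg fun z => sq_nonneg _).trans (hC 0)
  have h1 : ∀ K : ℝ, 0 < K →
      Tendsto (fun n => ∫ z, min |a n z| (K * |b z|) * |b z| ∂ν) atTop (𝓝 0) := by
    intro K hK
    have := tendsto_integral_of_dominated_convergence (μ := ν)
      (F := fun n z => min |a n z| (K * |b z|) * |b z|) (f := fun _ => 0) (fun z => K * b z ^ 2)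
      ?_ (hb.integrable_sq.const_mul K) ?_ ?_
    · simpa using this
    · intro n
      have m1 := (ha n).1.aemeasurable.norm
      have m2 := hb.1.aemeasurable.norm
      exact ((m1.min (m2.const_mul K)).mul m2).aestronglyMeasurable
    · intro n
      refine ae_of_all _ fun z => ?_
      rw [Real.norm_of_nonneg (by positivity)]
      calc min |a n z| (K * |b z|) * |b z| ≤ (K * |b z|) * |b z| := by
            gcongr; exact min_le_right _ _
        _ = K * b z ^ 2 := by rw [← sq_abs (b z)]; ring
    · refine ae_of_all _ fun z => ?_
      have h := (hlim z).abs
      rw [abs_zero] at h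
      refine squeeze_zero (fun n => by positivity) (fun n => ?_)
        (by simpa using h.mul_const |b z|)
      gcongr; exact min_le_left _ _
  rw [Metric.tendsto_atTop]
  intro ε hε
  obtain ⟨N, hN⟩ := (Metric.tendsto_atTop.1 (h1 (2 * (C + 1) / ε) (by positivity))) (ε / 2) (by positivity)
  refine ⟨N, fun n hn => ?_⟩
  have h2 := hN n hn
  rw [Real.dist_eq, sub_zero, abs_of_nonneg (integral_nonneg fun z => by positivity)] at h2 ⊢
  set K := 2 * (C + 1) / ε with hK
  have hK0 : 0 < K := by positivity
  have i1 : Integrable (fun z => min |a n z| (K * |b z|) * |b z|) ν := by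
    have m1 := (ha n).1.aemeasurable.norm
    have m2 := hb.1.aemeasurable.norm
    refine (hb.integrable_sq.const_mul K).mono'
      ((m1.min (m2.const_mul K)).mul m2).aestronglyMeasurable ?_
    refine ae_of_all _ fun z => ?_
    rw [Real.norm_of_nonneg (by positivity)]
    calc min |a n z| (K * |b z|) * |b z| ≤ (K * |b z|) * |b z| := by
          gcongr; exact min_le_right _ _
      _ = K * b z ^ 2 := by rw [← sq_abs (b z)]; ring
  have i2 := ((ha n).integrable_sq.const_mul (1 / K))
  have i3 : Integrable (fun z => |a n z| * |b z|) ν := (ha n).norm.integrable_mul hb.norm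
  have h3 : ∫ z, |a n z| * |b z| ∂ν ≤
      (∫ z, min |a n z| (K * |b z|) * |b z| ∂ν) + 1 / K * ∫ z, a n z ^ 2 ∂ν := by
    rw [← integral_const_mul, ← integral_add i1 i2]
    apply integral_mono i3 (i1.add i2)
    intro z
    simp only [Pi.add_apply]
    rcases le_total |a n z| (K * |b z|) with h | h
    · rw [min_eq_left h]
      have : 0 ≤ 1 / K * a n z ^ 2 := by positivity
      linarith
    · have h4 : |b z| ≤ |a n z| / K := by rw [le_div_iff₀ hK0]; linarith
      have h5 : |a n z| * |b z| ≤ 1 / K * a n z ^ 2 := by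
        calc |a n z| * |b z| ≤ |a n z| * (|a n z| / K) := by gcongr
          _ = 1 / K * a n z ^ 2 := by rw [← sq_abs (a n z)]; ring
      have : 0 ≤ min |a n z| (K * |b z|) * |b z| := by positivity
      linarith
  have h4 : 1 / K * ∫ z, a n z ^ 2 ∂ν ≤ 1 / K * (C + 1) := by
    gcongr; linarith [hC n]
  have h5 : 1 / K * (C + 1) = ε / 2 := by rw [hK]; field_simp
  linarith

lemma weak_cpt {d : ℕ → GIdx × ℝ → ℝ} {C : ℝ} (hd : ∀ n, MemLp (d n) 2 gridMeas)
    (hC : ∀ n, ∫ z, d n z ^ 2 ∂gridMeas ≤ C) :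
    ∃ φ : ℕ → ℕ, StrictMono φ ∧ ∃ D : GIdx × ℝ → ℝ, MemLp D 2 gridMeas ∧
      ∀ g : GIdx × ℝ → ℝ, MemLp g 2 gridMeas →
        Tendsto (fun n => ∫ z, d (φ n) z * g z ∂gridMeas) atTop
          (𝓝 (∫ z, D z * g z ∂gridMeas)) := by
  let H := Lp ℝ 2 gridMeas
  let e : ℕ → H := fun n => (hd n).toLp (d n)
  have hin : ∀ (f g : GIdx × ℝ → ℝ) (hf : MemLp f 2 gridMeas) (hg : MemLp g 2 gridMeas),
      inner ℝ (hf.toLp f) (hg.toLp g) = ∫ z, f z * g z ∂gridMeas := by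
    intro f g hf hg
    rw [L2.inner_def]
    apply integral_congr_ae
    filter_upwards [hf.coeFn_toLp, hg.coeFn_toLp] with z h1 h2
    rw [h1, h2]; simp [mul_comm]
  have hnorm : ∀ n, ‖e n‖ ≤ √C := by
    intro n
    apply Real.le_sqrt_of_sq_le
    rw [← real_inner_self_eq_norm_sq, hin]
    simpa [sq] using hC n
  have hb := WeakDual.isSeqCompact_closedBall ℝ H 0 (√C)
  obtain ⟨f, hf, φ, hφ, hlim⟩ := hb
    (x := fun n => StrongDual.toWeakDual (InnerProductSpace.toDual ℝ H (e n)))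
    (by
      intro n
      simp only [Set.mem_preimage, mem_closedBall_zero_iff]
      have : WeakDual.toStrongDual (StrongDual.toWeakDual (InnerProductSpace.toDual ℝ H (e n))) =
        InnerProductSpace.toDual ℝ H (e n) := rfl
      rw [this, LinearIsometryEquiv.norm_map]
      exact hnorm n)
  let D : H := (InnerProductSpace.toDual ℝ H).symm (WeakDual.toStrongDual f)
  refine ⟨φ, hφ, D, Lp.memLp D, fun g hg => ?_⟩
  have h1 := ((WeakDual.eval_continuous (hg.toLp g)).tendsto f).comp hlim
  have h2 : f (hg.toLp g) = ∫ z, D z * g z ∂gridMeas := by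
    have : inner ℝ D (hg.toLp g) = (WeakDual.toStrongDual f) (hg.toLp g) :=
      InnerProductSpace.toDual_symm_apply
    rw [← hin D g (Lp.memLp D) hg, Lp.toLp_coeFn, this]
    rfl
  rw [h2] at h1
  refine h1.congr fun n => ?_
  simp only [Function.comp]
  rw [← hin _ _ (hd (φ n)) hg]
  rfl

lemma section_memLp {d : GIdx × ℝ → ℝ} (hd : MemLp d 2 gridMeas) (i : GIdx) :
    MemLp (fun x => d (i, x)) 2 volume :=
  (gridEmb i).memLp_map_measure_iff.1 (hd.mono_measure (Measure.le_sum _ i))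

/-- indicator of a bounded interval on one line -/
def gind (i : GIdx) (a b : ℝ) : GIdx × ℝ → ℝ := Set.indicator (Prod.mk i '' Set.Ioc a b) 1

lemma gind_memLp (i : GIdx) (a b : ℝ) : MemLp (gind i a b) 2 gridMeas := by
  have hm : MeasurableSet (Prod.mk i '' Set.Ioc a b) :=
    (gridEmb i).measurableSet_image.2 measurableSet_Ioc
  apply memLp_indicator_const 2 hm (1:ℝ)
  right
  rw [gridMeas, Measure.sum_apply _ hm, tsum_eq_single i]
  · rw [(gridEmb i).map_apply, (Prod.mk_right_injective i).preimage_image]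
    simp
  · intro j hj
    rw [(gridEmb j).map_apply]
    have : Prod.mk j ⁻¹' (Prod.mk i '' Set.Ioc a b) = ∅ := by
      ext x; simp; intro _ _ h; exact absurd h.symm hj
    rw [this, measure_empty]

lemma integral_gind {d : GIdx × ℝ → ℝ} (hd : MemLp d 2 gridMeas) (i : GIdx) (a b : ℝ) :
    ∫ z, d z * gind i a b z ∂gridMeas = ∫ x in Set.Ioc a b, d (i, x) := by
  have hi : Integrable (fun z => d z * gind i a b z) gridMeas := hd.integrable_mul (gind_memLp i a b)
  unfold gridMeas at hi ⊢
  rw [integral_sum_measure hi, tsum_eq_single i]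
  · rw [(gridEmb i).integral_map, ← integral_indicator measurableSet_Ioc]
    congr 1; ext x
    by_cases hx : x ∈ Set.Ioc a b
    · rw [Set.indicator_of_mem hx, gind, Set.indicator_of_mem (Set.mem_image_of_mem _ hx)]; simp
    · rw [Set.indicator_of_notMem hx, gind, Set.indicator_of_notMem]; · simp
      rintro ⟨y, hy, h⟩
      rw [Prod.mk.injEq] at h
      exact hx (h.2 ▸ hy)
  · intro j hj
    rw [(gridEmb j).integral_map]
    have : ∀ x, d (j, x) * gind i a b (j, x) = 0 := by
      intro x
      rw [gind, Set.indicator_of_notMem]; · simp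
      rintro ⟨y, hy, h⟩
      rw [Prod.mk.injEq] at h
      exact hj h.1.symm
    simp [this]

/-- compactness of bounded sequences -/
lemma exists_limit {u : ℕ → GridFunc} {M : ℝ} (hu : ∀ n, (u n).MemH1)
    (hm : ∀ n, (u n).mass ≤ M) (hk : ∀ n, (u n).kin_s9 ≤ M) {x : ℕ → ℝ}
    (hx : ∀ n, x n ∈ Set.Icc (0:ℝ) 1) :
    ∃ φ : ℕ → ℕ, StrictMono φ ∧ ∃ v : GridFunc, v.MemH1 ∧
      (∀ i y, Tendsto (fun n => (u (φ n)).F i y) atTop (𝓝 (v.F i y))) ∧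
      (∀ g : GIdx × ℝ → ℝ, MemLp g 2 gridMeas →
        Tendsto (fun n => ∫ z : GIdx × ℝ, (u (φ n)).D z.1 z.2 * g z ∂gridMeas) atTop
          (𝓝 (∫ z : GIdx × ℝ, v.D z.1 z.2 * g z ∂gridMeas))) ∧
      ∃ y, Tendsto (fun n => x (φ n)) atTop (𝓝 y) := by
  have hU := fun n => (memH1_iff (u n)).1 (hu n)
  obtain ⟨φ₁, hφ₁, D, hD, hDlim⟩ := weak_cpt (d := fun n z => (u n).D z.1 z.2)
    (fun n => (hU n).2.2.2.2) hk
  have hcpt : IsCompact (Set.univ.pi fun _ : GIdx => Set.Icc (-√(4 * M)) (√(4 * M))) :=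
    isCompact_univ_pi fun _ => isCompact_Icc
  obtain ⟨c, -, φ₂, hφ₂, hc⟩ := hcpt.isSeqCompact (x := fun n i => (u (φ₁ n)).F i 0) (by
    intro n i _
    rw [Set.mem_Icc, ← abs_le]
    refine (sup_bound_one (hu _) i 0).trans (Real.sqrt_le_sqrt ?_)
    linarith [hm (φ₁ n), hk (φ₁ n)])
  obtain ⟨y, -, φ₃, hφ₃, hy⟩ := isCompact_Icc.isSeqCompact (x := fun n => x (φ₁ (φ₂ n)))
    (fun n => hx _)
  have hsec := fun i => section_memLp hD i
  have hloc : ∀ i, LocallyIntegrable (fun t => D (i, t)) := fun i =>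
    (hsec i).locallyIntegrable (by norm_num)
  have hIntv := fun i => locInt_interval (hloc i)
  have hm23 : StrictMono (φ₂ ∘ φ₃) := hφ₂.comp hφ₃
  have hD' : ∀ g : GIdx × ℝ → ℝ, MemLp g 2 gridMeas →
        Tendsto (fun n => ∫ z : GIdx × ℝ, (u (φ₁ (φ₂ (φ₃ n)))).D z.1 z.2 * g z ∂gridMeas) atTop
          (𝓝 (∫ z, D z * g z ∂gridMeas)) := fun g hg =>
    (hDlim g hg).comp hm23.tendsto_atTop
  have hc' : ∀ i, Tendsto (fun n => (u (φ₁ (φ₂ (φ₃ n)))).F i 0) atTop (𝓝 (c i)) := fun i =>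
    ((tendsto_pi_nhds.1 hc) i).comp hφ₃.tendsto_atTop
  have hioc : ∀ i a b, Tendsto (fun n => ∫ t in Set.Ioc a b, (u (φ₁ (φ₂ (φ₃ n)))).D i t) atTop
      (𝓝 (∫ t in Set.Ioc a b, D (i, t))) := by
    intro i a b
    have := hD' _ (gind_memLp i a b)
    rw [integral_gind hD] at this
    refine this.congr fun n => ?_
    exact integral_gind (d := fun z => (u (φ₁ (φ₂ (φ₃ n)))).D z.1 z.2) (hU _).2.2.2.2 i a b
  have hpt : ∀ i t, Tendsto (fun n => (u (φ₁ (φ₂ (φ₃ n)))).F i t) atTop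
      (𝓝 (c i + ∫ s in (0:ℝ)..t, D (i, s))) := by
    intro i t
    have h1 : Tendsto (fun n => ∫ s in (0:ℝ)..t, (u (φ₁ (φ₂ (φ₃ n)))).D i s) atTop
      (𝓝 (∫ s in (0:ℝ)..t, D (i, s))) := by
      unfold intervalIntegral
      exact (hioc i 0 t).sub (hioc i t 0)
    refine ((hc' i).add h1).congr fun n => ?_
    rw [(hU _).2.2.1]; ring
  let v : GridFunc :=
    { h := fun j t => c (.inl j) + ∫ s in (0:ℝ)..t, D (.inl j, s)
      w := fun j t => c (.inr j) + ∫ s in (0:ℝ)..t, D (.inr j, s)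
      hd := fun j t => D (.inl j, t)
      wd := fun j t => D (.inr j, t)
      compat := by
        intro j k
        refine tendsto_nhds_unique (hpt (.inl j) k) ((hpt (.inr k) j).congr fun n => ?_)
        exact ((u (φ₁ (φ₂ (φ₃ n)))).compat j k).symm }
  have hvF : ∀ i, v.F i = fun t => c i + ∫ s in (0:ℝ)..t, D (i, s) := by
    rintro (j | k) <;> rfl
  have hvD : ∀ i, v.D i = fun t => D (i, t) := by
    rintro (j | k) <;> rfl
  have hcont : ∀ i, Continuous (v.F i) := by
    intro i
    rw [hvF]
    exact continuous_const.add (intervalIntegral.continuous_primitive (hIntv i) 0)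
  refine ⟨fun n => φ₁ (φ₂ (φ₃ n)), hφ₁.comp hm23, v, ?_, ?_, ?_, y, hy⟩
  · rw [memH1_iff]
    refine ⟨hcont, ?_, ?_, ?_, ?_⟩
    · intro i; rw [hvD]; exact hloc i
    · intro i t; rw [hvD, hvF]; simp
    · refine ⟨aesm_grid fun i => (hcont i).aestronglyMeasurable, ?_⟩
      have h1 := Lp.eLpNorm_lim_le_liminf_eLpNorm (p := 2) (μ := gridMeas)
        (f := fun n (z : GIdx × ℝ) => (u (φ₁ (φ₂ (φ₃ n)))).F z.1 z.2)
        (fun n => (hU _).2.2.2.1.1) (fun z => v.F z.1 z.2)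
        (ae_of_all _ fun z => by rw [hvF]; exact hpt z.1 z.2)
      refine h1.trans_lt (lt_of_le_of_lt (liminf_le_of_le (by isBoundedDefault)
        (a := ENNReal.ofReal (M ^ ((2:ℝ)⁻¹))) ?_) ENNReal.ofReal_lt_top)
      intro b hb
      obtain ⟨n, hn⟩ := hb.exists
      refine hn.trans ?_
      rw [MemLp.eLpNorm_eq_integral_rpow_norm (by norm_num) (by norm_num) (hU _).2.2.2.1]
      apply ENNReal.ofReal_le_ofReal
      simp only [ENNReal.toReal_ofNat, Real.rpow_ofNat, Real.norm_eq_abs, sq_abs]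
      have := hm (φ₁ (φ₂ (φ₃ n)))
      rw [mass_eq (hu _)] at this
      exact Real.rpow_le_rpow (integral_nonneg fun z => sq_nonneg _) this (by norm_num)
    · simp only [hvD]; exact hD
  · intro i t; rw [hvF]; exact hpt i t
  · simp only [hvD]; exact hD'

end

noncomputable section

lemma rpow_add_aux {p s t M : ℝ} (hp : 2 ≤ p) (ht : 0 ≤ t) (hts : t ≤ s) (hs : s ≤ M) :
    (s + t) ^ p ≤ s ^ p + p * 2 ^ (p - 1) * M ^ (p - 2) * s * t := by
  rcases eq_or_lt_of_le (ht.trans hts) with h0 | hs0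
  · have : t = 0 := le_antisymm (by linarith) ht
    subst this; simp
  have hS : 0 < s + t := by linarith
  have h1 := one_add_mul_self_le_rpow_one_add (s := -(t / (s + t)))
    (by rw [neg_le_neg_iff, div_le_one hS]; linarith) (by linarith : 1 ≤ p)
  have e1 : 1 + -(t / (s + t)) = s / (s + t) := by field_simp; ring
  rw [e1, Real.div_rpow hs0.le hS.le, le_div_iff₀ (by positivity)] at h1
  have e2 : (s + t) ^ p = (s + t) ^ (p - 1) * (s + t) := by
    rw [← Real.rpow_add_one hS.ne']; congr 1; ring
  have e3 : (1 + p * -(t / (s + t))) * (s + t) ^ p = (s + t) ^ p - p * t * (s + t) ^ (p - 1) := by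
    rw [e2]; field_simp; ring
  rw [e3] at h1
  have h2 : (s + t) ^ (p - 1) ≤ 2 ^ (p - 1) * (M ^ (p - 2) * s) := by
    calc (s + t) ^ (p - 1) ≤ (2 * s) ^ (p - 1) :=
          Real.rpow_le_rpow hS.le (by linarith) (by linarith)
      _ = 2 ^ (p - 1) * (s ^ (p - 2) * s) := by
          rw [Real.mul_rpow (by norm_num) hs0.le, ← Real.rpow_add_one hs0.ne']
          congr 2; ring
      _ ≤ _ := by
          have := Real.rpow_le_rpow hs0.le hs (by linarith : 0 ≤ p - 2)
          gcongr
  have h3 : p * t * (s + t) ^ (p - 1) ≤ p * t * (2 ^ (p - 1) * (M ^ (p - 2) * s)) := by gcongr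
  nlinarith

lemma rpow_add_le' {p a b M : ℝ} (hp : 2 ≤ p) (ha : |a| ≤ M) (hb : |b| ≤ M) :
    |a + b| ^ p ≤ |a| ^ p + |b| ^ p + p * 2 ^ (p - 1) * M ^ (p - 2) * (|a| * |b|) := by
  have h1 : |a + b| ^ p ≤ (|a| + |b|) ^ p :=
    Real.rpow_le_rpow (abs_nonneg _) (abs_add_le a b) (by linarith)
  have ha0 : 0 ≤ |a| ^ p := by positivity
  have hb0 : 0 ≤ |b| ^ p := by positivity
  rcases le_total |a| |b| with h | h
  · have := rpow_add_aux hp (abs_nonneg a) h hb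
    rw [add_comm |b|] at this
    nlinarith
  · have := rpow_add_aux hp (abs_nonneg b) h ha
    nlinarith

/-- dilation of the amplitude to the mass `μ` -/
lemma exists_scale {p μ : ℝ} (hp : 2 ≤ p) {v : GridFunc} (hv : v.MemH1) (hm : 0 < v.mass)
    (hle : v.mass ≤ μ) :
    ∃ w : GridFunc, w.MemH1 ∧ w.mass = μ ∧ w.energy p ≤ μ / v.mass * v.energy p := by
  set t := μ / v.mass with ht
  have ht1 : 1 ≤ t := by rw [ht, one_le_div hm]; exact hle
  have ht0 : 0 < t := by linarith
  have hw := comb_memH1 (√t) 0 hv hv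
  have hp0 : 0 < p := by linarith
  refine ⟨v.comb √t 0 v, hw, ?_, ?_⟩
  · rw [mass_eq hw]
    simp only [comb_F, zero_mul, add_zero, mul_pow, Real.sq_sqrt ht0.le]
    rw [integral_const_mul, ← mass_eq hv, ht]
    field_simp
  · rw [energy_eq hw hp0, energy_eq hv hp0]
    have h1 : (v.comb √t 0 v).kin_s9 = t * v.kin_s9 := by
      unfold GridFunc.kin_s9
      simp only [comb_D, zero_mul, add_zero, mul_pow, Real.sq_sqrt ht0.le]
      rw [integral_const_mul]
    have h2 : (v.comb √t 0 v).pot_s9 p = √t ^ p * v.pot_s9 p := by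
      unfold GridFunc.pot_s9
      simp only [comb_F, zero_mul, add_zero, abs_mul, abs_of_nonneg (Real.sqrt_nonneg t)]
      rw [← integral_const_mul]
      congr 1; ext z
      rw [Real.mul_rpow (Real.sqrt_nonneg t) (abs_nonneg _)]
    have h3 : t ≤ √t ^ p := by
      have hs : 1 ≤ √t := Real.one_le_sqrt.2 ht1
      calc t = √t ^ (2:ℝ) := by rw [Real.rpow_ofNat, Real.sq_sqrt ht0.le]
        _ ≤ √t ^ p := Real.rpow_le_rpow_of_exponent_le hs hp
    have h4 := mul_le_mul_of_nonneg_right h3 (pot_nonneg v p)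
    have h5 : 0 < 1 / p := by positivity
    have h6 := mul_le_mul_of_nonneg_left h4 h5.le
    rw [h1, h2]
    nlinarith

lemma energy_lower {p μ e : ℝ} (hp : 2 < p) (hμ : 0 < μ)
    (he : ∀ u : GridFunc, u.MemH1 → u.mass = μ → e ≤ u.energy p)
    {v : GridFunc} (hv : v.MemH1) (hle : v.mass ≤ μ) : v.mass / μ * e ≤ v.energy p := by
  rcases (mass_nonneg v).eq_or_lt with h0 | h0
  · rw [← h0, zero_div, zero_mul, energy_eq hv (by linarith)]
    have h1 := pot_le hv hp.le (sup_bound_one hv)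
    rw [← h0, mul_zero] at h1
    have h2 : v.pot_s9 p = 0 := le_antisymm h1 (pot_nonneg _ _)
    have := kin_nonneg v
    rw [h2]; linarith
  · obtain ⟨w, hw, hwm, hwe⟩ := exists_scale hp.le hv h0 hle
    have h1 := (he w hw hwm).trans hwe
    have h2 := mul_le_mul_of_nonneg_left h1 (by positivity : 0 ≤ v.mass / μ)
    have h3 : v.mass / μ * (μ / v.mass * v.energy p) = v.energy p := by field_simp
    linarith

lemma integral_add_three {X : Type*} [MeasurableSpace X] {ν : Measure X} {f g k : X → ℝ}
    (hf : Integrable f ν) (hg : Integrable g ν) (hk : Integrable k ν) :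
    (∫ z, f z ∂ν) + (∫ z, g z ∂ν) + ∫ z, k z ∂ν = ∫ z, (f z + g z + k z) ∂ν := by
  rw [integral_add (f := fun z => f z + g z) (hf.add hg) hk, integral_add hf hg]

lemma split_mass {u v : GridFunc} (hu : u.MemH1) (hv : v.MemH1) :
    u.mass = (u.comb 1 (-1) v).mass + v.mass +
      2 * ∫ z : GIdx × ℝ, (u.comb 1 (-1) v).F z.1 z.2 * v.F z.1 z.2 ∂gridMeas := by
  have ha := comb_memH1 1 (-1) hu hv
  have a4 := ((memH1_iff _).1 ha).2.2.2.1
  have v4 := ((memH1_iff _).1 hv).2.2.2.1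
  have i3 : Integrable (fun z : GIdx × ℝ => (u.comb 1 (-1) v).F z.1 z.2 * v.F z.1 z.2) gridMeas :=
    a4.integrable_mul v4
  rw [mass_eq hu, mass_eq hv, mass_eq ha, ← integral_const_mul,
    integral_add_three a4.integrable_sq v4.integrable_sq (i3.const_mul 2)]
  congr 1; ext z
  rw [comb_F]; ring

lemma split_kin {u v : GridFunc} (hu : u.MemH1) (hv : v.MemH1) :
    u.kin_s9 = (u.comb 1 (-1) v).kin_s9 + v.kin_s9 +
      2 * ((∫ z : GIdx × ℝ, u.D z.1 z.2 * v.D z.1 z.2 ∂gridMeas) -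
        ∫ z : GIdx × ℝ, v.D z.1 z.2 * v.D z.1 z.2 ∂gridMeas) := by
  have ha := comb_memH1 1 (-1) hu hv
  have a4 := ((memH1_iff _).1 ha).2.2.2.2
  have v4 := ((memH1_iff _).1 hv).2.2.2.2
  have u4 := ((memH1_iff _).1 hu).2.2.2.2
  have i3 : Integrable (fun z : GIdx × ℝ => u.D z.1 z.2 * v.D z.1 z.2) gridMeas :=
    u4.integrable_mul v4
  have i4 : Integrable (fun z : GIdx × ℝ => v.D z.1 z.2 * v.D z.1 z.2) gridMeas :=
    v4.integrable_mul v4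
  have i5 : Integrable (fun z : GIdx × ℝ => 2 * (u.D z.1 z.2 * v.D z.1 z.2 -
    v.D z.1 z.2 * v.D z.1 z.2)) gridMeas := (i3.sub i4).const_mul 2
  unfold GridFunc.kin_s9
  rw [← integral_sub i3 i4, ← integral_const_mul,
    integral_add_three a4.integrable_sq v4.integrable_sq i5]
  congr 1; ext z
  rw [comb_D]; ring

lemma split_pot {u v : GridFunc} (hu : u.MemH1) (hv : v.MemH1) {p M : ℝ} (hp : 2 ≤ p)
    (hM : ∀ i x, |u.F i x| ≤ M) (hM' : ∀ i x, |v.F i x| ≤ M) :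
    u.pot_s9 p ≤ (u.comb 1 (-1) v).pot_s9 p + v.pot_s9 p + p * 2 ^ (p - 1) * (2 * M) ^ (p - 2) *
      ∫ z : GIdx × ℝ, |(u.comb 1 (-1) v).F z.1 z.2| * |v.F z.1 z.2| ∂gridMeas := by
  have ha := comb_memH1 1 (-1) hu hv
  have a4 := ((memH1_iff _).1 ha).2.2.2.1
  have v4 := ((memH1_iff _).1 hv).2.2.2.1
  have i3 : Integrable (fun z : GIdx × ℝ => |(u.comb 1 (-1) v).F z.1 z.2| * |v.F z.1 z.2|)
    gridMeas := a4.norm.integrable_mul v4.norm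
  have i1 := pot_integrable ha hp
  have i2 := pot_integrable hv hp
  unfold GridFunc.pot_s9
  rw [← integral_const_mul, integral_add_three i1 i2 (i3.const_mul _)]
  apply integral_mono (pot_integrable hu hp) ((i1.add i2).add (i3.const_mul _))
  intro z
  have hb := hM' z.1 z.2
  have hM0 := (abs_nonneg _).trans hb
  have h1 : |(u.comb 1 (-1) v).F z.1 z.2| ≤ 2 * M := by
    rw [comb_F]
    have := hM z.1 z.2
    rw [abs_le] at *
    constructor <;> linarith
  have h2 := rpow_add_le' hp h1 (hb.trans (by linarith : M ≤ 2 * M))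
  have h3 : (u.comb 1 (-1) v).F z.1 z.2 + v.F z.1 z.2 = u.F z.1 z.2 := by rw [comb_F]; ring
  rw [h3] at h2
  exact h2

lemma mass_sub_le {u v : GridFunc} (hu : u.MemH1) (hv : v.MemH1) :
    (u.comb 1 (-1) v).mass ≤ 2 * u.mass + 2 * v.mass := by
  have ha := comb_memH1 1 (-1) hu hv
  have a4 := ((memH1_iff _).1 ha).2.2.2.1
  have v4 := ((memH1_iff _).1 hv).2.2.2.1
  have u4 := ((memH1_iff _).1 hu).2.2.2.1
  rw [mass_eq hu, mass_eq hv, mass_eq ha, ← integral_const_mul, ← integral_const_mul,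
    ← integral_add (u4.integrable_sq.const_mul 2) (v4.integrable_sq.const_mul 2)]
  apply integral_mono a4.integrable_sq
    ((u4.integrable_sq.const_mul 2).add (v4.integrable_sq.const_mul 2))
  intro z
  simp only [comb_F, Pi.add_apply]
  nlinarith [sq_nonneg (u.F z.1 z.2 + v.F z.1 z.2)]

lemma mass_pos_of_ne {v : GridFunc} (hv : v.MemH1) {i : GIdx} {y δ : ℝ} (hδ : 0 < δ)
    (h : δ ≤ |v.F i y|) : 0 < v.mass := by
  rcases (mass_nonneg v).eq_or_lt with h0 | h0
  · exfalso
    have hk := kin_nonneg v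
    have h1 := sup_bound_s9 hv i y (l := δ ^ 2 / (4 * (v.kin_s9 + 1))) (by positivity)
    rw [← h0] at h1
    have h2 : δ ^ 2 ≤ (v.F i y) ^ 2 := by rw [← sq_abs (v.F i y)]; gcongr
    have h3 : 2 * (δ ^ 2 / (4 * (v.kin_s9 + 1))) * v.kin_s9 ≤ δ ^ 2 / 2 := by
      have : 2 * (δ ^ 2 / (4 * (v.kin_s9 + 1))) * v.kin_s9 = δ ^ 2 / 2 * (v.kin_s9 / (v.kin_s9 + 1)) := by
        field_simp; ring
      rw [this]
      have : v.kin_s9 / (v.kin_s9 + 1) ≤ 1 := by rw [div_le_one (by linarith)]; linarith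
      nlinarith [sq_nonneg δ]
    have : 0 < δ ^ 2 := by positivity
    simp at h1
    linarith
  · exact h0

/-- **Attainment of negative ground-state energy levels**: let `2 < p < 6`
and `μ > 0`, and assume `ℰ_p(μ) < 0` (i.e. some `u ∈ H¹_μ(𝒢)` has negative
energy). Then a ground state of mass `μ` exists. -/
theorem grid_attainment_of_negative_level (p μ : ℝ)
    (hp₂ : 2 < p) (hp₆ : p < 6) (hμ : 0 < μ)
    (hneg : ∃ v : GridFunc, v.MemH1 ∧ v.mass = μ ∧ v.energy p < 0) :
    ∃ u : GridFunc, IsGroundState p μ u := by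
  have hp0 : 0 < p := by linarith
  obtain ⟨C, hC⟩ := coercive hp₂ hp₆ hμ
  set e := sInf (energySet p μ) with he
  have hbdd : BddBelow (energySet p μ) := by
    refine ⟨-C, ?_⟩
    rintro _ ⟨u, hu, hm, rfl⟩
    have := hC u hu hm
    have := kin_nonneg u
    linarith
  have hlow : ∀ u : GridFunc, u.MemH1 → u.mass = μ → e ≤ u.energy p := fun u hu hm =>
    csInf_le hbdd ⟨u, hu, hm, rfl⟩
  have hne : (energySet p μ).Nonempty := by
    obtain ⟨v, h1, h2, h3⟩ := hneg
    exact ⟨_, v, h1, h2, rfl⟩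
  have he0 : e < 0 := by
    obtain ⟨v, h1, h2, h3⟩ := hneg
    exact (hlow v h1 h2).trans_lt h3
  obtain ⟨δ, hδ, hnv⟩ := nonvanish (c := -e / 2) hp₂ hμ (by linarith)
  -- a recentred minimizing sequence
  have hseq : ∀ n : ℕ, ∃ u : GridFunc, u.MemH1 ∧ u.mass = μ ∧
      u.energy p ≤ e + (-e / 2) * (1 / ((n : ℝ) + 1)) ∧ u.energy p ≤ 0 ∧
      ∃ y ∈ Set.Icc (0:ℝ) 1, δ ≤ |u.F (.inl 0) y| := by
    intro n
    have hn : 0 < 1 / ((n : ℝ) + 1) := by positivity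
    have hn1 : 1 / ((n : ℝ) + 1) ≤ 1 := by
      rw [div_le_one (by positivity)]; linarith [(Nat.cast_nonneg n : (0:ℝ) ≤ n)]
    have hpos : 0 < (-e / 2) * (1 / ((n : ℝ) + 1)) := mul_pos (by linarith) hn
    obtain ⟨_, ⟨u, hu, hm, rfl⟩, hlt⟩ := exists_lt_of_csInf_lt hne
      (show sInf (energySet p μ) < e + (-e / 2) * (1 / ((n : ℝ) + 1)) by linarith)
    have hle : u.energy p ≤ -(-e / 2) := by nlinarith
    obtain ⟨i, x, hx⟩ := hnv u hu hm hle
    obtain ⟨w, hw, hwm, hwe, y, hy, hwy⟩ := recenter hu p i x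
    refine ⟨w, hw, hwm.trans hm, ?_, ?_, y, hy, ?_⟩
    · rw [hwe]; exact hlt.le
    · rw [hwe]; linarith
    · rw [hwy]; exact hx
  choose u hu hm hE hE0 x hx hux using hseq
  have hk : ∀ n, (u n).kin_s9 ≤ max μ (4 * C) := fun n => by
    refine le_trans ?_ (le_max_right _ _)
    have := hC _ (hu n) (hm n)
    linarith [hE0 n]
  obtain ⟨φ, hφ, v, hv, hpt, hwk, y, hy⟩ := exists_limit hu
    (fun n => (hm n).le.trans (le_max_left _ _)) hk hx
  set M := max μ (4 * C) with hMdef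
  -- the limit does not vanish
  have hvy : δ ≤ |v.F (.inl 0) y| := by
    have h1 : Tendsto (fun n => (u (φ n)).F (.inl 0) (x (φ n)) - (u (φ n)).F (.inl 0) y) atTop
        (𝓝 0) := by
      have h2 : Tendsto (fun n => √(|x (φ n) - y| * M)) atTop (𝓝 0) := by
        have h3 : Tendsto (fun n => |x (φ n) - y| * M) atTop (𝓝 (|y - y| * M)) :=
          ((hy.sub_const y).abs).mul_const M
        have := h3.sqrt
        simpa using this
      refine squeeze_zero_norm (fun n => ?_) h2
      rw [Real.norm_eq_abs]
      apply Real.abs_le_sqrt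
      refine (holder (hu _) _ _ _).trans ?_
      gcongr
      exact hk _
    have h2 := (h1.add (hpt (.inl 0) y)).abs
    rw [zero_add] at h2
    refine ge_of_tendsto h2 (Eventually.of_forall fun n => ?_)
    simpa using hux (φ n)
  have hvpos : 0 < v.mass := mass_pos_of_ne hv hδ hvy
  -- the remainder
  let a : ℕ → GridFunc := fun n => (u (φ n)).comb 1 (-1) v
  have ha : ∀ n, (a n).MemH1 := fun n => comb_memH1 1 (-1) (hu _) hv
  have v4 := ((memH1_iff _).1 hv).2.2.2.1
  have hZ : Tendsto (fun n => ∫ z : GIdx × ℝ, |(a n).F z.1 z.2| * |v.F z.1 z.2| ∂gridMeas) atTop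
      (𝓝 0) := by
    refine cross_tendsto (C := 2 * μ + 2 * v.mass) (fun n => ((memH1_iff _).1 (ha n)).2.2.2.1) v4
      (fun n => ?_) fun z => ?_
    · rw [← mass_eq (ha n), ← hm (φ n)]
      exact mass_sub_le (hu _) hv
    · have := (hpt z.1 z.2).sub_const (v.F z.1 z.2)
      rw [sub_self] at this
      refine this.congr fun n => ?_
      simp only [a, comb_F]; ring
  have hX : Tendsto (fun n => ∫ z : GIdx × ℝ, (a n).F z.1 z.2 * v.F z.1 z.2 ∂gridMeas) atTop
      (𝓝 0) := by
    refine squeeze_zero_norm (fun n => ?_) hZ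
    refine (norm_integral_le_integral_norm _).trans (le_of_eq ?_)
    simp
  have hY : Tendsto (fun n => (∫ z : GIdx × ℝ, (u (φ n)).D z.1 z.2 * v.D z.1 z.2 ∂gridMeas) -
        ∫ z : GIdx × ℝ, v.D z.1 z.2 * v.D z.1 z.2 ∂gridMeas) atTop (𝓝 0) := by
    have := (hwk _ ((memH1_iff _).1 hv).2.2.2.2).sub_const
      (∫ z : GIdx × ℝ, v.D z.1 z.2 * v.D z.1 z.2 ∂gridMeas)
    rwa [sub_self] at this
  have hmass : ∀ n, (a n).mass = μ - v.mass -
      2 * ∫ z : GIdx × ℝ, (a n).F z.1 z.2 * v.F z.1 z.2 ∂gridMeas := fun n => by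
    have := split_mass (hu (φ n)) hv
    rw [hm] at this
    linarith
  have hmlim : Tendsto (fun n => (a n).mass) atTop (𝓝 (μ - v.mass)) := by
    simp_rw [hmass]
    simpa using (hX.const_mul 2).const_sub (μ - v.mass)
  have hvle : v.mass ≤ μ := by
    have := ge_of_tendsto hmlim (Eventually.of_forall fun n => mass_nonneg (a n))
    linarith
  have hev : ∀ᶠ n in atTop, (a n).mass ≤ μ :=
    (hmlim.eventually_lt_const (by linarith : μ - v.mass < μ)).mono fun n h => h.le
  -- uniform bounds
  obtain ⟨S, hS1, hS2⟩ : ∃ S : ℝ, (∀ n i x, |(u n).F i x| ≤ S) ∧ ∀ i x, |v.F i x| ≤ S := by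
    refine ⟨√(4 * M), fun n i x => ?_, fun i x => ?_⟩
    · refine (sup_bound_one (hu _) i x).trans (Real.sqrt_le_sqrt ?_)
      have : (u n).mass ≤ M := (hm n).le.trans (le_max_left _ _)
      linarith [hk n]
    · refine le_of_tendsto (hpt i x).abs (Eventually.of_forall fun n => ?_)
      refine (sup_bound_one (hu _) i x).trans (Real.sqrt_le_sqrt ?_)
      have : (u (φ n)).mass ≤ M := (hm _).le.trans (le_max_left _ _)
      linarith [hk (φ n)]
  set K := p * 2 ^ (p - 1) * (2 * S) ^ (p - 2) with hK
  have hmain : ∀ᶠ n in atTop,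
      v.energy p + (a n).mass / μ * e +
        ((∫ z : GIdx × ℝ, (u (φ n)).D z.1 z.2 * v.D z.1 z.2 ∂gridMeas) -
          ∫ z : GIdx × ℝ, v.D z.1 z.2 * v.D z.1 z.2 ∂gridMeas) -
        1 / p * (K * ∫ z : GIdx × ℝ, |(a n).F z.1 z.2| * |v.F z.1 z.2| ∂gridMeas) ≤
      e + (-e / 2) * (1 / ((φ n : ℝ) + 1)) := by
    filter_upwards [hev] with n hn
    refine le_trans ?_ (hE (φ n))
    have h1 := energy_lower hp₂ hμ hlow (ha n) hn
    have h2 := split_kin (hu (φ n)) hv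
    have h3 := split_pot (hu (φ n)) hv hp₂.le (hS1 (φ n)) hS2
    have h4 := mul_le_mul_of_nonneg_left h3 (by positivity : 0 ≤ 1 / p)
    rw [energy_eq (ha n) hp0] at h1
    rw [energy_eq hv hp0, energy_eq (hu (φ n)) hp0]
    simp only [a] at h1 ⊢
    rw [mul_add, mul_add] at h4
    linarith
  have hL : Tendsto (fun n => v.energy p + (a n).mass / μ * e +
        ((∫ z : GIdx × ℝ, (u (φ n)).D z.1 z.2 * v.D z.1 z.2 ∂gridMeas) -
          ∫ z : GIdx × ℝ, v.D z.1 z.2 * v.D z.1 z.2 ∂gridMeas) -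
        1 / p * (K * ∫ z : GIdx × ℝ, |(a n).F z.1 z.2| * |v.F z.1 z.2| ∂gridMeas)) atTop
      (𝓝 (v.energy p + (μ - v.mass) / μ * e + 0 - 1 / p * (K * 0))) :=
    (((((hmlim.div_const μ).mul_const e).const_add _).add hY).sub
      ((hZ.const_mul K).const_mul (1 / p)))
  have hR : Tendsto (fun n => e + (-e / 2) * (1 / ((φ n : ℝ) + 1))) atTop
      (𝓝 (e + (-e / 2) * 0)) :=
    ((tendsto_one_div_add_atTop_nhds_zero_nat.comp hφ.tendsto_atTop).const_mul _).const_add _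
  have hfin := le_of_tendsto_of_tendsto hL hR hmain
  have hfin2 : v.energy p ≤ v.mass / μ * e := by
    have : (μ - v.mass) / μ * e = e - v.mass / μ * e := by field_simp
    rw [this] at hfin
    linarith
  obtain ⟨w, hw, hwm, hwe⟩ := exists_scale hp₂.le hv hvpos hvle
  refine ⟨w, hw, hwm, fun g hg hgm => ?_⟩
  have h1 := mul_le_mul_of_nonneg_left hfin2 (by positivity : 0 ≤ μ / v.mass)
  have h2 : μ / v.mass * (v.mass / μ * e) = e := by field_simp
  have h3 := hlow g hg hgm
  linarith

end
end

section
/- Subcritical existence (Theorem 1.1): for every real p with 2 < p < 4 and every μ > 0, there exists a ground state of mass μ on the grid 𝒢, i.e., some u ∈ H¹_μ(𝒢) with E_p(u) = ℰ_p(μ), and moreover ℰ_p(μ) < 0. -/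
/- Formalization of NLS ground states on the two-dimensional grid 𝒢
   (the planar metric graph with vertex set ℤ×ℤ and unit edges).

   A function `u` on 𝒢 is encoded by the family `h j` of its restrictions to
   the horizontal lines `H j` and the family `w k` of its restrictions to the
   vertical lines `V k`, subject to the vertex-compatibility conditions
   `h j k = w k j`.  The (weak) derivative of `u` along each line is carried
   as additional data `hd`, `wd`, tied to `h`, `w` by the fundamental theorem
   of calculus in the membership predicates below. -/

open MeasureTheory Filter Topology
open scoped ENNReal NNReal

noncomputable section

namespace GridAux

/-- index set of the lines: `(true, j)` horizontal, `(false, k)` vertical -/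
abbrev Idx := Bool × ℤ

/-- the disjoint union of all lines -/
abbrev Om := Idx × ℝ

/-- the measure on the union of the lines -/
def nu : Measure Om := (Measure.count : Measure Idx).prod volume

instance : SigmaFinite nu := by unfold nu; infer_instance

/-- glue two families into a function on the union of all lines -/
def glue (f g : ℤ → ℝ → ℝ) : Om → ℝ := fun z => if z.1.1 then f z.1.2 z.2 else g z.1.2 z.2

lemma nu_eq : nu = Measure.sum (fun i : Idx => Measure.map (Prod.mk i) volume) := by
  unfold nu
  rw [Measure.count, Measure.prod_sum_left]
  simp_rw [Measure.dirac_prod]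

lemma embI (i : Idx) : MeasurableEmbedding (Prod.mk i : ℝ → Om) :=
  measurableEmbedding_prodMk_left i

lemma lintegral_nu (φ : Om → ℝ≥0∞) : ∫⁻ z, φ z ∂nu = ∑' i : Idx, ∫⁻ x, φ (i, x) := by
  rw [nu_eq, lintegral_sum_measure]
  congr 1
  ext i
  exact (embI i).lintegral_map _

lemma aesm_iff (F : Om → ℝ) :
    AEStronglyMeasurable F nu ↔ ∀ i, AEStronglyMeasurable (fun x => F (i, x)) := by
  rw [nu_eq, aestronglyMeasurable_sum_measure_iff]
  refine forall_congr' fun i => ?_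
  exact (embI i).aestronglyMeasurable_map_iff

lemma gridLpPow_eq (p : ℝ) (f g : ℤ → ℝ → ℝ) :
    gridLpPow p f g = ∫⁻ z, (‖glue f g z‖₊ : ℝ≥0∞) ^ p ∂nu := by
  rw [lintegral_nu, ENNReal.tsum_prod', tsum_bool]
  simp [gridLpPow, glue, add_comm]

lemma gridLpPow_toReal (p : ℝ) (hp : 0 ≤ p) (f g : ℤ → ℝ → ℝ)
    (hm : AEStronglyMeasurable (glue f g) nu) :
    (gridLpPow p f g).toReal = ∫ z, |glue f g z| ^ p ∂nu := by
  rw [gridLpPow_eq, integral_eq_lintegral_of_nonneg_ae]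
  · congr 1
    apply lintegral_congr
    intro z
    rw [← ENNReal.ofReal_rpow_of_nonneg (abs_nonneg _) hp, ← Real.norm_eq_abs,
      ofReal_norm]
    rfl
  · exact Filter.Eventually.of_forall fun z => Real.rpow_nonneg (abs_nonneg _) _
  · exact (hm.aemeasurable.norm.pow_const p).aestronglyMeasurable

lemma gridLpPow_two_toReal (f g : ℤ → ℝ → ℝ)
    (hm : AEStronglyMeasurable (glue f g) nu) :
    (gridLpPow 2 f g).toReal = ∫ z, (glue f g z) ^ 2 ∂nu := by
  rw [gridLpPow_toReal 2 (by norm_num) f g hm]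
  simp

lemma memLp_two_iff (f g : ℤ → ℝ → ℝ) (hm : AEStronglyMeasurable (glue f g) nu) :
    MemLp (glue f g) 2 nu ↔ gridLpPow 2 f g < ⊤ := by
  rw [gridLpPow_eq, MemLp, and_iff_right hm,
    eLpNorm_lt_top_iff_lintegral_rpow_enorm_lt_top (by norm_num) (by norm_num)]
  simp only [ENNReal.toReal_ofNat]
  rfl

/-- function of a grid function on the union of lines -/
def uF (u : GridFunc) : Om → ℝ := glue u.h u.w
/-- derivative of a grid function on the union of lines -/
def uG (u : GridFunc) : Om → ℝ := glue u.hd u.wd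

/-- `H¹` property for functions on the union of lines -/
structure H1 (F G : Om → ℝ) : Prop where
  cont : ∀ i, Continuous (fun x => F (i, x))
  ftc : ∀ i x, (∫ t in (0:ℝ)..x, G (i, t)) = F (i, x) - F (i, 0)
  mF : MemLp F 2 nu
  mG : MemLp G 2 nu

lemma measure_strip (i : Idx) (s : Set ℝ) : nu ({i} ×ˢ s) = volume s := by
  unfold nu
  rw [Measure.prod_prod, Measure.count_singleton, one_mul]

lemma setIntegral_strip (F : Om → ℝ) (i : Idx) (s : Set ℝ) (_ : MeasurableSet s) :
    ∫ z in {i} ×ˢ s, F z ∂nu = ∫ x in s, F (i, x) := by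
  have h : nu.restrict ({i} ×ˢ s) = Measure.map (Prod.mk i) (volume.restrict s) := by
    unfold nu
    rw [← Measure.prod_restrict, Measure.restrict_singleton, Measure.count_singleton, one_smul,
      Measure.dirac_prod]
  rw [h, (embI i).integral_map]

lemma locInt_slice (G : Om → ℝ) (hG : MemLp G 2 nu) (i : Idx) :
    LocallyIntegrable (fun x => G (i, x)) := by
  have h : nu.restrict ({i} ×ˢ Set.univ) = Measure.map (Prod.mk i) volume := by
    unfold nu
    rw [← Measure.prod_restrict, Measure.restrict_singleton, Measure.count_singleton, one_smul,
      Measure.dirac_prod, Measure.restrict_univ]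
  have h2 : MemLp G 2 (Measure.map (Prod.mk i) volume) := h ▸ hG.restrict _
  rw [(embI i).memLp_map_measure_iff] at h2
  exact h2.locallyIntegrable (by norm_num)

lemma intInt_slice (G : Om → ℝ) (hG : MemLp G 2 nu) (i : Idx) (a b : ℝ) :
    IntervalIntegrable (fun x => G (i, x)) volume a b :=
  intervalIntegrable_iff.2 (((locInt_slice G hG i).integrableOn_isCompact isCompact_uIcc).mono_set
    Set.uIoc_subset_uIcc)

lemma memH1_iff (u : GridFunc) : u.MemH1 ↔ H1 (uF u) (uG u) := by
  constructor
  · rintro ⟨h1, h2, h3, h4, h5, h6, h7, h8⟩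
    have c : ∀ i, Continuous (fun x => uF u (i, x)) := by
      rintro ⟨b, j⟩
      cases b
      · simpa [uF, glue] using h2 j
      · simpa [uF, glue] using h1 j
    have l : ∀ i, LocallyIntegrable (fun x => uG u (i, x)) := by
      rintro ⟨b, j⟩
      cases b
      · simpa [uG, glue] using h4 j
      · simpa [uG, glue] using h3 j
    refine ⟨c, ?_, ?_, ?_⟩
    · rintro ⟨b, j⟩ x
      cases b
      · simpa [uF, uG, glue] using h6 j x
      · simpa [uF, uG, glue] using h5 j x
    · exact (memLp_two_iff _ _ ((aesm_iff _).2 fun i => (c i).aestronglyMeasurable)).2 h7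
    · exact (memLp_two_iff _ _ ((aesm_iff _).2 fun i => (l i).aestronglyMeasurable)).2 h8
  · rintro ⟨c, f, mF, mG⟩
    have l := locInt_slice _ mG
    refine ⟨fun j => ?_, fun j => ?_, fun j => ?_, fun j => ?_, fun j x => ?_, fun j x => ?_,
      (memLp_two_iff _ _ mF.1).1 mF, (memLp_two_iff _ _ mG.1).1 mG⟩
    · simpa [uF, glue] using c (true, j)
    · simpa [uF, glue] using c (false, j)
    · simpa [uG, glue] using l (true, j)
    · simpa [uG, glue] using l (false, j)
    · simpa [uF, uG, glue] using f (true, j) x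
    · simpa [uF, uG, glue] using f (false, j) x

/-- build a grid function -/
def mkU (F G : Om → ℝ) (hc : ∀ j k : ℤ, F ((true, j), (k : ℝ)) = F ((false, k), (j : ℝ))) :
    GridFunc where
  h j x := F ((true, j), x)
  w j x := F ((false, j), x)
  hd j x := G ((true, j), x)
  wd j x := G ((false, j), x)
  compat := hc

lemma uF_mkU (F G hc) : uF (mkU F G hc) = F := by
  ext ⟨⟨b, j⟩, x⟩
  cases b <;> simp [uF, glue, mkU]

lemma uG_mkU (F G hc) : uG (mkU F G hc) = G := by
  ext ⟨⟨b, j⟩, x⟩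
  cases b <;> simp [uG, glue, mkU]

lemma uF_compat (u : GridFunc) (j k : ℤ) :
    uF u ((true, j), (k : ℝ)) = uF u ((false, k), (j : ℝ)) := by
  simpa [uF, glue] using u.compat j k

/-- energy functional -/
def En (p : ℝ) (F G : Om → ℝ) : ℝ :=
  (1 / 2) * (∫ z, (G z) ^ 2 ∂nu) - (1 / p) * ∫ z, |F z| ^ p ∂nu

lemma mass_eq (u : GridFunc) (hu : H1 (uF u) (uG u)) : u.mass = ∫ z, (uF u z) ^ 2 ∂nu :=
  gridLpPow_two_toReal _ _ hu.mF.1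

lemma energy_eq (u : GridFunc) (hu : H1 (uF u) (uG u)) (p : ℝ) (hp : 0 ≤ p) :
    u.energy p = En p (uF u) (uG u) := by
  unfold GridFunc.energy En
  rw [gridLpPow_two_toReal _ _ hu.mG.1, gridLpPow_toReal p hp _ _ hu.mF.1]
  rfl

lemma ftc' {F G : Om → ℝ} (h : H1 F G) (i : Idx) (x y : ℝ) :
    F (i, y) - F (i, x) = ∫ t in x..y, G (i, t) := by
  have l := intInt_slice _ h.mG i
  have e := intervalIntegral.integral_interval_sub_left (a := 0) (b := y) (c := x) (μ := volume)
    (f := fun t => G (i, t)) (l _ _) (l _ _)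
  rw [← e, h.ftc, h.ftc]
  ring

/-- the indicator of a segment in a line as an `L²` function -/
def segInd (i : Idx) (x y : ℝ) : Lp ℝ 2 nu :=
  indicatorConstLp 2 (s := {i} ×ˢ Set.uIoc x y)
    ((measurableSet_singleton i).prod measurableSet_uIoc)
    (by rw [measure_strip, Set.uIoc]; simp) (1:ℝ)

lemma norm_segInd (i : Idx) (x y : ℝ) : ‖segInd i x y‖ = Real.sqrt |y - x| := by
  unfold segInd
  rw [norm_indicatorConstLp (by norm_num) (by norm_num), measureReal_def, measure_strip,
    Real.volume_uIoc, ENNReal.toReal_ofReal (abs_nonneg _), Real.sqrt_eq_rpow]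
  simp

lemma segInd_integral (i : Idx) (x y : ℝ) (g : Lp ℝ 2 nu) :
    ∫ t in x..y, g (i, t) = (if x ≤ y then 1 else -1) * inner ℝ (segInd i x y) g := by
  unfold segInd
  rw [L2.inner_indicatorConstLp_one, setIntegral_strip _ _ _ measurableSet_uIoc,
    intervalIntegral.intervalIntegral_eq_integral_uIoc]
  rfl

lemma interval_congr_slice {F G : Om → ℝ} (h : F =ᵐ[nu] G) (i : Idx) (x y : ℝ) :
    ∫ t in x..y, F (i, t) = ∫ t in x..y, G (i, t) := by
  have : ∀ᵐ t, F (i, t) = G (i, t) := by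
    rw [nu_eq, Filter.EventuallyEq, Measure.ae_sum_iff] at h
    exact (embI i).ae_map_iff.1 (h i)
  exact intervalIntegral.integral_congr_ae (this.mono fun t ht _ => ht)

lemma holder {F G : Om → ℝ} (h : H1 F G) (i : Idx) (x y : ℝ) :
    |F (i, y) - F (i, x)| ≤ Real.sqrt |y - x| * ‖h.mG.toLp‖ := by
  rw [ftc' h, ← interval_congr_slice h.mG.coeFn_toLp, segInd_integral, abs_mul]
  have : |(if x ≤ y then (1:ℝ) else -1)| = 1 := by split_ifs <;> simp
  rw [this, one_mul, ← norm_segInd i]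
  exact abs_real_inner_le_norm _ _

lemma norm_sq_toLp {G : Om → ℝ} (h : MemLp G 2 nu) : ‖h.toLp‖ ^ 2 = ∫ z, (G z) ^ 2 ∂nu := by
  rw [← real_inner_self_eq_norm_sq, L2.inner_def]
  refine integral_congr_ae ?_
  filter_upwards [h.coeFn_toLp] with z hz
  simp [hz, sq]

lemma sup_bound {F G : Om → ℝ} (h : H1 F G) (z : Om) :
    (F z) ^ 2 ≤ 2 * (∫ z, (F z) ^ 2 ∂nu) + 2 * ∫ z, (G z) ^ 2 ∂nu := by
  obtain ⟨i, x⟩ := z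
  rw [← norm_sq_toLp h.mG]
  set K := ‖h.mG.toLp‖ with hK
  have h1 : ∀ y ∈ Set.Ioc x (x+1), (F (i,x)) ^ 2 - 2 * K ^ 2 ≤ 2 * (F (i, y)) ^ 2 := by
    intro y hy
    have h2 := holder h i x y
    have h3 : Real.sqrt |y - x| ≤ 1 := by
      rw [Real.sqrt_le_one, abs_le]
      constructor <;> linarith [hy.1, hy.2]
    have h4 : |F (i, y) - F (i, x)| ≤ K := by
      refine h2.trans ?_
      have : 0 ≤ K := norm_nonneg _
      nlinarith
    have h5 : (F (i, y) - F (i, x)) ^ 2 ≤ K ^ 2 := by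
      rw [← sq_abs]
      gcongr
    nlinarith [sq_nonneg (2 * F (i,y) - F (i,x))]
  have hi : IntegrableOn (fun y => 2 * (F (i, y)) ^ 2) (Set.Ioc x (x+1)) :=
    (((h.cont i).pow 2).const_mul 2).integrableOn_Icc.mono_set Set.Ioc_subset_Icc_self
  have h6 := setIntegral_mono_on (μ := volume) (s := Set.Ioc x (x+1))
    (f := fun _ => (F (i,x)) ^ 2 - 2 * K ^ 2) (by simp) hi measurableSet_Ioc h1
  rw [integral_const_mul, ← setIntegral_strip (fun z => F z ^ 2) i _ measurableSet_Ioc] at h6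
  have h7 : ∫ z in {i} ×ˢ Set.Ioc x (x+1), (F z) ^ 2 ∂nu ≤ ∫ z, (F z) ^ 2 ∂nu :=
    setIntegral_le_integral h.mF.integrable_sq (Filter.Eventually.of_forall fun z => sq_nonneg _)
  simp at h6
  linarith

lemma H1.lin {F G F' G' : Om → ℝ} (h : H1 F G) (h' : H1 F' G') (a b : ℝ) :
    H1 (fun z => a * F z + b * F' z) (fun z => a * G z + b * G' z) where
  cont i := ((h.cont i).const_mul a).add ((h'.cont i).const_mul b)
  ftc i x := by
    have l := intInt_slice _ h.mG i 0 x
    have l' := intInt_slice _ h'.mG i 0 x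
    rw [intervalIntegral.integral_add (l.const_mul a) (l'.const_mul b),
      intervalIntegral.integral_const_mul, intervalIntegral.integral_const_mul, h.ftc, h'.ftc]
    ring
  mF := (h.mF.const_mul a).add (h'.mF.const_mul b)
  mG := (h.mG.const_mul a).add (h'.mG.const_mul b)

end GridAux

end

noncomputable section

namespace GridAux

lemma weak_subseq (g : ℕ → Lp ℝ 2 nu) (R : ℝ) (h : ∀ n, ‖g n‖ ≤ R) :
    ∃ (g' : Lp ℝ 2 nu) (φ : ℕ → ℕ), StrictMono φ ∧
      ∀ v, Tendsto (fun n => inner ℝ v (g (φ n))) atTop (𝓝 (inner ℝ v g')) := by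
  have : Fact ((1:ℝ≥0∞) ≤ 2) := ⟨by norm_num⟩
  have : Fact ((2:ℝ≥0∞) ≠ ⊤) := ⟨by norm_num⟩
  have hnu : IsSeparable nu := by infer_instance
  have hs : SecondCountableTopology (Lp ℝ 2 nu) := by infer_instance
  have key := WeakDual.isSeqCompact_closedBall ℝ (Lp ℝ 2 nu) 0 R
  have hmem : ∀ n, StrongDual.toWeakDual (InnerProductSpace.toDual ℝ (Lp ℝ 2 nu) (g n)) ∈
      WeakDual.toStrongDual ⁻¹' Metric.closedBall (0 : StrongDual ℝ (Lp ℝ 2 nu)) R := by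
    intro n
    simpa using h n
  obtain ⟨a, -, φ, hφ, hlim⟩ := key hmem
  refine ⟨(InnerProductSpace.toDual ℝ (Lp ℝ 2 nu)).symm (WeakDual.toStrongDual a), φ, hφ, ?_⟩
  intro v
  have h2 := (WeakDual.eval_continuous (𝕜 := ℝ) v).tendsto a |>.comp hlim
  have e : inner ℝ v ((InnerProductSpace.toDual ℝ (Lp ℝ 2 nu)).symm (WeakDual.toStrongDual a))
      = a v := by
    rw [real_inner_comm, InnerProductSpace.toDual_symm_apply]
    rfl
  rw [e]
  refine h2.congr fun n => ?_
  simp only [Function.comp]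
  rw [real_inner_comm]
  rfl

lemma rpow_lip (p m x y : ℝ) (hp : 1 ≤ p) (hx : 0 ≤ x) (hy : 0 ≤ y) (hxm : x ≤ m)
    (hym : y ≤ m) : |x ^ p - y ^ p| ≤ p * m ^ (p - 1) * |x - y| := by
  have := Convex.norm_image_sub_le_of_norm_hasDerivWithin_le (f := fun x : ℝ => x ^ p)
    (f' := fun x => p * x ^ (p - 1)) (s := Set.Icc 0 m) (C := p * m ^ (p - 1)) (x := y) (y := x)
    (fun t _ => (Real.hasDerivAt_rpow_const (Or.inr hp)).hasDerivWithinAt)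
    (fun t ht => by
      rw [Real.norm_eq_abs, abs_of_nonneg
        (mul_nonneg (by linarith) (Real.rpow_nonneg ht.1 _))]
      have := Real.rpow_le_rpow ht.1 ht.2 (by linarith : 0 ≤ p - 1)
      gcongr)
    (convex_Icc 0 m) ⟨hy, hym⟩ ⟨hx, hxm⟩
  simpa [Real.norm_eq_abs] using this

lemma pow_split_aux (p M a b : ℝ) (hp : 2 ≤ p) (ha : |a| ≤ M) (hab : |b| ≤ |a|) :
    |(|a + b| ^ p - |a| ^ p - |b| ^ p)| ≤ ((p * 2 ^ (p - 1) + 1) * M ^ (p - 2)) * (|a| * |b|) := by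
  have h1 : |(|a + b| ^ p - |a| ^ p)| ≤ p * (2 * |a|) ^ (p - 1) * |b| := by
    refine (rpow_lip p (2 * |a|) _ _ (by linarith) (abs_nonneg _) (abs_nonneg _)
      ((abs_add_le a b).trans (by linarith)) (by linarith [abs_nonneg a])).trans ?_
    have : |(|a + b| - |a|)| ≤ |b| := by
      have := abs_abs_sub_abs_le_abs_sub (a + b) a
      simpa using this
    gcongr
  have h0 : ∀ x : ℝ, 0 ≤ x → x ^ (p - 1) = x ^ (p - 2) * x := by
    intro x hx
    conv_rhs => rw [← Real.rpow_one x, ← Real.rpow_mul hx, one_mul]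
    rw [← Real.rpow_add_of_nonneg hx (by linarith) (by linarith)]
    congr 1
    ring
  have h0' : ∀ x : ℝ, 0 ≤ x → x ^ p = x ^ (p - 1) * x := by
    intro x hx
    conv_rhs => rw [← Real.rpow_one x, ← Real.rpow_mul hx, one_mul]
    rw [← Real.rpow_add_of_nonneg hx (by linarith) (by linarith)]
    congr 1
    ring
  have hM : |a| ^ (p - 2) ≤ M ^ (p - 2) := Real.rpow_le_rpow (abs_nonneg _) ha (by linarith)
  have h2 : (2 * |a|) ^ (p - 1) ≤ 2 ^ (p - 1) * (M ^ (p - 2) * |a|) := by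
    rw [Real.mul_rpow (by norm_num) (abs_nonneg _), h0 _ (abs_nonneg a)]
    gcongr
  have h3 : |b| ^ p ≤ M ^ (p - 2) * |a| * |b| := by
    rw [h0' _ (abs_nonneg b)]
    have : |b| ^ (p - 1) ≤ |a| ^ (p - 1) :=
      Real.rpow_le_rpow (abs_nonneg _) hab (by linarith)
    rw [h0 _ (abs_nonneg a)] at this
    have : |b| ^ (p - 1) ≤ M ^ (p - 2) * |a| := this.trans (by gcongr)
    gcongr
  have h4 : |(|a + b| ^ p - |a| ^ p - |b| ^ p)| ≤ |(|a + b| ^ p - |a| ^ p)| + |b| ^ p := by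
    refine (abs_sub _ _).trans ?_
    rw [abs_of_nonneg (Real.rpow_nonneg (abs_nonneg b) p)]
  have h5 : p * (2 * |a|) ^ (p - 1) * |b| ≤ p * (2 ^ (p - 1) * (M ^ (p - 2) * |a|)) * |b| := by
    gcongr
  calc _ ≤ _ := h4
    _ ≤ p * (2 ^ (p - 1) * (M ^ (p - 2) * |a|)) * |b| + M ^ (p - 2) * |a| * |b| :=
      add_le_add (h1.trans h5) h3
    _ = _ := by ring

lemma pow_split (p M a b : ℝ) (hp : 2 ≤ p) (ha : |a| ≤ M) (hb : |b| ≤ M) :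
    |(|a + b| ^ p - |a| ^ p - |b| ^ p)| ≤ ((p * 2 ^ (p - 1) + 1) * M ^ (p - 2)) * (|a| * |b|) := by
  rcases le_total |b| |a| with h | h
  · exact pow_split_aux p M a b hp ha h
  · have := pow_split_aux p M b a hp hb h
    rw [add_comm b a, mul_comm |b|] at this
    convert this using 2
    ring

lemma rpow_le_sup {p S x : ℝ} (hp : 2 ≤ p) (hx : |x| ≤ S) : |x| ^ p ≤ S ^ (p - 2) * x ^ 2 := by
  have : |x| ^ p = |x| ^ (p - 2) * x ^ 2 := by
    rw [← sq_abs, ← Real.rpow_natCast |x| 2, ← Real.rpow_add_of_nonneg (abs_nonneg _)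
      (by linarith) (by norm_num)]
    congr 1
    norm_num
  rw [this]
  have := Real.rpow_le_rpow (abs_nonneg _) hx (by linarith : 0 ≤ p - 2)
  gcongr

lemma integrable_rpow {F : Om → ℝ} {p S : ℝ} (hp : 2 ≤ p) (hF : MemLp F 2 nu)
    (hS : ∀ z, |F z| ≤ S) : Integrable (fun z => |F z| ^ p) nu := by
  refine (hF.integrable_sq.const_mul (S ^ (p - 2))).mono'
    (hF.1.aemeasurable.norm.pow_const p).aestronglyMeasurable ?_
  refine Filter.Eventually.of_forall fun z => ?_
  rw [Real.norm_eq_abs, abs_of_nonneg (Real.rpow_nonneg (abs_nonneg _) _)]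
  exact rpow_le_sup hp (hS z)

lemma integral_rpow_le {F : Om → ℝ} {p S : ℝ} (hp : 2 ≤ p) (hF : MemLp F 2 nu)
    (hS : ∀ z, |F z| ≤ S) :
    ∫ z, |F z| ^ p ∂nu ≤ S ^ (p - 2) * ∫ z, (F z) ^ 2 ∂nu := by
  rw [← integral_const_mul]
  exact integral_mono (integrable_rpow hp hF hS) (hF.integrable_sq.const_mul _)
    fun z => rpow_le_sup hp (hS z)

/-- cross terms vanish -/
lemma cross_tendsto {V : ℕ → Om → ℝ} {f : Om → ℝ} (hV : ∀ n, MemLp (V n) 2 nu)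
    (hf : MemLp f 2 nu) (R : ℝ) (hR : ∀ n, ∫ z, (V n z) ^ 2 ∂nu ≤ R)
    (h0 : ∀ z, Tendsto (fun n => V n z) atTop (𝓝 0)) :
    Tendsto (fun n => ∫ z, |V n z| * |f z| ∂nu) atTop (𝓝 0) := by
  have hR0 : 0 ≤ R := (integral_nonneg fun z => sq_nonneg _).trans (hR 0)
  have hVint : ∀ n, Integrable (fun z => |V n z| * |f z|) nu := fun n => by
    simpa [abs_mul] using ((hV n).integrable_mul hf).abs
  rw [Metric.tendsto_atTop]
  intro e he
  set ε := e / (2 * (R + 1)) with hε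
  have hε0 : 0 < ε := by positivity
  set m : ℕ → Om → ℝ := fun n z => min (|V n z| * |f z|) ((f z) ^ 2 / (4 * ε)) with hm
  have hmm : ∀ n, AEStronglyMeasurable (m n) nu := fun n =>
    (hVint n).1.inf (hf.integrable_sq.div_const _).1
  have hm0 : ∀ n z, 0 ≤ m n z := fun n z => le_min (by positivity) (by positivity)
  have hmi : ∀ n, Integrable (m n) nu := fun n => by
    refine (hVint n).mono' (hmm n) (Filter.Eventually.of_forall fun z => ?_)
    rw [Real.norm_eq_abs, abs_of_nonneg (hm0 n z)]
    exact min_le_left _ _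
  have hmt : Tendsto (fun n => ∫ z, m n z ∂nu) atTop (𝓝 (∫ z, (0:ℝ) ∂nu)) := by
    refine tendsto_integral_of_dominated_convergence (fun z => (f z) ^ 2 / (4 * ε)) hmm
      (hf.integrable_sq.div_const _) (fun n => Filter.Eventually.of_forall fun z => ?_)
      (Filter.Eventually.of_forall fun z => ?_)
    · rw [Real.norm_eq_abs, abs_of_nonneg (hm0 n z)]
      exact min_le_right _ _
    · have h1 : Tendsto (fun n => |V n z| * |f z|) atTop (𝓝 0) := by
        simpa using (h0 z).abs.mul_const |f z|
      exact squeeze_zero (fun n => hm0 n z) (fun n => min_le_left _ _) h1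
  rw [integral_zero, Metric.tendsto_atTop] at hmt
  obtain ⟨N, hN⟩ := hmt (e / 2) (by positivity)
  refine ⟨N, fun n hn => ?_⟩
  have h1 := hN n hn
  rw [Real.dist_eq, sub_zero] at h1 ⊢
  rw [abs_of_nonneg (integral_nonneg fun z => by positivity)]
  have h2 : ∫ z, |V n z| * |f z| ∂nu ≤ ∫ z, (ε * (V n z) ^ 2 + m n z) ∂nu := by
    refine integral_mono (hVint n) (((hV n).integrable_sq.const_mul ε).add (hmi n)) fun z => ?_
    simp only [hm]
    rcases min_choice (|V n z| * |f z|) ((f z) ^ 2 / (4 * ε)) with h | h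
    · rw [h]
      nlinarith [sq_nonneg (V n z)]
    · rw [h]
      have : ε * (V n z) ^ 2 + (f z) ^ 2 / (4 * ε) - |V n z| * |f z| =
          (2 * ε * |V n z| - |f z|) ^ 2 / (4 * ε) := by
        field_simp
        rw [← sq_abs (V n z), ← sq_abs (f z)]
        ring
      have h5 : 0 ≤ (2 * ε * |V n z| - |f z|) ^ 2 / (4 * ε) := by positivity
      linarith
  rw [integral_add ((hV n).integrable_sq.const_mul ε) (hmi n), integral_const_mul] at h2
  have h3 : ε * ∫ z, (V n z) ^ 2 ∂nu ≤ ε * R := by gcongr; exact hR n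
  have h4 : ε * R < e / 2 := by
    rw [hε, div_mul_eq_mul_div, div_lt_div_iff₀ (by positivity) (by norm_num)]
    nlinarith
  have := le_abs_self (∫ z, m n z ∂nu)
  linarith

/-- splitting of the `L^p` norm -/
lemma split_tendsto {F : ℕ → Om → ℝ} {f : Om → ℝ} (p M R : ℝ) (hp : 2 ≤ p)
    (hF : ∀ n, MemLp (F n) 2 nu) (hf : MemLp f 2 nu)
    (hR : ∀ n, ∫ z, (F n z - f z) ^ 2 ∂nu ≤ R)
    (hM : ∀ n z, |F n z - f z| ≤ M) (hfM : ∀ z, |f z| ≤ M)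
    (h0 : ∀ z, Tendsto (fun n => F n z) atTop (𝓝 (f z))) :
    Tendsto (fun n => (∫ z, |F n z| ^ p ∂nu) - ∫ z, |F n z - f z| ^ p ∂nu) atTop
      (𝓝 (∫ z, |f z| ^ p ∂nu)) := by
  have hV : ∀ n, MemLp (fun z => F n z - f z) 2 nu := fun n => (hF n).sub hf
  have hc := cross_tendsto hV hf R hR (fun z => by
    simpa using (h0 z).sub_const (f z))
  have hc2 := hc.const_mul ((p * 2 ^ (p - 1) + 1) * M ^ (p - 2))
  rw [mul_zero] at hc2
  have hFM : ∀ n z, |F n z| ≤ 2 * M := fun n z => by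
    have := abs_add_le (F n z - f z) (f z)
    rw [sub_add_cancel] at this
    linarith [hM n z, hfM z]
  have i1 : ∀ n, Integrable (fun z => |F n z| ^ p) nu := fun n =>
    integrable_rpow hp (hF n) (hFM n)
  have i2 : ∀ n, Integrable (fun z => |F n z - f z| ^ p) nu := fun n =>
    integrable_rpow hp (hV n) (hM n)
  have i3 : Integrable (fun z => |f z| ^ p) nu := integrable_rpow hp hf hfM
  rw [tendsto_iff_norm_sub_tendsto_zero]
  refine squeeze_zero (fun n => norm_nonneg _) (fun n => ?_) hc2
  have i4 : Integrable (fun z => |F n z| ^ p - |F n z - f z| ^ p) nu := (i1 n).sub (i2 n)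
  rw [← integral_sub (i1 n) (i2 n), ← integral_sub i4 i3,
    ← integral_const_mul]
  refine norm_integral_le_of_norm_le ?_ (Filter.Eventually.of_forall fun z => ?_)
  · refine Integrable.const_mul ?_ _
    simpa [abs_mul] using ((hV n).integrable_mul hf).abs
  · have := pow_split p M (F n z - f z) (f z) hp (hM n z) (hfM z)
    rw [sub_add_cancel] at this
    exact this

end GridAux

end

noncomputable section

namespace GridAux

lemma pos_of_point {F G : Om → ℝ} (h : H1 F G) (z : Om) (hz : F z ≠ 0) :
    0 < ∫ z, (F z) ^ 2 ∂nu := by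
  refine lt_of_le_of_ne (integral_nonneg fun z => sq_nonneg _) fun h0 => hz ?_
  have h1 := (integral_eq_zero_iff_of_nonneg (fun z => sq_nonneg (F z)) h.mF.integrable_sq).1 h0.symm
  obtain ⟨i, x⟩ := z
  have h2 : ∀ᵐ t, F (i, t) ^ 2 = 0 := by
    rw [nu_eq, Filter.EventuallyEq, Measure.ae_sum_iff] at h1
    exact (embI i).ae_map_iff.1 (h1 i)
  have h3 : (fun t => F (i, t)) =ᵐ[volume] fun _ => (0:ℝ) := h2.mono fun t ht => by simpa using ht
  have h4 := (Continuous.ae_eq_iff_eq volume (h.cont i) continuous_const).1 h3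
  exact congrFun h4 x

lemma compact_limit (u : ℕ → GridFunc) (hu : ∀ n, H1 (uF (u n)) (uG (u n))) (A B : ℝ)
    (hA : ∀ n, ∫ z, (uF (u n) z) ^ 2 ∂nu ≤ A) (hB : ∀ n, ∫ z, (uG (u n) z) ^ 2 ∂nu ≤ B)
    (x : ℕ → ℝ) (hx : ∀ n, x n ∈ Set.Icc (0:ℝ) 1) (δ : ℝ) (hδ0 : 0 < δ)
    (hδ : ∀ n, δ ≤ |uF (u n) ((true, 0), x n)|) :
    ∃ (v : GridFunc) (φ : ℕ → ℕ), StrictMono φ ∧ H1 (uF v) (uG v) ∧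
      (∀ z, Tendsto (fun n => uF (u (φ n)) z) atTop (𝓝 (uF v z))) ∧
      Tendsto (fun n => (∫ z, (uG (u (φ n)) z) ^ 2 ∂nu) -
        ∫ z, (uG (u (φ n)) z - uG v z) ^ 2 ∂nu) atTop (𝓝 (∫ z, (uG v z) ^ 2 ∂nu)) ∧
      0 < ∫ z, (uF v z) ^ 2 ∂nu := by
  set M := Real.sqrt (2 * A + 2 * B) with hM
  have hbd : ∀ n z, |uF (u n) z| ≤ M := fun n z => by
    rw [hM]
    apply Real.le_sqrt_of_sq_le
    rw [sq_abs]
    have := sup_bound (hu n) z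
    linarith [hA n, hB n]
  have hK : ∀ n, ‖(hu n).mG.toLp‖ ≤ Real.sqrt B := fun n => by
    apply Real.le_sqrt_of_sq_le
    rw [norm_sq_toLp]
    exact hB n
  obtain ⟨g, φ₁, hφ₁, hg⟩ := weak_subseq (fun n => (hu n).mG.toLp) _ hK
  -- convergence of the base values
  have hcomp : IsSeqCompact ((Set.univ.pi fun _ : Idx => Set.Icc (-M) M) ×ˢ Set.Icc (0:ℝ) 1) :=
    ((isCompact_univ_pi fun _ => isCompact_Icc).prod isCompact_Icc).isSeqCompact
  obtain ⟨⟨f0, x0⟩, -, φ₂, hφ₂, hlim⟩ := hcomp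
    (x := fun n => (fun i => uF (u (φ₁ n)) (i, 0), x (φ₁ n)))
    (fun n => ⟨fun i _ => abs_le.1 (hbd _ _), hx _⟩)
  have hf0 : ∀ i, Tendsto (fun n => uF (u (φ₁ (φ₂ n))) (i, 0)) atTop (𝓝 (f0 i)) := fun i =>
    ((continuous_apply i).tendsto _).comp ((continuous_fst.tendsto _).comp hlim)
  have hx0 : Tendsto (fun n => x (φ₁ (φ₂ n))) atTop (𝓝 x0) := (continuous_snd.tendsto _).comp hlim
  set φ : ℕ → ℕ := fun n => φ₁ (φ₂ n) with hφ
  have hgφ : ∀ w, Tendsto (fun n => inner ℝ w ((hu (φ n)).mG.toLp)) atTop (𝓝 (inner ℝ w g)) :=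
    fun w => (hg w).comp hφ₂.tendsto_atTop
  set f : Om → ℝ := fun z => f0 z.1 + ∫ t in (0:ℝ)..z.2, g (z.1, t) with hf
  have hlimz : ∀ z, Tendsto (fun n => uF (u (φ n)) z) atTop (𝓝 (f z)) := by
    rintro ⟨i, y⟩
    have e : ∀ n, uF (u (φ n)) (i, y) = uF (u (φ n)) (i, 0) +
        (if (0:ℝ) ≤ y then 1 else -1) * inner ℝ (segInd i 0 y) ((hu (φ n)).mG.toLp) := by
      intro n
      rw [← segInd_integral, interval_congr_slice (hu (φ n)).mG.coeFn_toLp, ← ftc' (hu (φ n))]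
      ring
    simp only [hf, e, segInd_integral]
    exact (hf0 i).add ((hgφ _).const_mul _)
  have hcompat : ∀ j k : ℤ, f ((true, j), (k : ℝ)) = f ((false, k), (j : ℝ)) := by
    intro j k
    refine tendsto_nhds_unique (hlimz ((true, j), (k : ℝ))) ?_
    simp_rw [uF_compat]
    exact hlimz _
  have hgm : MemLp g 2 nu := Lp.memLp g
  have hfm : AEStronglyMeasurable f nu :=
    aestronglyMeasurable_of_tendsto_ae atTop (fun n => (hu (φ n)).mF.1)
      (Filter.Eventually.of_forall hlimz)
  have hf2 : MemLp f 2 nu := by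
    refine ⟨hfm, lt_of_le_of_lt (Lp.eLpNorm_lim_le_liminf_eLpNorm (p := 2)
      (fun n => (hu (φ n)).mF.1) f (Filter.Eventually.of_forall hlimz)) ?_⟩
    have hb : ∀ n, eLpNorm (uF (u (φ n))) 2 nu ≤ ENNReal.ofReal (Real.sqrt A) := by
      intro n
      have h1 : ‖(hu (φ n)).mF.toLp‖ ≤ Real.sqrt A := by
        apply Real.le_sqrt_of_sq_le
        rw [norm_sq_toLp]
        exact hA _
      rw [Lp.norm_toLp] at h1
      exact (ENNReal.le_ofReal_iff_toReal_le (hu (φ n)).mF.2.ne (Real.sqrt_nonneg _)).2 h1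
    refine lt_of_le_of_lt (Filter.liminf_le_liminf (v := fun _ => ENNReal.ofReal (Real.sqrt A))
      (Filter.Eventually.of_forall hb)) ?_
    simp
  have hH : H1 f g := by
    refine ⟨fun i => ?_, fun i y => ?_, hf2, hgm⟩
    · simp only [hf]
      exact continuous_const.add
        (intervalIntegral.continuous_primitive (fun a b => intInt_slice _ hgm i a b) 0)
    · simp [hf]
  refine ⟨mkU f g hcompat, φ, hφ₁.comp hφ₂, ?_⟩
  rw [uF_mkU, uG_mkU]
  refine ⟨hH, hlimz, ?_, ?_⟩
  · have e1 : ∀ n, (∫ z, (uG (u (φ n)) z) ^ 2 ∂nu) - ∫ z, (uG (u (φ n)) z - g z) ^ 2 ∂nu =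
        2 * inner ℝ g ((hu (φ n)).mG.toLp) - ‖g‖ ^ 2 := by
      intro n
      have a1 := norm_sq_toLp (hu (φ n)).mG
      have a2 := norm_sq_toLp ((hu (φ n)).mG.sub hgm)
      rw [MemLp.toLp_sub (hu (φ n)).mG hgm, Lp.toLp_coeFn] at a2
      simp only [Pi.sub_apply] at a2
      rw [← a1, ← a2, norm_sub_sq_real, real_inner_comm]
      ring
    have e2 : ∫ z, (g z) ^ 2 ∂nu = 2 * inner ℝ g g - ‖g‖ ^ 2 := by
      have := norm_sq_toLp hgm
      rw [Lp.toLp_coeFn] at this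
      rw [← this, real_inner_self_eq_norm_sq]
      ring
    simp_rw [e1, e2]
    exact ((hgφ g).const_mul 2).sub_const _
  · refine pos_of_point hH ((true, 0), x0) fun hz => ?_
    have t1 : Tendsto (fun n => uF (u (φ n)) ((true, 0), x (φ n))) atTop (𝓝 0) := by
      have t2 : Tendsto (fun n => uF (u (φ n)) ((true, 0), x (φ n)) -
          uF (u (φ n)) ((true, 0), x0)) atTop (𝓝 0) := by
        have t3 : Tendsto (fun n => Real.sqrt |x (φ n) - x0| * Real.sqrt B) atTop (𝓝 0) := by
          have : Tendsto (fun n => x (φ n) - x0) atTop (𝓝 0) := by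
            simpa using hx0.sub_const x0
          simpa using ((Real.continuous_sqrt.tendsto _).comp this.abs).mul_const (Real.sqrt B)
        refine squeeze_zero_norm (fun n => ?_) t3
        refine (holder (hu (φ n)) _ _ _).trans ?_
        gcongr
        exact hK _
      have t4 := t2.add (hlimz ((true, 0), x0))
      simpa [hz] using t4
    have t5 : δ ≤ |(0:ℝ)| := ge_of_tendsto' t1.abs fun n => hδ (φ n)
    simp at t5
    linarith

/-- translation of a grid function -/
def shift (u : GridFunc) (a b : ℤ) : GridFunc where
  h j x := u.h (j + b) (x + a)
  w k y := u.w (k + a) (y + b)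
  hd j x := u.hd (j + b) (x + a)
  wd k y := u.wd (k + a) (y + b)
  compat j k := by
    have := u.compat (j + b) (k + a)
    push_cast at this
    exact this

/-- reflection of a grid function -/
def swap (u : GridFunc) : GridFunc where
  h := u.w
  w := u.h
  hd := u.wd
  wd := u.hd
  compat j k := (u.compat k j).symm

lemma gridLpPow_shift (p : ℝ) (f g : ℤ → ℝ → ℝ) (a b : ℤ) :
    gridLpPow p (fun j x => f (j + b) (x + a)) (fun k y => g (k + a) (y + b)) =
      gridLpPow p f g := by
  unfold gridLpPow
  congr 1
  · rw [← (Equiv.addRight b).tsum_eq (fun j => ∫⁻ x : ℝ, (‖f j x‖₊ : ℝ≥0∞) ^ p)]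
    congr 1
    ext j
    exact lintegral_add_right_eq_self (fun x => (‖f (j + b) x‖₊ : ℝ≥0∞) ^ p) (a : ℝ)
  · rw [← (Equiv.addRight a).tsum_eq (fun j => ∫⁻ x : ℝ, (‖g j x‖₊ : ℝ≥0∞) ^ p)]
    congr 1
    ext j
    exact lintegral_add_right_eq_self (fun x => (‖g (j + a) x‖₊ : ℝ≥0∞) ^ p) (b : ℝ)

lemma memH1_shift (u : GridFunc) (hu : u.MemH1) (a b : ℤ) : (shift u a b).MemH1 := by
  have hH := (memH1_iff u).1 hu
  obtain ⟨h1, h2, h3, h4, h5, h6, h7, h8⟩ := hu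
  have li : ∀ (q : ℝ → ℝ) (c : ℝ), LocallyIntegrable q →
      LocallyIntegrable (fun x => q (x + c)) := by
    intro q c hq
    rw [locallyIntegrable_iff] at hq ⊢
    intro k hk
    have := hq _ (hk.image (continuous_add_const c))
    exact ((measurePreserving_add_right volume c).integrableOn_image
      (measurableEmbedding_addRight c)).1 this
  have e1 : ∀ j x y, (∫ t in x..y, u.hd j t) = u.h j y - u.h j x := fun j x y => by
    simpa [uF, uG, glue] using (ftc' hH (true, j) x y).symm
  have e2 : ∀ j x y, (∫ t in x..y, u.wd j t) = u.w j y - u.w j x := fun j x y => by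
    simpa [uF, uG, glue] using (ftc' hH (false, j) x y).symm
  refine ⟨fun j => (h1 _).comp (continuous_add_const _), fun j => (h2 _).comp
    (continuous_add_const _), fun j => li _ _ (h3 _), fun j => li _ _ (h4 _), fun j x => ?_,
    fun j x => ?_, ?_, ?_⟩
  · simp only [shift]
    rw [intervalIntegral.integral_comp_add_right (fun t => u.hd (j + b) t), e1]
  · simp only [shift]
    rw [intervalIntegral.integral_comp_add_right (fun t => u.wd (j + a) t), e2]
  · exact (gridLpPow_shift 2 u.h u.w a b).trans_lt h7
  · exact (gridLpPow_shift 2 u.hd u.wd a b).trans_lt h8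

lemma mass_shift (u : GridFunc) (a b : ℤ) : (shift u a b).mass = u.mass := by
  unfold GridFunc.mass
  exact congrArg _ (gridLpPow_shift 2 u.h u.w a b)

lemma energy_shift (u : GridFunc) (p : ℝ) (a b : ℤ) : (shift u a b).energy p = u.energy p := by
  unfold GridFunc.energy
  rw [← gridLpPow_shift 2 u.hd u.wd a b, ← gridLpPow_shift p u.h u.w a b]
  rfl

lemma normalize (p : ℝ) (u : GridFunc) (hu : u.MemH1) (δ : ℝ) (z : Om) (hz : δ ≤ |uF u z|) :
    ∃ v : GridFunc, v.MemH1 ∧ v.mass = u.mass ∧ v.energy p = u.energy p ∧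
      ∃ x ∈ Set.Icc (0:ℝ) 1, δ ≤ |uF v ((true, 0), x)| := by
  have key : ∀ (u : GridFunc), u.MemH1 → ∀ (j : ℤ) (x : ℝ), δ ≤ |u.h j x| →
      ∃ v : GridFunc, v.MemH1 ∧ v.mass = u.mass ∧ v.energy p = u.energy p ∧
      ∃ x ∈ Set.Icc (0:ℝ) 1, δ ≤ |uF v ((true, 0), x)| := by
    intro u hu j x hx
    refine ⟨shift u ⌊x⌋ j, memH1_shift u hu _ _, mass_shift _ _ _, energy_shift _ _ _ _,
      Int.fract x, ⟨Int.fract_nonneg x, (Int.fract_lt_one x).le⟩, ?_⟩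
    simpa [uF, glue, shift] using hx
  obtain ⟨⟨b, j⟩, x⟩ := z
  cases b
  · have hsw : (swap u).MemH1 := by
      obtain ⟨h1, h2, h3, h4, h5, h6, h7, h8⟩ := hu
      refine ⟨h2, h1, h4, h3, h6, h5, ?_, ?_⟩
      · unfold gridLpPow at h7 ⊢
        rw [add_comm]
        exact h7
      · unfold gridLpPow at h8 ⊢
        rw [add_comm]
        exact h8
    obtain ⟨v, a1, a2, a3, a4⟩ := key (swap u) hsw j x (by simpa [uF, glue, swap] using hz)
    refine ⟨v, a1, a2.trans ?_, a3.trans ?_, a4⟩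
    · simp [GridFunc.mass, gridLpPow, swap, add_comm]
    · simp [GridFunc.energy, gridLpPow, swap, add_comm]
  · exact key u hu j x (by simpa [uF, glue] using hz)

end GridAux

end

noncomputable section

namespace GridAux

lemma hasSum_exp (a : ℝ) (ha : 0 < a) :
    HasSum (fun j : ℤ => Real.exp (-a * |(j:ℝ)|))
      ((1 - Real.exp (-a))⁻¹ + Real.exp (-a) * (1 - Real.exp (-a))⁻¹) := by
  have hr : Real.exp (-a) < 1 := by simpa using ha
  have h1 := hasSum_geometric_of_lt_one (Real.exp_nonneg (-a)) hr
  refine HasSum.of_nat_of_neg_add_one ?_ ?_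
  · have e : (fun n : ℕ => Real.exp (-a * |(((n:ℕ):ℤ):ℝ)|)) = fun n => Real.exp (-a) ^ n := by
      funext n
      rw [← Real.exp_nat_mul]
      simp [mul_comm]
    rw [e]
    exact h1
  · have e : (fun n : ℕ => Real.exp (-a * |((-((n:ℤ) + 1) : ℤ):ℝ)|)) =
        fun n => Real.exp (-a) * Real.exp (-a) ^ n := by
      funext n
      rw [← Real.exp_nat_mul, ← Real.exp_add]
      push_cast
      rw [abs_neg, abs_of_nonneg (by positivity : (0:ℝ) ≤ (n:ℝ) + 1)]
      congr 1
      ring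
    have h2 := h1.mul_left (Real.exp (-a))
    rw [← e] at h2
    exact h2

lemma integral_exp_abs (a : ℝ) (ha : 0 < a) : ∫ x : ℝ, Real.exp (-a * |x|) = 2 / a := by
  rw [integral_comp_abs (f := fun x => Real.exp (-a * x)), integral_exp_mul_Ioi (by linarith)]
  simp
  ring

/-- integral of the product exponential -/
def AA (a : ℝ) : ℝ := ∫ z, Real.exp (-a * |((z.1.2 : ℤ) : ℝ)|) * Real.exp (-a * |z.2|) ∂nu

lemma AA_props (a : ℝ) (ha : 0 < a) (ha1 : a ≤ 1) :
    Integrable (fun z : Om => Real.exp (-a * |((z.1.2 : ℤ) : ℝ)|) * Real.exp (-a * |z.2|)) nu ∧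
    4 / a ^ 2 ≤ AA a ∧ AA a ≤ 16 / a ^ 2 := by
  have hS := hasSum_exp a ha
  set r := Real.exp (-a) with hr
  set S := (1 - r)⁻¹ + r * (1 - r)⁻¹ with hSd
  have i1 : Integrable (fun x : ℝ => Real.exp (-a * |x|)) := by
    by_contra h
    have := integral_undef h
    rw [integral_exp_abs a ha] at this
    have : 0 < 2 / a := by positivity
    linarith
  have hsum : Summable (fun i : Idx => Real.exp (-a * |((i.2 : ℤ) : ℝ)|)) := by
    rw [summable_prod_of_nonneg (fun i => Real.exp_nonneg _)]
    exact ⟨fun b => hS.summable, Summable.of_finite⟩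
  have i2 : Integrable (fun i : Idx => Real.exp (-a * |((i.2 : ℤ) : ℝ)|)) Measure.count := by
    rw [integrable_count_iff]
    simpa using hsum
  have e2 : ∫ i : Idx, Real.exp (-a * |((i.2 : ℤ) : ℝ)|) ∂Measure.count = 2 * S := by
    rw [integral_countable i2]
    simp only [measureReal_def, Measure.count_singleton, ENNReal.toReal_one, one_smul]
    rw [hsum.tsum_prod' (fun b => hS.summable), tsum_bool]
    simp only [hS.tsum_eq]
    ring
  have e3 : AA a = (2 * S) * (2 / a) := by
    unfold AA nu
    rw [integral_prod_mul (fun i : Idx => Real.exp (-a * |((i.2 : ℤ) : ℝ)|))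
      (fun x : ℝ => Real.exp (-a * |x|)), e2, integral_exp_abs a ha]
  have hr0 : 0 < r := Real.exp_pos _
  have b1 : 1 - r ≤ a := by
    have := Real.add_one_le_exp (-a)
    linarith
  have b2 : a / 2 ≤ 1 - r := by
    have h1 : a + 1 ≤ Real.exp a := Real.add_one_le_exp a
    have h2 : r * Real.exp a = 1 := by rw [hr, ← Real.exp_add]; simp
    have h3 : r * (a + 1) ≤ 1 := by nlinarith
    nlinarith
  have b0 : 0 < 1 - r := by linarith
  have c1 : 1 / a ≤ (1 - r)⁻¹ := by
    rw [one_div]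
    exact inv_anti₀ b0 b1
  have c2 : (1 - r)⁻¹ ≤ 2 / a := by
    rw [← inv_div]
    exact inv_anti₀ (by positivity) b2
  have s1 : 1 / a ≤ S := by
    have : 0 ≤ r * (1 - r)⁻¹ := by positivity
    linarith
  have s2 : S ≤ 4 / a := by
    have : r * (1 - r)⁻¹ ≤ 1 * (1 - r)⁻¹ := by gcongr; linarith
    have e : 4 / a = 2 / a + 2 / a := by ring
    linarith
  refine ⟨i2.mul_prod i1, ?_, ?_⟩
  · rw [e3]
    calc 4 / a ^ 2 = (2 * (1 / a)) * (2 / a) := by field_simp; norm_num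
      _ ≤ _ := by gcongr
  · rw [e3]
    calc (2 * S) * (2 / a) ≤ (2 * (4 / a)) * (2 / a) := by gcongr
      _ = _ := by field_simp; norm_num

lemma test_neg (p μ : ℝ) (hp₂ : 2 < p) (hp₄ : p < 4) (hμ : 0 < μ) :
    ∃ u : GridFunc, u.MemH1 ∧ u.mass = μ ∧ u.energy p < 0 := by
  set C := (1 / p) * ((μ / 4) ^ (p / 2) * (4 / p ^ 2)) with hC
  have hC0 : 0 < C := by positivity
  obtain ⟨ε, hε0, hε1, hε2⟩ : ∃ ε : ℝ, 0 < ε ∧ ε ≤ 1 / 4 ∧ ε ^ (4 - p) < 2 * C / μ := by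
    have h1 : Tendsto (fun ε : ℝ => ε ^ (4 - p)) (𝓝[>] 0) (𝓝 0) := by
      have := (Real.continuousAt_rpow_const 0 (4 - p) (Or.inr (by linarith))).tendsto
      rw [Real.zero_rpow (by linarith)] at this
      exact this.mono_left nhdsWithin_le_nhds
    have h2 : ∀ᶠ ε : ℝ in 𝓝[>] 0, ε ^ (4 - p) < 2 * C / μ :=
      h1.eventually_lt_const (by positivity)
    have h3 : ∀ᶠ ε : ℝ in 𝓝[>] 0, ε ∈ Set.Ioo (0:ℝ) (1 / 4) :=
      Ioo_mem_nhdsGT (by norm_num)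
    obtain ⟨ε, a, b⟩ := (h2.and h3).exists
    exact ⟨ε, b.1, b.2.le, a⟩
  obtain ⟨j2, l2, u2⟩ := AA_props (2 * ε) (by positivity) (by linarith)
  obtain ⟨jp, lp, -⟩ := AA_props (p * ε) (by positivity) (by nlinarith)
  have hA2 : 0 < AA (2 * ε) := lt_of_lt_of_le (by positivity) l2
  set c := Real.sqrt (μ / AA (2 * ε)) with hc
  have hc2 : c ^ 2 = μ / AA (2 * ε) := Real.sq_sqrt (by positivity)
  have hc0 : 0 ≤ c := Real.sqrt_nonneg _
  set F : Om → ℝ := fun z => c * Real.exp (-ε * (|((z.1.2 : ℤ) : ℝ)| + |z.2|)) with hF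
  set G : Om → ℝ := fun z => (if 0 ≤ z.2 then -ε else ε) * F z with hG
  have hcompat : ∀ j k : ℤ, F ((true, j), (k : ℝ)) = F ((false, k), (j : ℝ)) := by
    intro j k
    simp only [hF, add_comm]
  have hcont : ∀ i, Continuous (fun x => F (i, x)) := by
    intro i
    simp only [hF]
    fun_prop
  have hFm : AEStronglyMeasurable F nu := (aesm_iff _).2 fun i => (hcont i).aestronglyMeasurable
  have hGm : AEStronglyMeasurable G nu := by
    refine (aesm_iff _).2 fun i => ?_
    simp only [hG]
    refine AEStronglyMeasurable.mul ?_ (hcont i).aestronglyMeasurable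
    exact (Measurable.ite measurableSet_Ici measurable_const
      measurable_const).aestronglyMeasurable
  have hF2 : ∀ z, F z ^ 2 =
      c ^ 2 * (Real.exp (-(2 * ε) * |((z.1.2 : ℤ) : ℝ)|) * Real.exp (-(2 * ε) * |z.2|)) := by
    intro z
    simp only [hF]
    rw [mul_pow, ← Real.exp_nat_mul, ← Real.exp_add]
    congr 2
    push_cast
    ring
  have hFp : ∀ z, |F z| ^ p =
      c ^ p * (Real.exp (-(p * ε) * |((z.1.2 : ℤ) : ℝ)|) * Real.exp (-(p * ε) * |z.2|)) := by
    intro z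
    simp only [hF]
    rw [abs_of_nonneg (by positivity), Real.mul_rpow hc0 (Real.exp_nonneg _), ← Real.exp_mul,
      ← Real.exp_add]
    congr 2
    ring
  have hG2 : ∀ z, G z ^ 2 = ε ^ 2 * F z ^ 2 := by
    intro z
    simp only [hG]
    split_ifs <;> ring
  have mF : MemLp F 2 nu := by
    rw [memLp_two_iff_integrable_sq hFm]
    simp only [hF2]
    exact j2.const_mul _
  have mG : MemLp G 2 nu := by
    rw [memLp_two_iff_integrable_sq hGm]
    simp only [hG2]
    exact mF.integrable_sq.const_mul _
  have hH : H1 F G := by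
    refine ⟨hcont, fun i x => ?_, mF, mG⟩
    refine integral_eq_of_hasDerivAt_off_countable (fun t => F (i, t)) (fun t => G (i, t))
      (Set.countable_singleton (0:ℝ)) (hcont i).continuousOn ?_ (intInt_slice _ mG i 0 x)
    intro t ht
    have ht0 : t ≠ 0 := fun h => ht.2 (by simp [h])
    have hd : HasDerivAt (fun t => |t|) (if 0 ≤ t then (1:ℝ) else -1) t := by
      rcases lt_or_gt_of_ne ht0 with h | h
      · rw [if_neg (by linarith)]
        exact hasDerivAt_abs_neg h
      · rw [if_pos h.le]
        exact hasDerivAt_abs_pos h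
    have := (((hd.const_add |((i.2 : ℤ) : ℝ)|).const_mul (-ε)).exp).const_mul c
    simp only [hF, hG]
    refine this.congr_deriv ?_
    split_ifs <;> ring
  have hHu : H1 (uF (mkU F G hcompat)) (uG (mkU F G hcompat)) := by rwa [uF_mkU, uG_mkU]
  have iF : ∫ z, F z ^ 2 ∂nu = μ := by
    simp only [hF2]
    rw [integral_const_mul, hc2]
    change μ / AA (2 * ε) * AA (2 * ε) = μ
    field_simp
  refine ⟨mkU F G hcompat, (memH1_iff _).2 hHu, ?_, ?_⟩
  · rw [mass_eq _ hHu, uF_mkU, iF]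
  · rw [energy_eq _ hHu p (by linarith), uF_mkU, uG_mkU]
    unfold En
    have iG : ∫ z, G z ^ 2 ∂nu = ε ^ 2 * μ := by
      simp only [hG2]
      rw [integral_const_mul, iF]
    have iP : ∫ z, |F z| ^ p ∂nu = c ^ p * AA (p * ε) := by
      simp only [hFp]
      rw [integral_const_mul]
      rfl
    rw [iG, iP]
    have k1 : (μ / 4) * ε ^ 2 ≤ c ^ 2 := by
      rw [hc2, le_div_iff₀ hA2]
      calc μ / 4 * ε ^ 2 * AA (2 * ε) ≤ μ / 4 * ε ^ 2 * (16 / (2 * ε) ^ 2) := by gcongr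
        _ = μ := by field_simp; norm_num
    have k2 : c ^ p = (c ^ 2) ^ (p / 2) := by
      rw [← Real.rpow_natCast c 2, ← Real.rpow_mul hc0]
      congr 1
      push_cast
      ring
    have k3 : (μ / 4) ^ (p / 2) * ε ^ p ≤ c ^ p := by
      rw [k2]
      have := Real.rpow_le_rpow (by positivity) k1 (by positivity : 0 ≤ p / 2)
      rw [Real.mul_rpow (by positivity) (by positivity)] at this
      convert this using 2
      rw [← Real.rpow_natCast ε 2, ← Real.rpow_mul hε0.le]
      congr 1
      push_cast
      ring
    have k4 : ε ^ p = ε ^ (p - 2) * ε ^ 2 := by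
      rw [← Real.rpow_natCast ε 2, ← Real.rpow_add hε0]
      congr 1
      push_cast
      ring
    have k5 : ε ^ 2 = ε ^ (4 - p) * ε ^ (p - 2) := by
      rw [← Real.rpow_natCast ε 2, ← Real.rpow_add hε0]
      congr 1
      push_cast
      ring
    have k6 : C * ε ^ (p - 2) ≤ (1 / p) * (c ^ p * AA (p * ε)) := by
      calc C * ε ^ (p - 2)
          = (1 / p) * (((μ / 4) ^ (p / 2) * ε ^ p) * (4 / (p * ε) ^ 2)) := by
            rw [hC, k4]
            field_simp
        _ ≤ _ := by
            have : 0 < 4 / (p * ε) ^ 2 := by positivity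
            gcongr
    have k7 : ε ^ (4 - p) * μ < 2 * C := by rwa [lt_div_iff₀ hμ] at hε2
    have k8 : 0 < ε ^ (p - 2) := by positivity
    have k9 : (1 / 2) * (ε ^ 2 * μ) < C * ε ^ (p - 2) := by
      rw [k5]
      nlinarith
    linarith

end GridAux

end

noncomputable section

namespace GridAux

lemma abs_le_sup {F G : Om → ℝ} (h : H1 F G) (A B : ℝ) (hA : ∫ z, (F z) ^ 2 ∂nu ≤ A)
    (hB : ∫ z, (G z) ^ 2 ∂nu ≤ B) (z : Om) : |F z| ≤ Real.sqrt (2 * A + 2 * B) := by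
  apply Real.le_sqrt_of_sq_le
  rw [sq_abs]
  have := sup_bound h z
  linarith

lemma rpow_sublinear (c q : ℝ) (hc : 0 < c) (hq0 : 0 < q) (hq1 : q < 1) :
    ∃ D : ℝ, ∀ y : ℝ, 0 ≤ y → c * y ^ q ≤ y / 8 + D := by
  have h1 : Tendsto (fun y : ℝ => c * y ^ (-(1 - q))) atTop (𝓝 (c * 0)) :=
    (tendsto_rpow_neg_atTop (by linarith)).const_mul c
  rw [mul_zero] at h1
  have h2 := (h1.eventually (gt_mem_nhds (show (0:ℝ) < 1 / 8 by norm_num))).and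
    (eventually_gt_atTop (0:ℝ))
  obtain ⟨T, hT⟩ := h2.exists_forall_of_atTop
  have hT0 := (hT T le_rfl).2
  refine ⟨c * T ^ q, fun y hy => ?_⟩
  rcases le_total T y with h | h
  · obtain ⟨h3, h4⟩ := hT y h
    have e : c * y ^ q = (c * y ^ (-(1 - q))) * y := by
      rw [mul_assoc, ← Real.rpow_add_one h4.ne']
      congr 2
      ring
    rw [e]
    have : 0 ≤ c * T ^ q := by positivity
    nlinarith
  · have : y ^ q ≤ T ^ q := Real.rpow_le_rpow hy h hq0.le
    nlinarith

lemma coercive (p μ : ℝ) (hp₂ : 2 < p) (hp₄ : p < 4) (hμ : 0 < μ) :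
    ∃ D : ℝ, ∀ F G : Om → ℝ, H1 F G → ∫ z, (F z) ^ 2 ∂nu = μ →
      (∫ z, (G z) ^ 2 ∂nu) / 4 - μ / 4 - D ≤ En p F G := by
  obtain ⟨D, hD⟩ := rpow_sublinear (μ / p) ((p - 2) / 2) (by positivity) (by linarith) (by linarith)
  refine ⟨D, fun F G h hm => ?_⟩
  set K := ∫ z, (G z) ^ 2 ∂nu with hK
  have hK0 : 0 ≤ K := integral_nonneg fun z => sq_nonneg _
  have h1 := integral_rpow_le hp₂.le h.mF (abs_le_sup h μ K hm.le le_rfl)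
  rw [hm] at h1
  have h2 : Real.sqrt (2 * μ + 2 * K) ^ (p - 2) = (2 * μ + 2 * K) ^ ((p - 2) / 2) := by
    rw [Real.sqrt_eq_rpow, ← Real.rpow_mul (by positivity)]
    congr 1
    ring
  rw [h2] at h1
  have h3 := hD (2 * μ + 2 * K) (by positivity)
  unfold En
  rw [← hK]
  have h4 : (1 / p) * ∫ z, |F z| ^ p ∂nu ≤ μ / p * (2 * μ + 2 * K) ^ ((p - 2) / 2) := by
    calc (1 / p) * ∫ z, |F z| ^ p ∂nu ≤ (1 / p) * ((2 * μ + 2 * K) ^ ((p - 2) / 2) * μ) := by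
          gcongr
      _ = _ := by ring
  linarith

lemma scaling (p μ : ℝ) (hp₂ : 2 < p) (v : GridFunc) (hv : H1 (uF v) (uG v))
    (m : ℝ) (hm : ∫ z, (uF v z) ^ 2 ∂nu = m) (hm0 : 0 < m) (hmμ : m ≤ μ) :
    ∃ w : GridFunc, w.MemH1 ∧ w.mass = μ ∧ w.energy p ≤ (μ / m) * En p (uF v) (uG v) := by
  set t := Real.sqrt (μ / m) with ht
  have hq1 : 1 ≤ μ / m := by rwa [le_div_iff₀ hm0, one_mul]
  have ht2 : t ^ 2 = μ / m := Real.sq_sqrt (by linarith)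
  have ht1 : 1 ≤ t := by rw [ht]; exact Real.one_le_sqrt.2 hq1
  have hl := hv.lin hv t 0
  have hc : ∀ j k : ℤ, (fun z => t * uF v z + 0 * uF v z) ((true, j), (k : ℝ)) =
      (fun z => t * uF v z + 0 * uF v z) ((false, k), (j : ℝ)) := by
    intro j k
    simp only [uF_compat]
  set w := mkU (fun z => t * uF v z + 0 * uF v z) (fun z => t * uG v z + 0 * uG v z) hc with hw
  have hwF : uF w = fun z => t * uF v z + 0 * uF v z := uF_mkU _ _ _
  have hwG : uG w = fun z => t * uG v z + 0 * uG v z := uG_mkU _ _ _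
  have hwH : H1 (uF w) (uG w) := by rw [hwF, hwG]; exact hl
  refine ⟨w, (memH1_iff w).2 hwH, ?_, ?_⟩
  · rw [mass_eq w hwH, hwF]
    have : ∀ z, (t * uF v z + 0 * uF v z) ^ 2 = t ^ 2 * (uF v z) ^ 2 := fun z => by ring
    simp only [this]
    rw [integral_const_mul, hm, ht2]
    field_simp
  · rw [energy_eq w hwH p (by linarith), hwF, hwG]
    unfold En
    have e1 : ∀ z, (t * uG v z + 0 * uG v z) ^ 2 = t ^ 2 * (uG v z) ^ 2 := fun z => by ring
    have e2 : ∀ z, |t * uF v z + 0 * uF v z| ^ p = t ^ p * |uF v z| ^ p := fun z => by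
      rw [zero_mul, add_zero, abs_mul, abs_of_nonneg (by linarith : 0 ≤ t),
        Real.mul_rpow (by linarith) (abs_nonneg _)]
    simp only [e1, e2]
    rw [integral_const_mul, integral_const_mul, ← ht2]
    have hP : 0 ≤ ∫ z, |uF v z| ^ p ∂nu :=
      integral_nonneg fun z => Real.rpow_nonneg (abs_nonneg _) _
    have htp : t ^ 2 ≤ t ^ p := by
      rw [← Real.rpow_natCast]
      exact Real.rpow_le_rpow_of_exponent_le ht1 (by norm_num; linarith)
    have h3 : (1 / p) * (t ^ 2 * ∫ z, |uF v z| ^ p ∂nu) ≤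
        (1 / p) * (t ^ p * ∫ z, |uF v z| ^ p ∂nu) := by gcongr
    linarith

lemma lower (p μ : ℝ) (hp₂ : 2 < p) (hμ : 0 < μ) (e : ℝ)
    (he : ∀ w : GridFunc, w.MemH1 → w.mass = μ → e ≤ w.energy p)
    (v : GridFunc) (hv : H1 (uF v) (uG v)) (hmμ : ∫ z, (uF v z) ^ 2 ∂nu ≤ μ) :
    (∫ z, (uF v z) ^ 2 ∂nu) / μ * e ≤ En p (uF v) (uG v) := by
  set m := ∫ z, (uF v z) ^ 2 ∂nu with hm
  have hm0 : 0 ≤ m := integral_nonneg fun z => sq_nonneg _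
  rcases hm0.eq_or_lt with h | h
  · have h1 := integral_rpow_le hp₂.le hv.mF (abs_le_sup hv _ _ le_rfl le_rfl)
    rw [← hm, ← h, mul_zero] at h1
    have hK0 : 0 ≤ ∫ z, (uG v z) ^ 2 ∂nu := integral_nonneg fun z => sq_nonneg _
    rw [← h]
    unfold En
    have : (1 / p) * ∫ z, |uF v z| ^ p ∂nu ≤ 0 :=
      mul_nonpos_of_nonneg_of_nonpos (by positivity) h1
    simp only [zero_div, zero_mul]
    linarith
  · obtain ⟨w, h1, h2, h3⟩ := scaling p μ hp₂ v hv m hm.symm h hmμ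
    have h4 := (he w h1 h2).trans h3
    calc m / μ * e ≤ m / μ * (μ / m * En p (uF v) (uG v)) := by gcongr
      _ = _ := by field_simp

theorem main (p μ : ℝ) (hp₂ : 2 < p) (hp₄ : p < 4) (hμ : 0 < μ) :
    ∃ u : GridFunc, IsGroundState p μ u ∧ u.energy p < 0 := by
  obtain ⟨D, hD⟩ := coercive p μ hp₂ hp₄ hμ
  have hp0 : 0 ≤ p := by linarith
  have hco : ∀ u : GridFunc, u.MemH1 → u.mass = μ →
      (∫ z, (uG u z) ^ 2 ∂nu) / 4 - μ / 4 - D ≤ u.energy p := fun u hu hm => by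
    have h := (memH1_iff u).1 hu
    rw [energy_eq u h p hp0]
    exact hD _ _ h (by rw [← mass_eq u h, hm])
  have hbb : BddBelow (energySet p μ) := by
    refine ⟨- μ / 4 - D, ?_⟩
    rintro _ ⟨u, hu, hm, rfl⟩
    have h1 := hco u hu hm
    have hK0 : 0 ≤ ∫ z, (uG u z) ^ 2 ∂nu := integral_nonneg fun z => sq_nonneg _
    linarith
  obtain ⟨u0, hu0, hm0, he0⟩ := test_neg p μ hp₂ hp₄ hμ
  set e := sInf (energySet p μ) with hedef
  have hne : (energySet p μ).Nonempty := ⟨_, u0, hu0, hm0, rfl⟩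
  have hle : ∀ w : GridFunc, w.MemH1 → w.mass = μ → e ≤ w.energy p := fun w h1 h2 =>
    csInf_le hbb ⟨w, h1, h2, rfl⟩
  have he : e < 0 := (hle u0 hu0 hm0).trans_lt he0
  set δ := (-p * e / (4 * μ)) ^ (1 / (p - 2)) with hδ
  have hb0 : 0 < -p * e / (4 * μ) := by
    apply div_pos _ (by positivity)
    nlinarith
  have hδ0 : 0 < δ := Real.rpow_pos_of_pos hb0 _
  have hδp : δ ^ (p - 2) = -p * e / (4 * μ) := by
    rw [hδ, ← Real.rpow_mul hb0.le, one_div, inv_mul_cancel₀ (by linarith), Real.rpow_one]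
  -- a normalized minimizing sequence
  obtain ⟨s, _, hs, hsm⟩ := exists_seq_tendsto_sInf hne hbb
  have hmin : ∃ u : ℕ → GridFunc, (∀ n, (u n).MemH1 ∧ (u n).mass = μ ∧
      (u n).energy p < e / 2 ∧ ∃ x ∈ Set.Icc (0:ℝ) 1, δ ≤ |uF (u n) ((true, 0), x)|) ∧
      Tendsto (fun n => (u n).energy p) atTop (𝓝 e) := by
    have hev := hs.eventually (gt_mem_nhds (show e < e / 2 by linarith))
    obtain ⟨N, hN⟩ := hev.exists_forall_of_atTop
    have hex : ∀ n : ℕ, ∃ u : GridFunc, u.MemH1 ∧ u.mass = μ ∧ u.energy p = s (n + N) ∧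
        ∃ x ∈ Set.Icc (0:ℝ) 1, δ ≤ |uF u ((true, 0), x)| := by
      intro n
      obtain ⟨u, hu, hm, hes⟩ := hsm (n + N)
      have hlt := hN (n + N) (by omega)
      have h := (memH1_iff u).1 hu
      have hz : ∃ z, δ ≤ |uF u z| := by
        by_contra hcon
        push Not at hcon
        have h1 := integral_rpow_le hp₂.le h.mF (fun z => (hcon z).le)
        rw [← mass_eq u h, hm, hδp] at h1
        have h2 : -p * e / (4 * μ) * μ = -p * e / 4 := by field_simp
        rw [h2] at h1
        rw [← hes, energy_eq u h p hp0] at hlt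
        unfold En at hlt
        have hK0 : 0 ≤ ∫ z, (uG u z) ^ 2 ∂nu := integral_nonneg fun z => sq_nonneg _
        have h3 : (1 / p) * ∫ z, |uF u z| ^ p ∂nu ≤ (1 / p) * (-p * e / 4) := by gcongr
        have h4 : (1 / p) * (-p * e / 4) = - e / 4 := by field_simp
        linarith
      obtain ⟨z, hz⟩ := hz
      obtain ⟨v, h1, h2, h3, h4⟩ := normalize p u hu δ z hz
      exact ⟨v, h1, h2.trans hm, h3.trans hes, h4⟩
    choose u h1 h2 h3 h4 using hex
    refine ⟨u, fun n => ⟨h1 n, h2 n, ?_, h4 n⟩, ?_⟩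
    · rw [h3]
      exact hN _ (by omega)
    · simp only [h3]
      exact (tendsto_add_atTop_iff_nat N).2 hs
  obtain ⟨u, hu, hue⟩ := hmin
  have hH : ∀ n, H1 (uF (u n)) (uG (u n)) := fun n => (memH1_iff _).1 (hu n).1
  choose x hx hxδ using fun n => (hu n).2.2.2
  have hmass : ∀ n, ∫ z, (uF (u n) z) ^ 2 ∂nu = μ := fun n => by
    rw [← mass_eq _ (hH n), (hu n).2.1]
  set B := μ + 4 * D with hBd
  have hB : ∀ n, ∫ z, (uG (u n) z) ^ 2 ∂nu ≤ B := fun n => by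
    have := hco (u n) (hu n).1 (hu n).2.1
    have := (hu n).2.2.1
    linarith
  obtain ⟨v, φ, hφ, hv, hpt, hkin, hmpos⟩ :=
    compact_limit u hH μ B (fun n => (hmass n).le) hB x hx δ hδ0 hxδ
  set m := ∫ z, (uF v z) ^ 2 ∂nu with hm
  -- the remainder
  have hc : ∀ n, ∀ j k : ℤ, (fun z => 1 * uF (u (φ n)) z + (-1) * uF v z) ((true, j), (k : ℝ)) =
      (fun z => 1 * uF (u (φ n)) z + (-1) * uF v z) ((false, k), (j : ℝ)) := by
    intro n j k
    simp only [uF_compat]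
  let V : ℕ → GridFunc := fun n =>
    mkU (fun z => 1 * uF (u (φ n)) z + (-1) * uF v z)
      (fun z => 1 * uG (u (φ n)) z + (-1) * uG v z) (hc n)
  have hVF : ∀ n, uF (V n) = fun z => uF (u (φ n)) z - uF v z := fun n => by
    rw [uF_mkU]; funext z; ring
  have hVG : ∀ n, uG (V n) = fun z => uG (u (φ n)) z - uG v z := fun n => by
    rw [uG_mkU]; funext z; ring
  have hVH : ∀ n, H1 (uF (V n)) (uG (V n)) := fun n => by
    rw [uF_mkU, uG_mkU]; exact (hH (φ n)).lin hv 1 (-1)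
  set M1 := Real.sqrt (2 * μ + 2 * B)
  set M2 := Real.sqrt (2 * m + 2 * ∫ z, (uG v z) ^ 2 ∂nu)
  have hb1 : ∀ n z, |uF (u n) z| ≤ M1 := fun n z =>
    abs_le_sup (hH n) μ B (hmass n).le (hB n) z
  have hb2 : ∀ z, |uF v z| ≤ M2 := fun z => abs_le_sup hv _ _ le_rfl le_rfl z
  have hM1 : 0 ≤ M1 := Real.sqrt_nonneg _
  have hbM : ∀ n z, |uF (u (φ n)) z - uF v z| ≤ M1 + M2 := fun n z =>
    (abs_sub _ _).trans (add_le_add (hb1 _ z) (hb2 z))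
  have hbM2 : ∀ z, |uF v z| ≤ M1 + M2 := fun z => (hb2 z).trans (by linarith)
  have hR : ∀ n, ∫ z, (uF (u (φ n)) z - uF v z) ^ 2 ∂nu ≤ 2 * μ + 2 * m := fun n => by
    have i1 := (hH (φ n)).mF.integrable_sq
    have i2 := hv.mF.integrable_sq
    have : ∫ z, (2 * (uF (u (φ n)) z) ^ 2 + 2 * (uF v z) ^ 2) ∂nu = 2 * μ + 2 * m := by
      rw [integral_add (i1.const_mul 2) (i2.const_mul 2), integral_const_mul, integral_const_mul,
        hmass]
    rw [← this]
    refine integral_mono ((hH (φ n)).mF.sub hv.mF).integrable_sq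
      ((i1.const_mul 2).add (i2.const_mul 2)) fun z => ?_
    simp only
    nlinarith [sq_nonneg (uF (u (φ n)) z + uF v z)]
  have sp := split_tendsto p (M1 + M2) _ hp₂.le (fun n => (hH (φ n)).mF) hv.mF hR hbM hbM2 hpt
  have s2 := split_tendsto 2 (M1 + M2) _ le_rfl (fun n => (hH (φ n)).mF) hv.mF hR hbM hbM2 hpt
  simp only [Real.rpow_two, sq_abs, hmass] at s2
  rw [← hm] at s2
  have hmV : Tendsto (fun n => ∫ z, (uF (V n) z) ^ 2 ∂nu) atTop (𝓝 (μ - m)) := by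
    have := s2.const_sub μ
    refine this.congr fun n => ?_
    rw [hVF]
    ring
  have hmμ : m ≤ μ := by
    have := ge_of_tendsto' hmV fun n => integral_nonneg fun z => sq_nonneg _
    linarith
  have hEsplit : Tendsto (fun n => (u (φ n)).energy p - En p (uF (V n)) (uG (V n))) atTop
      (𝓝 (En p (uF v) (uG v))) := by
    have := (hkin.const_mul (1 / 2)).sub (sp.const_mul (1 / p))
    refine this.congr fun n => ?_
    rw [energy_eq _ (hH (φ n)) p hp0, hVF, hVG]
    unfold En
    ring
  have hupper : Tendsto (fun n => (u (φ n)).energy p - (∫ z, (uF (V n) z) ^ 2 ∂nu) / μ * e) atTop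
      (𝓝 (e - (μ - m) / μ * e)) :=
    (hue.comp hφ.tendsto_atTop).sub ((hmV.div_const μ).mul_const e)
  have hEv : En p (uF v) (uG v) ≤ e - (μ - m) / μ * e := by
    refine le_of_tendsto_of_tendsto hEsplit hupper ?_
    filter_upwards [hmV.eventually (gt_mem_nhds (show μ - m < μ by linarith))] with n hn
    have := lower p μ hp₂ hμ e hle (V n) (hVH n) hn.le
    linarith
  have hEv' : En p (uF v) (uG v) ≤ m / μ * e := by
    refine hEv.trans (le_of_eq ?_)
    field_simp
    ring
  obtain ⟨w, w1, w2, w3⟩ := scaling p μ hp₂ v hv m hm.symm hmpos hmμ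
  have hw : w.energy p ≤ e := by
    refine w3.trans ?_
    calc μ / m * En p (uF v) (uG v) ≤ μ / m * (m / μ * e) := by gcongr
      _ = e := by field_simp
  exact ⟨w, ⟨w1, w2, fun z h1 h2 => hw.trans (hle z h1 h2)⟩, hw.trans_lt he⟩

end GridAux

end
noncomputable section

/-- **Subcritical existence (Theorem 1.1)**: for every `2 < p < 4` and every
`μ > 0` there exists a ground state of mass `μ` on the grid 𝒢, and the
ground-state energy level `ℰ_p(μ)` is negative. -/
theorem grid_subcritical_existence (p μ : ℝ) (hp₂ : 2 < p) (hp₄ : p < 4)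
    (hμ : 0 < μ) :
    ∃ u : GridFunc, IsGroundState p μ u ∧ u.energy p < 0 := by
  exact GridAux.main p μ hp₂ hp₄ hμ

end
end
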